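/- Let G be a finite insoluble group. If G is biminimal non-nilpotent, then G is isomorphic to A₅ or to SL(2,5). -/

import Mathlib

/-- A group is *minimal non-nilpotent* if it is not nilpotent but every proper
subgroup of it is nilpotent. -/
def MinimalNonNilpotent (G : Type*) [Group G] : Prop :=
  ¬ Group.IsNilpotent G ∧ ∀ H : Subgroup G, H ≠ ⊤ → Group.IsNilpotent H

/-- A group is *biminimal non-nilpotent* if it is neither nilpotent nor minimal
non-nilpotent, but every proper subgroup of it is nilpotent or minimal non-nilpotent. -/
def BiminimalNonNilpotent (G : Type*) [Group G] : Prop :=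
  ¬ Group.IsNilpotent G ∧ ¬ MinimalNonNilpotent G ∧
    ∀ H : Subgroup G, H ≠ ⊤ → (Group.IsNilpotent H ∨ MinimalNonNilpotent H)

/-- A group is *para-Nil-Hamiltonian* if it is not nilpotent and every non-normal
subgroup of it is either nilpotent or minimal non-nilpotent. -/
def ParaNilHamiltonian (G : Type*) [Group G] : Prop :=
  ¬ Group.IsNilpotent G ∧
    ∀ H : Subgroup G, ¬ H.Normal → (Group.IsNilpotent H ∨ MinimalNonNilpotent H)

/-- A group is *meta-Nil-Hamiltonian* if every non-nilpotent subgroup of it is normal. -/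
def MetaNilHamiltonian (G : Type*) [Group G] : Prop :=
  ∀ H : Subgroup G, ¬ Group.IsNilpotent H → H.Normal

/-- A group is *locally graded* if every non-trivial finitely generated subgroup of it
contains a proper subgroup of finite index. -/
def LocallyGraded (G : Type*) [Group G] : Prop :=
  ∀ H : Subgroup G, H ≠ ⊥ → Group.FG H → ∃ K : Subgroup H, K ≠ ⊤ ∧ K.FiniteIndex

/-- A group is abelian if its multiplication commutes. -/
def Abelian (G : Type*) [Group G] : Prop := ∀ a b : G, a * b = b * a

/-- A group is *minimal non-abelian* if it is not abelian but every proper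
subgroup of it is abelian. -/
def MinimalNonAbelian (G : Type*) [Group G] : Prop :=
  ¬ Abelian G ∧ ∀ H : Subgroup G, H ≠ ⊤ → Abelian H

/-- A group is *biminimal non-abelian* if it is neither abelian nor minimal non-abelian,
but every proper subgroup of it is abelian or minimal non-abelian. -/
def BiminimalNonAbelian (G : Type*) [Group G] : Prop :=
  ¬ Abelian G ∧ ¬ MinimalNonAbelian G ∧
    ∀ H : Subgroup G, H ≠ ⊤ → (Abelian H ∨ MinimalNonAbelian H)

/-- A group is *parahamiltonian* if it is not abelian and every non-normal subgroup
of it is either abelian or minimal non-abelian. -/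
def Parahamiltonian (G : Type*) [Group G] : Prop :=
  ¬ Abelian G ∧ ∀ H : Subgroup G, ¬ H.Normal → (Abelian H ∨ MinimalNonAbelian H)

/-- A group is *locally nilpotent* if every finitely generated subgroup of it is nilpotent. -/
def LocallyNilpotent (G : Type*) [Group G] : Prop :=
  ∀ H : Subgroup G, Group.FG H → Group.IsNilpotent H

open scoped commutatorElement

set_option linter.unusedSectionVars false

section

open Subgroup

section General
variable {G : Type*} [Group G]

theorem mem_normalizer_of_conj_mem [Finite G] {H : Subgroup G} {g : G}
    (h : ∀ x ∈ H, g * x * g⁻¹ ∈ H) : g ∈ normalizer (H : Set G) := by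
  rw [mem_normalizer_iff_map_conj_eq]
  refine eq_of_le_of_card_ge ?_ ?_
  · rintro _ ⟨x, hx, rfl⟩
    exact h x hx
  · rw [card_map_of_injective (MulAut.conj g).injective]

theorem conj_mem_of_mem_normalizer {H : Subgroup G} {g x : G}
    (hg : g ∈ normalizer (H : Set G)) (hx : x ∈ H) : g * x * g⁻¹ ∈ H :=
  (mem_normalizer_iff.1 hg x).1 hx

theorem pow_eq_one_of_coprime_pow {x : G} {m n : ℕ} (h : m.Coprime n) (hm : x ^ m = 1)
    (hn : x ^ n = 1) : x = 1 := by
  rw [← orderOf_eq_one_iff]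
  exact Nat.eq_one_of_dvd_coprimes h (orderOf_dvd_of_pow_eq_one hm) (orderOf_dvd_of_pow_eq_one hn)

theorem commute_of_coprime_orderOf [Finite G] [Group.IsNilpotent G] {x y : G}
    (h : (orderOf x).Coprime (orderOf y)) : Commute x y := by
  have hnil : Group.IsNilpotent G := inferInstance
  obtain ⟨e⟩ := ((Group.isNilpotent_of_finite_tfae (G := G)).out 0 4).1 hnil
  suffices Commute (e.symm x) (e.symm y) by simpa using this.map e
  refine funext fun p => funext fun P => ?_
  have hp : Fact (p : ℕ).Prime := ⟨Nat.prime_of_mem_primeFactors p.2⟩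
  have hx : e.symm x p P ^ orderOf x = 1 := by
    have : e.symm x ^ orderOf x = 1 := by rw [← map_pow, pow_orderOf_eq_one, map_one]
    exact congrFun (congrFun this p) P
  have hy : e.symm y p P ^ orderOf y = 1 := by
    have : e.symm y ^ orderOf y = 1 := by rw [← map_pow, pow_orderOf_eq_one, map_one]
    exact congrFun (congrFun this p) P
  obtain ⟨i, hi⟩ := P.2 (e.symm x p P)
  obtain ⟨j, hj⟩ := P.2 (e.symm y p P)
  have : ((p : ℕ) ^ i).Coprime (orderOf x) ∨ ((p : ℕ) ^ j).Coprime (orderOf y) := by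
    by_cases hpx : (p : ℕ) ∣ orderOf x
    · right
      refine Nat.Coprime.pow_left _ ((Nat.Prime.coprime_iff_not_dvd hp.1).2 fun hpy => ?_)
      exact hp.1.one_lt.ne' (Nat.eq_one_of_dvd_coprimes h hpx hpy)
    · left
      exact Nat.Coprime.pow_left _ ((Nat.Prime.coprime_iff_not_dvd hp.1).2 hpx)
  show e.symm x p P * e.symm y p P = e.symm y p P * e.symm x p P
  rcases this with h | h
  · rw [pow_eq_one_of_coprime_pow h hi hx]; simp
  · rw [pow_eq_one_of_coprime_pow h hj hy]; simp

theorem Subgroup.commute_of_coprime_orderOf [Finite G] {H : Subgroup G} (hH : Group.IsNilpotent H)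
    {x y : G} (hx : x ∈ H) (hy : y ∈ H) (h : (orderOf x).Coprime (orderOf y)) : Commute x y := by
  have := _root_.commute_of_coprime_orderOf (G := H) (x := ⟨x, hx⟩) (y := ⟨y, hy⟩)
    (by simpa using h)
  exact this.map H.subtype

theorem isNilpotent_of_le {H K : Subgroup G} (hK : Group.IsNilpotent K) (h : H ≤ K) :
    Group.IsNilpotent H :=
  Group.nilpotent_of_mulEquiv (subgroupOfEquivOfLe h)

theorem exists_mem_normalizer_of_lt_of_isNilpotent {D M : Subgroup G} (hM : Group.IsNilpotent M)
    (h : D < M) : ∃ x ∈ M, x ∉ D ∧ x ∈ normalizer (D : Set G) := by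
  have hlt : D.subgroupOf M < ⊤ := by
    rw [lt_top_iff_ne_top, Ne, subgroupOf_eq_top]
    exact h.not_ge
  obtain ⟨x, hx, hxD⟩ := SetLike.exists_of_lt (Group.normalizerCondition_of_isNilpotent _ hlt)
  refine ⟨x, x.2, fun h => hxD h, ?_⟩
  rw [mem_normalizer_iff] at hx ⊢
  intro d
  constructor
  · intro hd
    exact (hx ⟨d, h.le hd⟩).1 hd
  · intro hd
    have hdM : d ∈ M := by
      have := M.mul_mem (M.mul_mem (M.inv_mem x.2) (h.le hd)) x.2
      simpa [mul_assoc] using this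
    exact (hx ⟨d, hdM⟩).2 hd

/-- If `A` meets its conjugates only through `N`, then it has many conjugates. -/
theorem card_mul_card_le_card_mul_card_conjugates [Fintype G] [DecidableEq G] (A : Finset G)
    (N : Subgroup G)
    (h : ∀ g : G, ∀ a ∈ A, g * a * g⁻¹ ∈ A → g ∈ N) :
    Fintype.card G * A.card ≤
      Nat.card N * ((Finset.univ ×ˢ A).image fun x : G × G => x.1 * x.2 * x.1⁻¹).card := by
  classical
  rw [← Finset.card_univ, ← Finset.card_product]
  refine Finset.card_le_mul_card_image _ _ fun b hb => ?_
  simp only [Finset.mem_image, Finset.mem_product, Finset.mem_univ, true_and, Prod.exists] at hb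
  obtain ⟨g, a, ha, rfl⟩ := hb
  rw [Nat.card_eq_fintype_card, ← Fintype.card_coe]
  refine Fintype.card_le_of_injective
    (fun z => (⟨g⁻¹ * z.1.1, ?_⟩ : N)) ?_
  · obtain ⟨⟨g', a'⟩, hz⟩ := z
    simp only [Finset.mem_filter, Finset.mem_product, Finset.mem_univ, true_and] at hz
    refine h _ a' hz.1 ?_
    have : g⁻¹ * g' * a' * (g⁻¹ * g')⁻¹ = g⁻¹ * (g' * a' * g'⁻¹) * g := by group
    rw [this, hz.2]
    simpa [mul_assoc] using ha
  · rintro ⟨⟨g₁, a₁⟩, h₁⟩ ⟨⟨g₂, a₂⟩, h₂⟩ h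
    simp only [Finset.mem_filter, Finset.mem_product, Finset.mem_univ, true_and,
      Subtype.mk.injEq, mul_right_inj] at h h₁ h₂
    subst h
    have := h₁.2.trans h₂.2.symm
    simp only [mul_left_inj, mul_right_inj] at this
    simp [this]

theorem Subgroup.exists_forall_conj_not_mem [Finite G] {M : Subgroup G} (hM : M ≠ ⊤) :
    ∃ x : G, ∀ g : G, g⁻¹ * x * g ∉ M := by
  classical
  have := Fintype.ofFinite G
  by_contra! hcon
  have key := MulAction.sum_card_fixedBy_eq_card_orbits_mul_card_group G (G ⧸ M)
  have h1 : Fintype.card (MulAction.orbitRel.Quotient G (G ⧸ M)) = 1 := by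
    rw [Fintype.card_eq_one_iff_nonempty_unique]
    have := (MulAction.pretransitive_iff_unique_quotient_of_nonempty G (G ⧸ M)).1 inferInstance
    exact this
  rw [h1, one_mul] at key
  have h2 : ∀ x : G, 1 ≤ Fintype.card (MulAction.fixedBy (G ⧸ M) x) := by
    intro x
    obtain ⟨g, hg⟩ := hcon x
    refine Fintype.card_pos_iff.2 ⟨⟨(g : G ⧸ M), ?_⟩⟩
    rw [MulAction.mem_fixedBy]
    show ((x * g : G) : G ⧸ M) = g
    rw [eq_comm, QuotientGroup.eq]
    simpa [mul_assoc] using hg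
  have h3 : 1 < Fintype.card (MulAction.fixedBy (G ⧸ M) (1 : G)) := by
    have : Fintype.card (MulAction.fixedBy (G ⧸ M) (1 : G)) = M.index := by
      rw [← Nat.card_eq_fintype_card, Subgroup.index]
      exact Nat.card_congr ((Equiv.setCongr (by simp)).trans (Equiv.Set.univ _))
    rw [this]
    have h0 : M.index ≠ 0 := index_ne_zero_of_finite
    have h1 : M.index ≠ 1 := by rwa [Ne, index_eq_one]
    omega
  have : ∑ _x : G, 1 < ∑ x : G, Fintype.card (MulAction.fixedBy (G ⧸ M) x) :=
    Finset.sum_lt_sum (fun x _ => h2 x) ⟨1, Finset.mem_univ _, h3⟩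
  rw [key] at this
  simp at this

theorem Subgroup.index_prime_of_isCoatom_of_normal [Finite G] {M : Subgroup G} [hn : M.Normal]
    (hM : IsCoatom M) : M.index.Prime := by
  have h1 : M.index ≠ 1 := by rw [Ne, index_eq_one]; exact hM.1
  obtain ⟨p, hp, hpd⟩ := Nat.exists_prime_and_dvd h1
  have : Fact p.Prime := ⟨hp⟩
  obtain ⟨x, hx⟩ := exists_prime_orderOf_dvd_card' (G := G ⧸ M) p hpd
  have hlt : M < (zpowers x).comap (QuotientGroup.mk' M) := by
    refine lt_of_le_of_ne ?_ fun h => ?_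
    · intro m hm
      have : (m : G ⧸ M) = 1 := (QuotientGroup.eq_one_iff m).2 hm
      rw [mem_comap]
      simp [this]
    · obtain ⟨g, rfl⟩ := QuotientGroup.mk'_surjective M x
      have hg : g ∈ (zpowers (QuotientGroup.mk' M g)).comap (QuotientGroup.mk' M) :=
        mem_zpowers (QuotientGroup.mk' M g)
      rw [← h] at hg
      rw [show QuotientGroup.mk' M g = 1 from (QuotientGroup.eq_one_iff g).2 hg, orderOf_one] at hx
      exact hp.one_lt.ne hx
  have htop := hM.2 _ hlt
  have hz : zpowers x = ⊤ := by
    rw [eq_top_iff]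
    intro z _
    obtain ⟨g, rfl⟩ := QuotientGroup.mk'_surjective M z
    have : g ∈ (zpowers x).comap (QuotientGroup.mk' M) := by rw [htop]; trivial
    exact this
  have : M.index = p := by
    rw [Subgroup.index, ← Subgroup.card_top (G := G ⧸ M), ← hz, Nat.card_zpowers, hx]
  rwa [this]

/-- A subgroup containing a Sylow subgroup for each prime is everything. -/
theorem Subgroup.eq_top_of_forall_sylow_le [Finite G] {K : Subgroup G}
    (h : ∀ p : ℕ, p.Prime → ∃ P : Sylow p G, (P : Subgroup G) ≤ K) : K = ⊤ := by
  by_contra hK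
  have h1 : K.index ≠ 1 := by rwa [Ne, index_eq_one]
  obtain ⟨p, hp, hpd⟩ := Nat.exists_prime_and_dvd h1
  obtain ⟨P, hP⟩ := h p hp
  have : Fact p.Prime := ⟨hp⟩
  exact P.not_dvd_index (hpd.trans (index_dvd_of_le hP))

end General

theorem card_conj_proper_lt {n k m : ℕ} (h : n * (m - 1) ≤ m * k) (hm : 2 ≤ m) : n ≤ 2 * k := by
  obtain ⟨m, rfl⟩ := Nat.exists_eq_add_of_le hm
  rw [show 2 + m - 1 = m + 1 by omega] at h
  nlinarith

theorem isSolvable_of_proper_isNilpotent {G : Type*} [Group G] [Finite G]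
    (h : ∀ H : Subgroup G, H ≠ ⊤ → Group.IsNilpotent H) : Group.IsSolvable G := by
  classical
  induction hn : Nat.card G using Nat.strong_induction_on generalizing G with
  | _ n ih =>
  subst hn
  by_cases hnil : Group.IsNilpotent G
  · infer_instance
  by_cases hN : ∃ N : Subgroup G, N.Normal ∧ N ≠ ⊥ ∧ N ≠ ⊤
  · obtain ⟨N, hNn, hNb, hNt⟩ := hN
    have hNnil := h N hNt
    have : Group.IsSolvable (G ⧸ N) := by
      refine ih _ ?_ ?_ rfl
      · have := card_eq_card_quotient_mul_card_subgroup N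
        have h1 : 1 < Nat.card N := by
          rwa [one_lt_card_iff_ne_bot]
        have h2 : 0 < Nat.card (G ⧸ N) := Nat.card_pos
        nlinarith
      · intro H hH
        have hc : H.comap (QuotientGroup.mk' N) ≠ ⊤ := by
          intro hc
          apply hH
          rw [← map_comap_eq_self_of_surjective (QuotientGroup.mk'_surjective N) H, hc,
            map_top_of_surjective _ (QuotientGroup.mk'_surjective N)]
        have := h _ hc
        have hs := (QuotientGroup.mk' N).subgroupComap_surjective_of_surjective H
          (QuotientGroup.mk'_surjective N)
        exact Group.nilpotent_of_surjective _ hs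
    refine Group.isSolvable_of_ker_le_range N.subtype (QuotientGroup.mk' N) (by simp)
  push Not at hN
  exfalso
  have hco : ¬ ∀ H : Subgroup G, IsCoatom H → H.Normal := fun hc =>
    hnil (((Group.isNilpotent_of_finite_tfae (G := G)).out 0 2).2 hc)
  push Not at hco
  obtain ⟨M, hM, hMn⟩ := hco
  have hbot : ∀ K : Subgroup G, IsCoatom K → K ≠ ⊥ := by
    rintro K hK rfl
    rcases eq_or_ne M ⊥ with rfl | hMb
    · exact hMn inferInstance
    · exact hM.1 (hK.2 M (bot_lt_iff_ne_bot.2 hMb))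
  have hnorm : ∀ K : Subgroup G, K ≠ ⊥ → K ≠ ⊤ → normalizer (K : Set G) ≠ ⊤ := by
    intro K hb ht hK
    exact ht (hN K (normalizer_eq_top_iff.1 hK) hb)
  have hself : ∀ K : Subgroup G, IsCoatom K → normalizer (K : Set G) = K := by
    intro K hK
    by_contra hne
    exact hnorm K (hbot K hK) hK.1 (hK.2 _ (lt_of_le_of_ne le_normalizer (Ne.symm hne)))
  -- distinct maximal subgroups intersect trivially
  have hdisj : ∀ K L : Subgroup G, IsCoatom K → IsCoatom L → K ≠ L → K ⊓ L = ⊥ := by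
    by_contra! hcon
    obtain ⟨K₀, L₀, hK₀, hL₀, hKL₀, hi₀⟩ := hcon
    obtain ⟨⟨K, L⟩, ⟨hK, hL, hKL, hi⟩, hmax⟩ := Set.exists_max_image
      {x : Subgroup G × Subgroup G | IsCoatom x.1 ∧ IsCoatom x.2 ∧ x.1 ≠ x.2 ∧ x.1 ⊓ x.2 ≠ ⊥}
      (fun x => Nat.card (x.1 ⊓ x.2 : Subgroup G)) (Set.toFinite _)
      ⟨(K₀, L₀), hK₀, hL₀, hKL₀, hi₀⟩
    simp only at hK hL hKL hi hmax
    have hDK : K ⊓ L < K := by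
      refine lt_of_le_of_ne inf_le_left fun h => hKL ?_
      by_contra hne
      exact hL.1 (hK.2 L (lt_of_le_of_ne (inf_eq_left.1 h) hne))
    have hDL : K ⊓ L < L := by
      refine lt_of_le_of_ne inf_le_right fun h => hKL ?_
      by_contra hne
      exact hK.1 (hL.2 K (lt_of_le_of_ne (inf_eq_right.1 h) (Ne.symm hne)))
    have hDt : K ⊓ L ≠ ⊤ := fun h => hK.1 (top_le_iff.1 (h ▸ inf_le_left))
    obtain ⟨M₃, hM₃, hle⟩ := (eq_top_or_exists_le_coatom
      (normalizer ((K ⊓ L : Subgroup G) : Set G))).resolve_left (hnorm _ hi hDt)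
    have aux : ∀ A : Subgroup G, IsCoatom A → K ⊓ L < A → A = M₃ := by
      intro A hA hlt
      by_contra hne
      obtain ⟨x, hxA, hxD, hxN⟩ := exists_mem_normalizer_of_lt_of_isNilpotent (h A hA.1) hlt
      have hlt2 : K ⊓ L < A ⊓ M₃ := by
        refine lt_of_le_of_ne (le_inf hlt.le (le_normalizer.trans hle)) fun h => hxD ?_
        rw [h]
        exact ⟨hxA, hle hxN⟩
      have := hmax (A, M₃) ⟨hA, hM₃, hne, (bot_le.trans_lt hlt2).ne'⟩
      have h2 := Set.ncard_lt_ncard (SetLike.coe_ssubset_coe.2 hlt2) (Set.toFinite _)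
      rw [Set.ncard_def, Set.encard] at h2
      simp only at this
      exact absurd h2 (not_lt.2 this)
    exact hKL ((aux K hK hDK).trans (aux L hL hDL).symm)
  have := Fintype.ofFinite G
  obtain ⟨x, hx⟩ := exists_forall_conj_not_mem hM.1
  have hxt : zpowers x ≠ ⊤ := by
    intro h
    have : IsCyclic G := ⟨x, fun y => by
      have : y ∈ zpowers x := by rw [h]; trivial
      exact this⟩
    have : IsMulCommutative G := inferInstance
    let _ : CommGroup G := { (inferInstance : Group G) with mul_comm := fun a b => mul_comm' a b }
    exact hnil inferInstance
  obtain ⟨L, hL, hxL⟩ := (eq_top_or_exists_le_coatom (zpowers x)).resolve_left hxt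
  rw [zpowers_le] at hxL
  have hconj : ∀ (K : Subgroup G) (g : G), IsCoatom K →
      IsCoatom (K.map (MulAut.conj g).toMonoidHom) := by
    intro K g hK
    exact (MulAut.conj g).mapSubgroup.isCoatom_iff K |>.2 hK
  have hgen : ∀ (K L : Subgroup G) (g a : G), IsCoatom K → IsCoatom L → a ∈ K → a ≠ 1 →
      g * a * g⁻¹ ∈ L → K.map (MulAut.conj g).toMonoidHom = L := by
    intro K L g a hK hL ha ha1 hg
    by_contra hne
    have := hdisj _ L (hconj K g hK) hL hne
    have hm : g * a * g⁻¹ ∈ K.map (MulAut.conj g).toMonoidHom ⊓ L := ⟨⟨a, ha, rfl⟩, hg⟩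
    rw [this, mem_bot] at hm
    apply ha1
    simpa using hm
  let B : Subgroup G → Finset G := fun K => Finset.univ.filter fun y => y ∈ K ∧ y ≠ 1
  let I : Subgroup G → Finset G := fun K =>
    (Finset.univ ×ˢ B K).image fun x : G × G => x.1 * x.2 * x.1⁻¹
  have hcount : ∀ K : Subgroup G, IsCoatom K → Fintype.card G ≤ 2 * (I K).card := by
    intro K hK
    have h1 := card_mul_card_le_card_mul_card_conjugates (B K) K (by
      intro g a ha hg
      simp only [B, Finset.mem_filter, Finset.mem_univ, true_and] at ha hg
      rw [← hself K hK, mem_normalizer_iff_map_conj_eq]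
      exact hgen K K g a hK hK ha.1 ha.2 hg.1)
    have hB : (B K).card = Nat.card K - 1 := by
      have : B K = (Finset.univ.filter fun y => y ∈ K).erase 1 := by
        ext y; simp [B, and_comm]
      rw [this, Finset.card_erase_of_mem (by simp [K.one_mem]), Nat.card_eq_fintype_card,
        ← Fintype.card_subtype]
    rw [hB] at h1
    exact card_conj_proper_lt h1 ((one_lt_card_iff_ne_bot K).2 (hbot K hK))
  have hI : Disjoint (I M) (I L) := by
    rw [Finset.disjoint_left]
    intro z hz hz'
    simp only [I, B, Finset.mem_image, Finset.mem_product, Finset.mem_univ, true_and,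
      Finset.mem_filter, Prod.exists] at hz hz'
    obtain ⟨g, a, ⟨ha, ha1⟩, rfl⟩ := hz
    obtain ⟨k, b, ⟨hb, hb1⟩, hgb⟩ := hz'
    have := hgen M L (k⁻¹ * g) a hM hL ha ha1 (by
      have : k⁻¹ * g * a * (k⁻¹ * g)⁻¹ = k⁻¹ * (g * a * g⁻¹) * k := by group
      rw [this, ← hgb]
      simpa [mul_assoc] using hb)
    rw [← this] at hxL
    obtain ⟨m, hm, hmx⟩ := hxL
    apply hx (k⁻¹ * g)
    rw [← hmx]
    simpa [mul_assoc] using hm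
  have h1I : ∀ K : Subgroup G, (1 : G) ∉ I K := by
    intro K h
    simp [I, B] at h
  have hsub : I M ∪ I L ⊆ Finset.univ.erase 1 := by
    intro z hz
    refine Finset.mem_erase.2 ⟨?_, Finset.mem_univ _⟩
    rintro rfl
    rcases Finset.mem_union.1 hz with h | h
    · exact h1I M h
    · exact h1I L h
  have hc := Finset.card_le_card hsub
  rw [Finset.card_union_of_disjoint hI, Finset.card_erase_of_mem (Finset.mem_univ _),
    Finset.card_univ] at hc
  have h1 := hcount M hM
  have h2 := hcount L hL
  have h3 : 0 < Fintype.card G := Fintype.card_pos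
  omega

theorem MinimalNonNilpotent.exists_structure {G : Type*} [Group G] [Finite G]
    (h : MinimalNonNilpotent G) :
    ∃ p q : ℕ, p.Prime ∧ q.Prime ∧ p ≠ q ∧ ∃ (P : Subgroup G) (y : G), P.Normal ∧ IsPGroup p P ∧
      (∃ k, orderOf y = q ^ k) ∧ P ⊔ zpowers y = ⊤ ∧ (∀ g, Commute (y ^ q) g) ∧
      ¬ ∀ x ∈ P, Commute x y := by
  obtain ⟨hnil, hprop⟩ := h
  have hsol := isSolvable_of_proper_isNilpotent hprop
  have hnt : Nontrivial G := by
    by_contra hc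
    rw [not_nontrivial_iff_subsingleton] at hc
    exact hnil inferInstance
  obtain ⟨N, hN, hcN⟩ := (eq_top_or_exists_le_coatom (_root_.commutator G)).resolve_left
    (Group.IsSolvable.commutator_lt_top_of_nontrivial G).ne
  have hNn : N.Normal := Normal.of_commutator_le G hcN
  have hq := index_prime_of_isCoatom_of_normal hN
  set q := N.index with hqdef
  have hNnil := hprop N hN.1
  have hqN : ∀ g : G, g ^ q ∈ N := fun g => by rw [hqdef]; exact N.pow_index_mem g
  have hpN : ∀ p : ℕ, p.Prime → p ≠ q → ∀ g : G, (∃ k, g ^ p ^ k = 1) → g ∈ N := by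
    rintro p hp hpq g ⟨k, hk⟩
    rw [← QuotientGroup.eq_one_iff]
    refine pow_eq_one_of_coprime_pow (m := p ^ k) (n := q) ?_ ?_ ?_
    · exact Nat.Coprime.pow_left _ ((Nat.coprime_primes hp hq).2 hpq)
    · rw [← QuotientGroup.mk_pow, hk]; rfl
    · rw [← QuotientGroup.mk_pow]
      exact (QuotientGroup.eq_one_iff _).2 (hqN g)
  have hPN : ∀ p : ℕ, p.Prime → p ≠ q → ∀ P : Sylow p G, (P : Subgroup G) ≤ N := by
    intro p hp hpq P x hx
    obtain ⟨k, hk⟩ := P.2 ⟨x, hx⟩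
    exact hpN p hp hpq x ⟨k, by simpa using congrArg Subtype.val hk⟩
  have hPnorm : ∀ p : ℕ, p.Prime → p ≠ q → ∀ P : Sylow p G, (P : Subgroup G).Normal := by
    intro p hp hpq P
    have : Fact p.Prime := ⟨hp⟩
    have hle := hPN p hp hpq P
    have h1 : (P.subtype hle : Subgroup N).Normal := inferInstance
    have h2 := (P.subtype hle).characteristic_of_normal h1
    have h3 : ((P.subtype hle : Subgroup N).map N.subtype).Normal :=
      ConjAct.normal_of_characteristic_of_normal
    rwa [Sylow.coe_subtype, subgroupOf_map_subtype, inf_of_le_left hle] at h3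
  have : Fact q.Prime := ⟨hq⟩
  obtain ⟨Q⟩ : Nonempty (Sylow q G) := inferInstance
  have hQn : ¬ (Q : Subgroup G).Normal := by
    intro hQ
    refine hnil (((Group.isNilpotent_of_finite_tfae (G := G)).out 0 3).2 ?_)
    intro p hp P
    rcases eq_or_ne p q with rfl | hpq
    · have := Sylow.unique_of_normal Q hQ
      rwa [Subsingleton.elim P Q]
    · exact hPnorm p hp.1 hpq P
  have hcop : ∀ p : ℕ, p.Prime → p ≠ q → ∀ x y : G, (∃ k, x ^ p ^ k = 1) → (∃ k, y ^ q ^ k = 1) →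
      (orderOf x).Coprime (orderOf y) := by
    rintro p hp hpq x y ⟨k, hk⟩ ⟨l, hl⟩
    exact Nat.Coprime.of_dvd (orderOf_dvd_of_pow_eq_one hk) (orderOf_dvd_of_pow_eq_one hl)
      (Nat.Coprime.pow _ _ ((Nat.coprime_primes hp hq).2 hpq))
  have hpel : ∀ (p : ℕ) (P : Sylow p G) (x : G), x ∈ (P : Subgroup G) → ∃ k, x ^ p ^ k = 1 := by
    intro p P x hx
    obtain ⟨k, hk⟩ := P.2 ⟨x, hx⟩
    exact ⟨k, by simpa using congrArg Subtype.val hk⟩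
  have hex : ∃ p : ℕ, p.Prime ∧ p ≠ q ∧ ∃ P : Sylow p G, (P ⊔ Q : Subgroup G) = ⊤ := by
    by_contra! hcon
    apply hQn
    rw [← normalizer_eq_top_iff]
    refine eq_top_of_forall_sylow_le fun p hp => ?_
    rcases eq_or_ne p q with rfl | hpq
    · exact ⟨Q, le_normalizer⟩
    · have : Fact p.Prime := ⟨hp⟩
      obtain ⟨P⟩ : Nonempty (Sylow p G) := inferInstance
      refine ⟨P, fun x hx => mem_normalizer_of_conj_mem fun z hz => ?_⟩
      have hc : Commute x z := commute_of_coprime_orderOf (hprop _ (hcon p hp hpq P))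
        (mem_sup_left hx) (mem_sup_right hz)
        (hcop p hp hpq x z (hpel p P x hx) (hpel q Q z hz))
      rw [hc.eq]
      simpa using hz
  obtain ⟨p, hp, hpq, P, hPQ⟩ := hex
  have hPn := hPnorm p hp hpq P
  have hPleN := hPN p hp hpq P
  have hQ1 : ∀ x ∈ (P : Subgroup G), ∀ z ∈ (Q : Subgroup G), z ∈ N → Commute x z := by
    intro x hx z hz hzN
    exact commute_of_coprime_orderOf hNnil (hPleN hx) hzN
        (hcop p hp hpq x z (hpel p P x hx) (hpel q Q z hz))
  obtain ⟨y, hyQ, hyN⟩ : ∃ y ∈ (Q : Subgroup G), y ∉ N := by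
    by_contra! hcon
    exact hN.1 (top_le_iff.1 (hPQ ▸ sup_le hPleN hcon))
  have hNy : N ⊔ zpowers y = ⊤ := by
    refine hN.2 _ (lt_of_le_of_ne le_sup_left fun h => hyN ?_)
    rw [h]
    exact mem_sup_right (mem_zpowers y)
  have hny : ¬ ∀ x ∈ (P : Subgroup G), Commute x y := by
    intro hc
    apply hQn
    rw [← normalizer_eq_top_iff, ← top_le_iff, ← hPQ]
    refine sup_le (fun x hx => mem_normalizer_of_conj_mem fun z hz => ?_) le_normalizer
    have : Commute x z := by
      have hzt : z ∈ N ⊔ zpowers y := by rw [hNy]; trivial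
      obtain ⟨n, hn, w, hw, rfl⟩ := mem_sup_of_normal_left.1 hzt
      obtain ⟨k, rfl⟩ := mem_zpowers_iff.1 hw
      have hnQ : n ∈ (Q : Subgroup G) := by
        have := (Q : Subgroup G).mul_mem hz ((Q : Subgroup G).inv_mem
          ((Q : Subgroup G).zpow_mem hyQ k))
        simpa using this
      exact (hQ1 x hx n hnQ hn).mul_right ((hc x hx).zpow_right k)
    rw [this.eq]
    simpa using hz
  have hyk := hpel q Q y hyQ
  have htop : (P : Subgroup G) ⊔ zpowers y = ⊤ := by
    by_contra hne
    refine hny fun x hx => ?_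
    exact commute_of_coprime_orderOf (hprop _ hne) (mem_sup_left hx)
      (mem_sup_right (mem_zpowers y)) (hcop p hp hpq x y (hpel p P x hx) hyk)
  refine ⟨p, q, hp, hq, hpq, P, y, hPn, P.2, ?_, htop, ?_, hny⟩
  · obtain ⟨k, hk⟩ := hyk
    obtain ⟨l, -, hl⟩ := (Nat.dvd_prime_pow hq).1 (orderOf_dvd_of_pow_eq_one hk)
    exact ⟨l, hl⟩
  · intro g
    have hg : g ∈ (P : Subgroup G) ⊔ zpowers y := by rw [htop]; trivial
    obtain ⟨x, hx, w, hw, rfl⟩ := mem_sup_of_normal_left.1 hg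
    obtain ⟨k, rfl⟩ := mem_zpowers_iff.1 hw
    exact (hQ1 x hx (y ^ q) ((Q : Subgroup G).pow_mem hyQ q) (hqN y)).symm.mul_right
      (((Commute.refl y).pow_left q).zpow_right k)

/-- `H = P ⋊ ⟨y⟩` is a Schmidt group inside an ambient group. -/
structure IsSchmidt {G : Type*} [Group G] (H : Subgroup G) (p q : ℕ) (P : Subgroup G) (y : G) :
    Prop where
  prime_p : p.Prime
  prime_q : q.Prime
  ne : p ≠ q
  le : P ≤ H
  mem : y ∈ H
  conj_mem : ∀ g ∈ H, ∀ x ∈ P, g * x * g⁻¹ ∈ P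
  isPGroup : IsPGroup p P
  order : ∃ k, orderOf y = q ^ k
  exists_eq : ∀ g ∈ H, ∃ x ∈ P, ∃ k : ℤ, g = x * y ^ k
  commute_pow : ∀ g ∈ H, Commute (y ^ q) g
  not_commute : ¬ ∀ x ∈ P, Commute x y

theorem MinimalNonNilpotent.exists_isSchmidt {G : Type*} [Group G] [Finite G] {H : Subgroup G}
    (h : MinimalNonNilpotent H) : ∃ p q P y, IsSchmidt H p q P y := by
  obtain ⟨p, q, hp, hq, hpq, P, y, hPn, hP, hy, htop, hcen, hnc⟩ := h.exists_structure
  refine ⟨p, q, P.map H.subtype, y, hp, hq, hpq, map_subtype_le P, y.2, ?_, hP.map _, ?_, ?_, ?_, ?_⟩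
  · rintro g hg _ ⟨x, hx, rfl⟩
    exact ⟨_, hPn.conj_mem x hx ⟨g, hg⟩, rfl⟩
  · simpa using hy
  · intro g hg
    have hg' : (⟨g, hg⟩ : H) ∈ P ⊔ zpowers y := by rw [htop]; trivial
    obtain ⟨x, hx, w, hw, hxw⟩ := mem_sup_of_normal_left.1 hg'
    obtain ⟨k, rfl⟩ := mem_zpowers_iff.1 hw
    exact ⟨x, ⟨x, hx, rfl⟩, k, by simpa using (congrArg Subtype.val hxw).symm⟩
  · intro g hg
    exact (hcen ⟨g, hg⟩).map H.subtype
  · intro hc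
    apply hnc
    intro x hx
    exact Subtype.ext (hc x ⟨x, hx, rfl⟩).eq

namespace IsSchmidt
variable {G : Type*} [Group G] {H P : Subgroup G} {p q : ℕ} {y : G}

theorem mem_normalizer [Finite G] (h : IsSchmidt H p q P y) : H ≤ normalizer (P : Set G) :=
  fun g hg => mem_normalizer_of_conj_mem (h.conj_mem g hg)

/-- Powers by multiples of the order of `y` lie in `P`. -/
theorem pow_mem (h : IsSchmidt H p q P y) {g : G} (hg : g ∈ H) : g ^ orderOf y ∈ P := by
  obtain ⟨x, hx, k, rfl⟩ := h.exists_eq g hg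
  have hyk : y ^ k ∈ H := H.zpow_mem h.mem k
  have key : ∀ n : ℕ, ∃ z ∈ P, (x * y ^ k) ^ n = z * (y ^ k) ^ n := by
    intro n
    induction n with
    | zero => exact ⟨1, P.one_mem, by simp⟩
    | succ n ih =>
      obtain ⟨z, hz, hzn⟩ := ih
      refine ⟨z * ((y ^ k) ^ n * x * ((y ^ k) ^ n)⁻¹),
        P.mul_mem hz (h.conj_mem _ (H.pow_mem hyk n) x hx), ?_⟩
      rw [pow_succ, hzn, pow_succ]
      group
  obtain ⟨z, hz, hzn⟩ := key (orderOf y)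
  rw [hzn, ← zpow_natCast, ← zpow_mul, mul_comm, zpow_mul, zpow_natCast, pow_orderOf_eq_one]
  simpa using hz

theorem mem_of_pow_eq_one (h : IsSchmidt H p q P y) {g : G} (hg : g ∈ H) {k : ℕ}
    (hk : g ^ p ^ k = 1) : g ∈ P := by
  obtain ⟨l, hl⟩ := h.order
  have hc : (p ^ k).Coprime (orderOf y) := by
    rw [hl]
    exact Nat.Coprime.pow _ _ ((Nat.coprime_primes h.prime_p h.prime_q).2 h.ne)
  have h1 := h.pow_mem hg
  have : g = (g ^ orderOf y) ^ ((orderOf y).gcdB (p ^ k) * 0 + (orderOf y).gcdA (p ^ k)) := by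
    have hb := Nat.gcd_eq_gcd_ab (orderOf y) (p ^ k)
    rw [Nat.Coprime.gcd_eq_one hc.symm] at hb
    have : g ^ (1 : ℤ) = g ^ ((orderOf y : ℤ) * (orderOf y).gcdA (p ^ k) +
        ((p ^ k : ℕ) : ℤ) * (orderOf y).gcdB (p ^ k)) := by
      rw [← hb]; rfl
    rw [zpow_one, zpow_add, zpow_mul, zpow_mul, zpow_natCast, zpow_natCast, hk] at this
    simpa using this
  rw [this]
  exact P.zpow_mem h1 _

theorem le_of_isPGroup (h : IsSchmidt H p q P y) {V : Subgroup G} (hVH : V ≤ H)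
    (hV : IsPGroup p V) : V ≤ P := by
  intro x hx
  obtain ⟨k, hk⟩ := hV ⟨x, hx⟩
  exact h.mem_of_pow_eq_one (hVH hx) (k := k) (by simpa using congrArg Subtype.val hk)

theorem disjoint_of_coprime (h : IsSchmidt H p q P y) {x : G} (hx : x ∈ P) {r k : ℕ}
    (hr : r.Prime) (hrp : p ≠ r) (hk : x ^ r ^ k = 1) : x = 1 := by
  obtain ⟨l, hl⟩ := h.isPGroup ⟨x, hx⟩
  exact pow_eq_one_of_coprime_pow (m := p ^ l) (n := r ^ k)
    (Nat.Coprime.pow _ _ ((Nat.coprime_primes h.prime_p hr).2 hrp))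
    (by simpa using congrArg Subtype.val hl) hk

theorem zpow_mem_iff (h : IsSchmidt H p q P y) {k : ℤ} : y ^ k ∈ P ↔ y ^ k = 1 := by
  refine ⟨fun hk => ?_, fun hk => hk ▸ P.one_mem⟩
  obtain ⟨l, hl⟩ := h.order
  refine h.disjoint_of_coprime hk (r := q) (k := l) h.prime_q h.ne ?_
  rw [← hl, ← zpow_natCast, ← zpow_mul, mul_comm, zpow_mul, zpow_natCast, pow_orderOf_eq_one,
    one_zpow]

theorem isCyclic (h : IsSchmidt H p q P y) {V : Subgroup G} (hVH : V ≤ H)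
    (hV : IsPGroup q V) : IsCyclic V := by
  have hn : (P.subgroupOf H).Normal := ⟨fun x hx g => h.conj_mem g g.2 x hx⟩
  have : IsCyclic (H ⧸ P.subgroupOf H) := by
    refine ⟨QuotientGroup.mk ⟨y, h.mem⟩, fun z => ?_⟩
    obtain ⟨⟨g, hg⟩, rfl⟩ := QuotientGroup.mk_surjective z
    obtain ⟨x, hx, k, rfl⟩ := h.exists_eq g hg
    refine ⟨k, ?_⟩
    show (QuotientGroup.mk (⟨y, h.mem⟩ : H) : H ⧸ P.subgroupOf H) ^ k = _
    rw [← QuotientGroup.mk_zpow, eq_comm, QuotientGroup.eq_iff_div_mem, mem_subgroupOf]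
    simpa using hx
  refine isCyclic_of_injective ((QuotientGroup.mk' (P.subgroupOf H)).comp (inclusion hVH)) ?_
  rw [injective_iff_map_eq_one]
  intro v hv
  have hv' : inclusion hVH v ∈ P.subgroupOf H := (QuotientGroup.eq_one_iff _).1 hv
  obtain ⟨k, hk⟩ := hV v
  exact Subtype.ext (h.disjoint_of_coprime (x := v) hv' h.prime_q h.ne
    (by simpa using congrArg Subtype.val hk))

theorem card_eq [Finite G] (h : IsSchmidt H p q P y) : Nat.card H = Nat.card P * orderOf y := by
  rw [← Nat.card_zpowers, ← Nat.card_prod]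
  symm
  refine Nat.card_congr (Equiv.ofBijective
    (fun z : P × zpowers y => (⟨z.1 * z.2, H.mul_mem (h.le z.1.2)
      (zpowers_le.2 h.mem z.2.2)⟩ : H)) ⟨?_, ?_⟩)
  · rintro ⟨⟨a, ha⟩, ⟨b, hb⟩⟩ ⟨⟨c, hc⟩, ⟨d, hd⟩⟩ hab
    obtain ⟨k, rfl⟩ := mem_zpowers_iff.1 hb
    obtain ⟨l, rfl⟩ := mem_zpowers_iff.1 hd
    simp only [Subtype.mk.injEq] at hab
    have h1 : c⁻¹ * a = y ^ (l - k) := by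
      rw [zpow_sub, inv_mul_eq_iff_eq_mul, ← mul_assoc, ← hab]
      group
    have h2 : y ^ (l - k) = 1 := h.zpow_mem_iff.1 (h1 ▸ P.mul_mem (P.inv_mem hc) ha)
    rw [h2, inv_mul_eq_one] at h1
    subst h1
    simp only [mul_right_inj] at hab
    simp [hab]
  · rintro ⟨g, hg⟩
    obtain ⟨x, hx, k, rfl⟩ := h.exists_eq g hg
    exact ⟨⟨⟨x, hx⟩, ⟨y ^ k, k, rfl⟩⟩, rfl⟩

theorem not_isNilpotent [Finite G] (h : IsSchmidt H p q P y) : ¬ Group.IsNilpotent H := by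
  intro hn
  apply h.not_commute
  intro x hx
  obtain ⟨l, hl⟩ := h.order
  obtain ⟨k, hk⟩ := h.isPGroup ⟨x, hx⟩
  refine Subgroup.commute_of_coprime_orderOf hn (h.le hx) h.mem ?_
  rw [hl]
  refine Nat.Coprime.of_dvd_left (orderOf_dvd_of_pow_eq_one (n := p ^ k)
    (by simpa using congrArg Subtype.val hk)) ?_
  exact Nat.Coprime.pow _ _ ((Nat.coprime_primes h.prime_p h.prime_q).2 h.ne)

theorem eq_or_eq_of_dvd [Finite G] (h : IsSchmidt H p q P y) {r : ℕ} (hr : r.Prime)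
    (hd : r ∣ Nat.card H) : r = p ∨ r = q := by
  have : Fact p.Prime := ⟨h.prime_p⟩
  obtain ⟨n, hn⟩ := IsPGroup.iff_card.1 h.isPGroup
  obtain ⟨l, hl⟩ := h.order
  rw [h.card_eq, hn, hl] at hd
  rcases (Nat.Prime.dvd_mul hr).1 hd with hd | hd
  · exact Or.inl ((Nat.prime_dvd_prime_iff_eq hr h.prime_p).1 (hr.dvd_of_dvd_pow hd))
  · exact Or.inr ((Nat.prime_dvd_prime_iff_eq hr h.prime_q).1 (hr.dvd_of_dvd_pow hd))

end IsSchmidt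

/-- A non-solvable simple group whose proper subgroups are nilpotent or minimal non-nilpotent. -/
structure IsSimpleBiminimal (G : Type*) [Group G] : Prop where
  eq_bot_or_eq_top : ∀ N : Subgroup G, N.Normal → N = ⊥ ∨ N = ⊤
  not_isSolvable : ¬ Group.IsSolvable G
  proper : ∀ H : Subgroup G, H ≠ ⊤ → Group.IsNilpotent H ∨ MinimalNonNilpotent H

section Decomposition
variable {G : Type*} [Group G]

theorem exists_zpow_decomposition [Finite G] (g : G) {p : ℕ} (hp : p.Prime) :
    ∃ c : ℤ, (∃ k, (g ^ c) ^ p ^ k = 1) ∧ ∃ m : ℕ, p.Coprime m ∧ (g ^ (1 - c)) ^ m = 1 := by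
  obtain ⟨k, m, hm, hkm⟩ := Nat.exists_eq_pow_mul_and_not_dvd (orderOf_pos g).ne' p hp.ne_one
  have hc : (p ^ k).Coprime m := Nat.Coprime.pow_left _ ((Nat.Prime.coprime_iff_not_dvd hp).2 hm)
  have hb := Nat.gcd_eq_gcd_ab (p ^ k) m
  rw [hc.gcd_eq_one] at hb
  have h1 : g ^ ((p ^ k : ℕ) * m : ℤ) = 1 := by
    rw [← Nat.cast_mul, zpow_natCast, ← hkm, pow_orderOf_eq_one]
  refine ⟨m * (p ^ k).gcdB m, ⟨k, ?_⟩, m, (Nat.Prime.coprime_iff_not_dvd hp).2 hm, ?_⟩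
  · rw [← zpow_natCast, ← zpow_mul,
      show ((m : ℤ) * (p ^ k).gcdB m) * (p ^ k : ℕ) = ((p ^ k : ℕ) * m) * (p ^ k).gcdB m by ring,
      zpow_mul, h1, one_zpow]
  · rw [show (1 : ℤ) - m * (p ^ k).gcdB m = (p ^ k : ℕ) * (p ^ k).gcdA m by
      push_cast at hb ⊢; linarith, ← zpow_natCast, ← zpow_mul,
      show ((p ^ k : ℕ) * (p ^ k).gcdA m) * (m : ℤ) = ((p ^ k : ℕ) * m) * (p ^ k).gcdA m by ring,
      zpow_mul, h1, one_zpow]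

theorem Commute.of_zpow_of_pow {x g : G} {k : ℤ} {n : ℕ} (h : Commute x (g ^ k)) (hn : g ^ n = 1)
    (hc : IsCoprime k (n : ℤ)) : Commute x g := by
  obtain ⟨a, b, hab⟩ := hc
  have : g = (g ^ k) ^ a := by
    rw [← zpow_mul, mul_comm, ← mul_one (g ^ (a * k)), ← one_zpow b, ← hn, ← zpow_natCast,
      ← zpow_mul, ← zpow_add, mul_comm (n : ℤ), hab, zpow_one]
  rw [this]
  exact h.zpow_right a

theorem Sylow.mem_of_mem_normalizer {p : ℕ} [Fact p.Prime] (P : Sylow p G) {g : G}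
    (hg : g ∈ normalizer (P : Set G)) {k : ℕ} (hk : g ^ p ^ k = 1) : g ∈ (P : Subgroup G) := by
  have hz : IsPGroup p (zpowers g) := by
    rintro ⟨_, n, rfl⟩
    refine ⟨k, Subtype.ext ?_⟩
    show (g ^ n) ^ p ^ k = 1
    rw [← zpow_natCast, ← zpow_mul, mul_comm, zpow_mul, zpow_natCast, hk, one_zpow]
  have := hz.inf_normalizer_sylow P
  have h : g ∈ zpowers g ⊓ normalizer (P : Set G) := ⟨mem_zpowers g, hg⟩
  rw [this] at h
  exact h.2

theorem IsPGroup.exists_pow_eq_one {p : ℕ} {P : Subgroup G} (hP : IsPGroup p P) {x : G}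
    (hx : x ∈ P) : ∃ k, x ^ p ^ k = 1 := by
  obtain ⟨k, hk⟩ := hP ⟨x, hx⟩
  exact ⟨k, by simpa using congrArg Subtype.val hk⟩

theorem isPGroup_zpowers {p k : ℕ} {g : G} (hk : g ^ p ^ k = 1) : IsPGroup p (zpowers g) := by
  rintro ⟨_, n, rfl⟩
  refine ⟨k, Subtype.ext ?_⟩
  show (g ^ n) ^ p ^ k = 1
  rw [← zpow_natCast, ← zpow_mul, mul_comm, zpow_mul, zpow_natCast, hk, one_zpow]

theorem exists_sylow_mem {p k : ℕ} {g : G} (hk : g ^ p ^ k = 1) :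
    ∃ S : Sylow p G, g ∈ (S : Subgroup G) := by
  obtain ⟨S, hS⟩ := (isPGroup_zpowers hk).exists_le_sylow
  exact ⟨S, hS (mem_zpowers g)⟩

/-- The `p`-elements of a nilpotent subgroup form a `p`-subgroup. -/
theorem exists_isPGroup_of_isNilpotent [Finite G] {K : Subgroup G} (hK : Group.IsNilpotent K)
    (p : ℕ) [Fact p.Prime] :
    ∃ U ≤ K, IsPGroup p U ∧ ∀ x ∈ K, ∀ k, x ^ p ^ k = 1 → x ∈ U := by
  obtain ⟨U⟩ : Nonempty (Sylow p K) := inferInstance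
  refine ⟨(U : Subgroup K).map K.subtype, map_subtype_le _, U.2.map _, fun x hx k hk => ?_⟩
  have hU : (U : Subgroup K).Normal := inferInstance
  refine ⟨⟨x, hx⟩, U.mem_of_mem_normalizer (k := k) ?_ (Subtype.ext hk), rfl⟩
  have h1 : normalizer ((U : Subgroup K) : Set K) = ⊤ := normalizer_eq_top_iff.2 hU
  have h2 : (⟨x, hx⟩ : K) ∈ normalizer ((U : Subgroup K) : Set K) := by rw [h1]; trivial
  exact h2

/-- If `N(P)` is nilpotent, every element of `N(P)` acts on `P` as an element of `P`. -/
theorem Sylow.exists_conj_eq [Finite G] {p : ℕ} [hp : Fact p.Prime] (P : Sylow p G)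
    (hN : Group.IsNilpotent (normalizer (P : Set G))) {g : G} (hg : g ∈ normalizer (P : Set G)) :
    ∃ u ∈ (P : Subgroup G), ∀ x ∈ (P : Subgroup G), g * x * g⁻¹ = u * x * u⁻¹ := by
  obtain ⟨c, ⟨k, hk⟩, m, hm, hgm⟩ := exists_zpow_decomposition g hp.1
  refine ⟨g ^ c, P.mem_of_mem_normalizer (zpow_mem hg c) hk, fun x hx => ?_⟩
  have hcomm : Commute (g ^ (1 - c)) x := by
    obtain ⟨l, hl⟩ := P.2.exists_pow_eq_one hx
    refine Subgroup.commute_of_coprime_orderOf hN (zpow_mem hg _) (le_normalizer hx) ?_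
    exact Nat.Coprime.of_dvd (orderOf_dvd_of_pow_eq_one hgm) (orderOf_dvd_of_pow_eq_one hl)
      (Nat.Coprime.pow_right _ hm.symm)
  have : g = g ^ c * g ^ (1 - c) := by rw [← zpow_add]; simp
  calc g * x * g⁻¹ = g ^ c * (g ^ (1 - c) * x) * (g ^ (1 - c))⁻¹ * (g ^ c)⁻¹ := by
        conv_lhs => rw [this]
        simp only [mul_inv_rev, mul_assoc]
    _ = _ := by rw [hcomm.eq]; simp only [mul_assoc, mul_inv_cancel, mul_one]

theorem zpowers_conj_mem_of_isCyclic {V D : Subgroup G} [Finite G] (hV : IsCyclic V) (hD : D ≤ V)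
    {g : G} (hg : g ∈ normalizer (V : Set G)) : g ∈ normalizer (D : Set G) := by
  obtain ⟨⟨v, hv⟩, hgen⟩ := hV
  obtain ⟨n, hn⟩ := hgen ⟨g * v * g⁻¹, conj_mem_of_mem_normalizer hg hv⟩
  have hn' : v ^ n = g * v * g⁻¹ := congrArg Subtype.val hn
  refine mem_normalizer_of_conj_mem fun x hx => ?_
  obtain ⟨m, hm⟩ := hgen ⟨x, hD hx⟩
  have hm' : v ^ m = x := congrArg Subtype.val hm
  have : g * x * g⁻¹ = x ^ n := by
    rw [← hm', ← conj_zpow, ← hn', ← zpow_mul, ← zpow_mul, mul_comm]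
  rw [this]
  exact zpow_mem hx n

end Decomposition

namespace IsSimpleBiminimal
variable {G : Type*} [Group G] [Finite G] (hG : IsSimpleBiminimal G)
include hG

theorem normalizer_ne_top {K : Subgroup G} (hb : K ≠ ⊥) (ht : K ≠ ⊤) :
    normalizer (K : Set G) ≠ ⊤ := fun h =>
  (hG.eq_bot_or_eq_top K (normalizer_eq_top_iff.1 h)).elim hb ht

theorem ne_top_of_isNilpotent {K : Subgroup G} (hK : Group.IsNilpotent K) : K ≠ ⊤ := by
  rintro rfl
  have := Group.nilpotent_of_mulEquiv (topEquiv (G := G))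
  exact hG.not_isSolvable inferInstance

theorem ne_top_of_isPGroup {p : ℕ} [Fact p.Prime] {K : Subgroup G} (hK : IsPGroup p K) : K ≠ ⊤ :=
  hG.ne_top_of_isNilpotent hK.isNilpotent

theorem eq_of_le {H K : Subgroup G} (hH : ¬ Group.IsNilpotent H) (hHK : H ≤ K) (hK : K ≠ ⊤) :
    H = K := by
  by_contra hne
  rcases hG.proper K hK with h | h
  · exact hH (isNilpotent_of_le h hHK)
  · refine hH ?_
    have := h.2 (H.subgroupOf K) fun ht => hne (le_antisymm hHK (subgroupOf_eq_top.1 ht))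
    exact Group.nilpotent_of_mulEquiv (subgroupOfEquivOfLe hHK)

theorem commutator_eq_top : _root_.commutator G = ⊤ := by
  refine (hG.eq_bot_or_eq_top _ inferInstance).resolve_left fun h => hG.not_isSolvable ?_
  exact ⟨1, by simpa using h⟩

theorem isNilpotent_or_isSchmidt {K : Subgroup G} (hK : K ≠ ⊤) :
    Group.IsNilpotent K ∨ ∃ p q P y, IsSchmidt K p q P y :=
  (hG.proper K hK).imp_right fun h => h.exists_isSchmidt

section Sylow
variable {p : ℕ} [hp : Fact p.Prime]

theorem not_normalizer_le_centralizer (P : Sylow p G) (hP : (P : Subgroup G) ≠ ⊥) :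
    ¬ normalizer (P : Set G) ≤ centralizer (P : Set G) := by
  intro h
  have hc := MonoidHom.ker_transferSylow_isComplement' P h
  rcases hG.eq_bot_or_eq_top (MonoidHom.transferSylow P h).ker inferInstance with hb | ht
  · rw [hb] at hc
    exact hG.ne_top_of_isPGroup P.2 (isComplement'_bot_left.1 hc)
  · rw [ht] at hc
    exact hP (isComplement'_top_left.1 hc)

/-- Sylow subgroups intersect trivially. -/
theorem sylow_inf_eq_bot (P₁ P₂ : Sylow p G) (hne : P₁ ≠ P₂) : (P₁ ⊓ P₂ : Subgroup G) = ⊥ := by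
  by_contra hcon
  obtain ⟨⟨P₁, P₂⟩, ⟨hne, hi⟩, hmax⟩ := Set.exists_max_image
      {x : Sylow p G × Sylow p G | x.1 ≠ x.2 ∧ (x.1 ⊓ x.2 : Subgroup G) ≠ ⊥}
      (fun x => Nat.card (x.1 ⊓ x.2 : Subgroup G)) (Set.toFinite _)
      ⟨(P₁, P₂), hne, hcon⟩
  simp only at hne hi hmax
  set D : Subgroup G := P₁ ⊓ P₂ with hD
  have hmax' : ∀ A B : Sylow p G, D < (A ⊓ B : Subgroup G) → A = B := by
    intro A B hlt
    by_contra hne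
    have := hmax (A, B) ⟨hne, (bot_le.trans_lt hlt).ne'⟩
    have h2 := Set.ncard_lt_ncard (SetLike.coe_ssubset_coe.2 hlt) (Set.toFinite _)
    rw [Set.ncard_def, Set.encard] at h2
    simp only at this
    exact absurd h2 (not_lt.2 this)
  have hP12 : ∀ A B : Sylow p G, (A : Subgroup G) ≤ B → A = B := fun A B h =>
    Sylow.ext (A.3 B.2 h).symm
  have hDP₁ : D < P₁ := lt_of_le_of_ne inf_le_left fun h =>
    hne (hP12 _ _ (inf_eq_left.1 h))
  have hDP₂ : D < P₂ := lt_of_le_of_ne inf_le_right fun h =>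
    hne (hP12 _ _ (inf_eq_right.1 h)).symm
  have hDt : D ≠ ⊤ := fun h => hG.ne_top_of_isPGroup P₁.2 (top_le_iff.1 (h ▸ hDP₁.le))
  set K := normalizer (D : Set G) with hKdef
  have hK : K ≠ ⊤ := hG.normalizer_ne_top hi hDt
  have hDK : D ≤ K := le_normalizer
  -- `K` has no normal Sylow `p`-subgroup
  have hnU : ¬ ∃ U ≤ K, IsPGroup p U ∧ ∀ x ∈ K, ∀ k, x ^ p ^ k = 1 → x ∈ U := by
    rintro ⟨U, hUK, hU, hmem⟩
    obtain ⟨P₃, hP₃⟩ := hU.exists_le_sylow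
    have aux : ∀ A : Sylow p G, D < A → A = P₃ := by
      intro A hA
      obtain ⟨x, hxA, hxD, hxN⟩ := exists_mem_normalizer_of_lt_of_isNilpotent A.2.isNilpotent hA
      have hU' : ∀ z ∈ (A : Subgroup G), z ∈ K → z ∈ (P₃ : Subgroup G) := by
        intro z hz hzK
        obtain ⟨k, hk⟩ := A.2.exists_pow_eq_one hz
        exact hP₃ (hmem z hzK k hk)
      refine hmax' A P₃ (lt_of_le_of_ne (le_inf hA.le fun z hz => hU' z (hA.le hz) (hDK hz))
        fun h => hxD ?_)
      rw [h]
      exact ⟨hxA, hU' x hxA hxN⟩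
    exact hne ((aux P₁ hDP₁).trans (aux P₂ hDP₂).symm)
  rcases hG.isNilpotent_or_isSchmidt hK with hnil | ⟨p', q', U, y, hS⟩
  · exact hnU (exists_isPGroup_of_isNilpotent hnil p)
  have hpp' : p ≠ p' := by
    rintro rfl
    exact hnU ⟨U, hS.le, hS.isPGroup, fun x hx k hk => hS.mem_of_pow_eq_one hx hk⟩
  have hpK : p ∣ Nat.card K := by
    have h1 : Nat.card D ∣ Nat.card K := card_dvd_of_le hDK
    obtain ⟨n, hn⟩ := IsPGroup.iff_card.1 (P₁.2.to_le hDP₁.le)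
    rw [hn] at h1
    refine (dvd_pow_self p ?_).trans h1
    rintro rfl
    rw [pow_zero] at hn
    exact hi (card_eq_one.1 hn)
  obtain rfl : p = q' := (hS.eq_or_eq_of_dvd hp.1 hpK).resolve_left hpp'
  have aux : ∀ A : Sylow p G, D < A → IsCyclic A ∧ (A : Subgroup G) ≤ K := by
    intro A hA
    have hcyc : IsCyclic (A ⊓ K : Subgroup G) := hS.isCyclic inf_le_right (A.2.to_le inf_le_left)
    have hle : (A : Subgroup G) ≤ K := by
      by_contra hle
      have hlt : (A ⊓ K : Subgroup G) < A := lt_of_le_of_ne inf_le_left fun h =>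
        hle (inf_eq_left.1 h)
      obtain ⟨x, hxA, hxD, hxN⟩ := exists_mem_normalizer_of_lt_of_isNilpotent A.2.isNilpotent hlt
      have := zpowers_conj_mem_of_isCyclic hcyc (le_inf hA.le hDK) hxN
      exact hxD ⟨hxA, this⟩
    rw [inf_of_le_left hle] at hcyc
    exact ⟨hcyc, hle⟩
  obtain ⟨hc₁, hP₁K⟩ := aux P₁ hDP₁
  obtain ⟨hc₂, hP₂K⟩ := aux P₂ hDP₂
  have hP₁b : (P₁ : Subgroup G) ≠ ⊥ := fun h => hi (le_bot_iff.1 (h ▸ inf_le_left))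
  have hN₁ : normalizer (P₁ : Set G) ≠ ⊤ :=
    hG.normalizer_ne_top hP₁b (hG.ne_top_of_isPGroup P₁.2)
  have hNK : normalizer (P₁ : Set G) ≤ K := fun g hg =>
    zpowers_conj_mem_of_isCyclic hc₁ hDP₁.le hg
  by_cases hnil : Group.IsNilpotent (normalizer (P₁ : Set G))
  · refine hG.not_normalizer_le_centralizer P₁ hP₁b fun g hg => ?_
    obtain ⟨u, hu, hux⟩ := P₁.exists_conj_eq hnil hg
    rw [mem_centralizer_iff]
    intro x hx
    have h1 := hux x hx
    have h2 : u * x = x * u := by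
      have : IsMulCommutative P₁ := inferInstance
      exact congrArg Subtype.val (mul_comm' (⟨u, hu⟩ : P₁) ⟨x, hx⟩)
    rw [h2, mul_inv_cancel_right, mul_inv_eq_iff_eq_mul] at h1
    exact h1.symm
  · have := hG.eq_of_le hnil hNK hK
    refine hne (hP12 P₂ P₁ fun x hx => ?_).symm
    obtain ⟨k, hk⟩ := P₂.2.exists_pow_eq_one hx
    exact P₁.mem_of_mem_normalizer (this ▸ hP₂K hx) hk

theorem sylow_eq {P Q : Sylow p G} {x : G} (hx : x ∈ (P : Subgroup G)) (hx' : x ∈ (Q : Subgroup G))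
    (hx1 : x ≠ 1) : P = Q := by
  by_contra hne
  have : x ∈ (P ⊓ Q : Subgroup G) := ⟨hx, hx'⟩
  rw [hG.sylow_inf_eq_bot P Q hne, mem_bot] at this
  exact hx1 this

theorem mem_normalizer_of_conj_mem_sylow (P : Sylow p G) {x g : G} (hx : x ∈ (P : Subgroup G))
    (hx1 : x ≠ 1) (h : g * x * g⁻¹ ∈ (P : Subgroup G)) : g ∈ normalizer (P : Set G) := by
  rw [← Sylow.smul_eq_iff_mem_normalizer]
  refine hG.sylow_eq (x := g * x * g⁻¹) ?_ h (by simpa using hx1)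
  rw [Sylow.smul_def, Sylow.pointwise_smul_def]
  exact ⟨x, hx, rfl⟩

theorem not_isNilpotent_normalizer (P : Sylow p G) (hP : (P : Subgroup G) ≠ ⊥) :
    ¬ Group.IsNilpotent (normalizer (P : Set G)) := by
  intro hnil
  have h1 := Subgroup.commutator_inf_eq_focalSubgroup P
  rw [hG.commutator_eq_top, top_inf_eq] at h1
  have h2 : (P : Subgroup G) ≤ ⁅(P : Subgroup G), (P : Subgroup G)⁆ := by
    conv_lhs => rw [h1, focalSubgroup_def]
    rw [closure_le]
    rintro _ ⟨hg, x, hx, u, rfl⟩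
    by_cases hx1 : x = 1
    · subst hx1
      simp
    have hu : u ∈ normalizer (P : Set G) := by
      refine hG.mem_normalizer_of_conj_mem_sylow P ((P : Subgroup G).inv_mem hx)
        (inv_ne_one.2 hx1) ?_
      have := (P : Subgroup G).mul_mem ((P : Subgroup G).inv_mem hx) hg
      rw [commutatorElement_def] at this
      simpa [mul_assoc] using this
    obtain ⟨v, hv, hvx⟩ := P.exists_conj_eq hnil hu
    have : ⁅x, u⁆ = ⁅x, v⁆ := by
      have := hvx _ ((P : Subgroup G).inv_mem hx)
      simp only [commutatorElement_def, mul_assoc] at this ⊢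
      rw [this]
    rw [this]
    exact commutator_mem_commutator hx hv
  have hnt : Nontrivial P := (Subgroup.nontrivial_iff_ne_bot _).2 hP
  have hsolv : Group.IsNilpotent P := P.2.isNilpotent
  have hlt := Group.IsSolvable.commutator_lt_top_of_nontrivial P
  refine hlt.ne ?_
  have h3 := Subgroup.map_subtype_commutator (P : Subgroup G)
  rw [← (le_antisymm h2 (commutator_le_self _) : (P : Subgroup G) = _)] at h3
  apply map_injective (P : Subgroup G).subtype_injective
  rw [h3, ← MonoidHom.range_eq_map, range_subtype]

theorem exists_isSchmidt_normalizer (P : Sylow p G) (hP : (P : Subgroup G) ≠ ⊥) :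
    ∃ q y, IsSchmidt (normalizer (P : Set G)) p q P y := by
  have hN := hG.normalizer_ne_top hP (hG.ne_top_of_isPGroup P.2)
  obtain ⟨p', q', U, y, hS⟩ := (hG.isNilpotent_or_isSchmidt hN).resolve_left
    (hG.not_isNilpotent_normalizer P hP)
  have hle : (P : Subgroup G) ≤ normalizer (P : Set G) := le_normalizer
  have hpd : p ∣ Nat.card (normalizer (P : Set G)) := by
    obtain ⟨n, hn⟩ := IsPGroup.iff_card.1 P.2
    refine (dvd_trans ?_ (card_dvd_of_le hle))
    rw [hn]
    refine dvd_pow_self p ?_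
    rintro rfl
    rw [pow_zero] at hn
    exact hP (card_eq_one.1 hn)
  rcases hS.eq_or_eq_of_dvd hp.1 hpd with rfl | rfl
  · have : U = P := by
      refine le_antisymm (fun x hx => ?_) (hS.le_of_isPGroup hle P.2)
      obtain ⟨k, hk⟩ := hS.isPGroup.exists_pow_eq_one hx
      exact P.mem_of_mem_normalizer (hS.le hx) hk
    subst this
    exact ⟨q', y, hS⟩
  · exfalso
    apply hS.not_commute
    intro x hx
    obtain ⟨k, hk⟩ := hS.order
    have hyP : y ∈ (P : Subgroup G) := P.mem_of_mem_normalizer hS.mem (k := k)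
      (by rw [← hk, pow_orderOf_eq_one])
    have h1 : x * y * x⁻¹ * y⁻¹ ∈ (P : Subgroup G) := (P : Subgroup G).mul_mem
      (conj_mem_of_mem_normalizer (hS.le hx) hyP) ((P : Subgroup G).inv_mem hyP)
    have h2 : x * y * x⁻¹ * y⁻¹ ∈ U := by
      have := U.mul_mem hx (hS.conj_mem y hS.mem _ (U.inv_mem hx))
      simpa [mul_assoc] using this
    obtain ⟨j, hj⟩ := P.2.exists_pow_eq_one h1
    have := hS.disjoint_of_coprime h2 hp.1 hS.ne hj
    rw [mul_inv_eq_one, mul_inv_eq_iff_eq_mul] at this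
    exact this

end Sylow
end IsSimpleBiminimal

theorem IsPGroup.eq_one_of_mem {G : Type*} [Group G] {p q : ℕ} (hp : p.Prime) (hq : q.Prime)
    (hpq : p ≠ q) {P Q : Subgroup G} (hP : IsPGroup p P) (hQ : IsPGroup q Q) {x : G} (h : x ∈ P)
    (h' : x ∈ Q) : x = 1 := by
  obtain ⟨k, hk⟩ := hP.exists_pow_eq_one h
  obtain ⟨l, hl⟩ := hQ.exists_pow_eq_one h'
  exact pow_eq_one_of_coprime_pow
    (Nat.Coprime.pow _ _ ((Nat.coprime_primes hp hq).2 hpq)) hk hl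

/-- The numerical contradiction behind fixed-point-freeness. -/
theorem three_classes_count {p q a b g X Y Z : ℕ} (hp : 2 ≤ p) (hq : 2 ≤ q)
    (ha : p ^ 2 ≤ a) (hb : q ^ 2 ≤ b) (hX : g * (a - 1) ≤ a * q * X)
    (hY : g * (b - 1) ≤ b * p * Y) (hZ : g * ((p - 1) * (q - 1)) ≤ p * q * Z)
    (hsum : X + Y + Z + 1 ≤ g) : False := by
  have hp0 : (0 : ℚ) < p := by positivity
  have hq0 : (0 : ℚ) < q := by positivity
  have ha1 : 1 ≤ a := by nlinarith
  have hb1 : 1 ≤ b := by nlinarith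
  have ha0 : (0 : ℚ) < a := by exact_mod_cast ha1
  have hb0 : (0 : ℚ) < b := by exact_mod_cast hb1
  zify [ha1, hb1, show 1 ≤ p by omega, show 1 ≤ q by omega] at hX hY hZ hsum ha hb
  have hX' : (g : ℚ) * (a - 1) ≤ a * q * X := by exact_mod_cast hX
  have hY' : (g : ℚ) * (b - 1) ≤ b * p * Y := by exact_mod_cast hY
  have hZ' : (g : ℚ) * ((p - 1) * (q - 1)) ≤ p * q * Z := by exact_mod_cast hZ
  have hs : (X : ℚ) + Y + Z + 1 ≤ g := by exact_mod_cast hsum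
  have ha' : (p : ℚ) ^ 2 ≤ a := by exact_mod_cast ha
  have hb' : (q : ℚ) ^ 2 ≤ b := by exact_mod_cast hb
  have hg0 : (0 : ℚ) ≤ g := by positivity
  -- multiply everything by `p * q`
  have h1 : (g : ℚ) * p - g / p ≤ p * q * X := by
    have : (g : ℚ) * p * (a - 1) / a ≤ p * q * X := by
      rw [div_le_iff₀ ha0]; nlinarith
    refine le_trans ?_ this
    have h2 : (g : ℚ) * p * (a - 1) / a = g * p - g * (p / a) := by field_simp
    have h3 : (p : ℚ) / a ≤ 1 / p := by
      rw [div_le_div_iff₀ ha0 hp0]; nlinarith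
    rw [h2]
    have := mul_le_mul_of_nonneg_left h3 hg0
    rw [mul_one_div] at this
    linarith
  have h2 : (g : ℚ) * q - g / q ≤ p * q * Y := by
    have : (g : ℚ) * q * (b - 1) / b ≤ p * q * Y := by
      rw [div_le_iff₀ hb0]; nlinarith
    refine le_trans ?_ this
    have h2 : (g : ℚ) * q * (b - 1) / b = g * q - g * (q / b) := by field_simp
    have h3 : (q : ℚ) / b ≤ 1 / q := by
      rw [div_le_div_iff₀ hb0 hq0]; nlinarith
    rw [h2]
    have := mul_le_mul_of_nonneg_left h3 hg0
    rw [mul_one_div] at this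
    linarith
  have h3 : (g : ℚ) / p + g / q ≤ g := by
    have hp2 : (2 : ℚ) ≤ p := by exact_mod_cast hp
    have hq2 : (2 : ℚ) ≤ q := by exact_mod_cast hq
    have e1 : (g : ℚ) / p ≤ g / 2 := by gcongr
    have e2 : (g : ℚ) / q ≤ g / 2 := by gcongr
    linarith
  have hpq0 : 0 < (p : ℚ) * q := by positivity
  nlinarith

namespace IsSimpleBiminimal
variable {G : Type*} [Group G] [Finite G] (hG : IsSimpleBiminimal G)
include hG

section
variable {p : ℕ} [hp : Fact p.Prime]

theorem pow_eq_one_of_isSchmidt_normalizer {P : Sylow p G} {q : ℕ} {y : G}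
    (h : IsSchmidt (normalizer (P : Set G)) p q P y) :
    y ^ q = 1 := by
  by_contra hz
  have : Fact q.Prime := ⟨h.prime_q⟩
  obtain ⟨l, hl⟩ := h.order
  obtain ⟨S, hyS⟩ := exists_sylow_mem (p := q) (k := l) (g := y)
    (by rw [← hl, pow_orderOf_eq_one])
  have hzS : y ^ q ∈ (S : Subgroup G) := (S : Subgroup G).pow_mem hyS q
  have hle : normalizer (P : Set G) ≤ normalizer (S : Set G) := fun g hg => by
    refine hG.mem_normalizer_of_conj_mem_sylow S hzS hz ?_
    rw [← (h.commute_pow g hg).eq]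
    simpa using hzS
  apply h.not_commute
  intro x hx
  have h1 : x * y * x⁻¹ * y⁻¹ ∈ (S : Subgroup G) := (S : Subgroup G).mul_mem
    (conj_mem_of_mem_normalizer (hle (h.le hx)) hyS) ((S : Subgroup G).inv_mem hyS)
  have h2 : x * y * x⁻¹ * y⁻¹ ∈ (P : Subgroup G) := by
    have := (P : Subgroup G).mul_mem hx (h.conj_mem y h.mem _ ((P : Subgroup G).inv_mem hx))
    simpa [mul_assoc] using this
  have := IsPGroup.eq_one_of_mem h.prime_p h.prime_q h.ne P.2 S.2 h2 h1
  rw [mul_inv_eq_one, mul_inv_eq_iff_eq_mul] at this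
  exact this

theorem orderOf_eq_of_isSchmidt_normalizer {P : Sylow p G} {q : ℕ} {y : G}
    (h : IsSchmidt (normalizer (P : Set G)) p q P y) :
    orderOf y = q := by
  have : Fact q.Prime := ⟨h.prime_q⟩
  refine orderOf_eq_prime (hG.pow_eq_one_of_isSchmidt_normalizer h) ?_
  rintro rfl
  exact h.not_commute fun x _ => Commute.one_right x

theorem sq_le_card_of_isSchmidt {P : Sylow p G} {q : ℕ} {y x : G}
    (h : IsSchmidt (normalizer (P : Set G)) p q P y) (hy : orderOf y = q)
    {w : G} (hw : w ∈ normalizer (P : Set G)) (hwP : w ∉ (P : Subgroup G))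
    (hx : x ∈ (P : Subgroup G)) (hx1 : x ≠ 1) (hcomm : Commute x w) :
    p ^ 2 ≤ Nat.card P := by
  obtain ⟨n, hn⟩ := IsPGroup.iff_card.1 P.2
  rw [hn]
  by_contra hlt
  have hn2 : n < 2 := by
    by_contra h2
    exact hlt (Nat.pow_le_pow_right hp.1.pos (by omega))
  have hnt : Nat.card P ≠ 1 := fun h1 => by
    rw [card_eq_one] at h1
    rw [h1, mem_bot] at hx
    exact hx1 hx
  have hn1 : n = 1 := by
    interval_cases n
    · exact absurd hn hnt
    · rfl
  rw [hn1, pow_one] at hn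
  have hgen : ∀ z ∈ (P : Subgroup G), z ∈ zpowers x := by
    intro z hz
    have hle : zpowers x ≤ P := zpowers_le.2 hx
    have : zpowers x = (P : Subgroup G) := by
      refine eq_of_le_of_card_ge hle ?_
      have hd := card_dvd_of_le hle
      have hn' : Nat.card (P : Subgroup G) = p := hn
      rw [hn'] at hd ⊢
      rcases (Nat.dvd_prime hp.1).1 hd with h1 | h1
      · rw [card_eq_one, zpowers_eq_bot] at h1
        exact absurd h1 hx1
      · exact h1.ge
    rwa [this]
  obtain ⟨u, hu, k, hk⟩ := h.exists_eq w hw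
  apply h.not_commute
  intro z hz
  obtain ⟨i, rfl⟩ := mem_zpowers_iff.1 (hgen z hz)
  obtain ⟨j, hj⟩ := mem_zpowers_iff.1 (hgen u hu)
  refine Commute.zpow_left ?_ i
  have hxk : Commute x (y ^ k) := by
    have : y ^ k = (x ^ j)⁻¹ * w := by rw [hj, hk]; group
    rw [this]
    exact (((Commute.refl x).zpow_right j).inv_right).mul_right hcomm
  refine Commute.of_zpow_of_pow hxk (pow_orderOf_eq_one y) ?_
  rw [hy, isCoprime_comm, (Nat.prime_iff_prime_int.1 h.prime_q).coprime_iff_not_dvd]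
  rintro ⟨c, rfl⟩
  rw [zpow_mul, zpow_natCast, ← hy, pow_orderOf_eq_one, one_zpow, mul_one] at hk
  exact hwP (hk ▸ hu)

/-- The complement in `N(P)` acts fixed-point-freely on `P`. -/
theorem eq_one_of_commute {P : Sylow p G} {q : ℕ} {y : G}
    (h : IsSchmidt (normalizer (P : Set G)) p q P y)
    {x : G} (hx : x ∈ (P : Subgroup G)) (hxy : Commute x y) : x = 1 := by
  classical
  by_contra hx1
  have := Fintype.ofFinite G
  have hq : Fact q.Prime := ⟨h.prime_q⟩
  have hoy := hG.orderOf_eq_of_isSchmidt_normalizer h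
  have hy1 : y ≠ 1 := by
    rintro rfl
    exact h.not_commute fun x _ => Commute.one_right x
  have hyq := hG.pow_eq_one_of_isSchmidt_normalizer h
  obtain ⟨S, hyS⟩ := exists_sylow_mem (p := q) (k := 1) (g := y) (by simpa using hyq)
  have hSb : (S : Subgroup G) ≠ ⊥ := by
    intro hS
    rw [hS, mem_bot] at hyS
    exact hy1 hyS
  have hxNS : x ∈ normalizer (S : Set G) := by
    refine hG.mem_normalizer_of_conj_mem_sylow S hyS hy1 ?_
    rw [hxy.eq]
    simpa using hyS
  have hPS : ∀ {z : G}, z ∈ (P : Subgroup G) → z ∈ (S : Subgroup G) → z = 1 :=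
    fun hz hz' => IsPGroup.eq_one_of_mem h.prime_p h.prime_q h.ne P.2 S.2 hz hz'
  obtain ⟨r, w, hS⟩ := hG.exists_isSchmidt_normalizer S hSb
  obtain ⟨k, hk⟩ := P.2.exists_pow_eq_one hx
  obtain rfl : p = r := by
    refine (hS.eq_or_eq_of_dvd hp.1 ?_).resolve_left h.ne
    have h1 : orderOf x ∣ Nat.card (normalizer (S : Set G)) := by
      rw [← Nat.card_zpowers]
      exact card_dvd_of_le (zpowers_le.2 hxNS)
    obtain ⟨j, -, hj⟩ := (Nat.dvd_prime_pow hp.1).1 (orderOf_dvd_of_pow_eq_one hk)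
    rw [hj] at h1
    refine (dvd_pow_self p ?_).trans h1
    rintro rfl
    rw [pow_zero, orderOf_eq_one_iff] at hj
    exact hx1 hj
  have how := hG.orderOf_eq_of_isSchmidt_normalizer hS
  have hxp : x ^ p = 1 := by
    have := hS.pow_mem hxNS
    rw [how] at this
    exact hPS ((P : Subgroup G).pow_mem hx p) this
  have hox : orderOf x = p := orderOf_eq_prime hxp hx1
  have hPcard : p ^ 2 ≤ Nat.card P := hG.sq_le_card_of_isSchmidt h hoy h.mem
    (fun hyP => hy1 (hPS hyP hyS)) hx hx1 hxy
  have hScard : q ^ 2 ≤ Nat.card S := hG.sq_le_card_of_isSchmidt hS how hxNS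
    (fun hxS => hx1 (hPS hx hxS)) hyS hy1 hxy.symm
  let AP : Finset G := Finset.univ.filter fun z => z ∈ (P : Subgroup G) ∧ z ≠ 1
  let AS : Finset G := Finset.univ.filter fun z => z ∈ (S : Subgroup G) ∧ z ≠ 1
  let A : Finset G := Finset.univ.filter fun z => (z ^ q ∈ (P : Subgroup G) ∧ z ^ q ≠ 1) ∧
    z ^ p ∈ (S : Subgroup G) ∧ z ^ p ≠ 1
  have hcardsub : ∀ K : Subgroup G,
      (Finset.univ.filter fun z => z ∈ K ∧ z ≠ 1).card = Nat.card K - 1 := by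
    intro K
    have : (Finset.univ.filter fun z => z ∈ K ∧ z ≠ 1) =
        (Finset.univ.filter fun y => y ∈ K).erase 1 := by
      ext y; simp [and_comm]
    rw [this, Finset.card_erase_of_mem (by simp [K.one_mem]), Nat.card_eq_fintype_card,
      ← Fintype.card_subtype]
  have hAcard : (p - 1) * (q - 1) ≤ A.card := by
    have h1 := hcardsub (zpowers x)
    have h2 := hcardsub (zpowers y)
    rw [Nat.card_zpowers] at h1 h2
    rw [hox] at h1
    rw [hoy] at h2
    rw [← h1, ← h2, ← Finset.card_product]
    refine Finset.card_le_card_of_injOn (fun z => z.1 * z.2) ?_ ?_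
    · rintro ⟨a, b⟩ hab
      simp only [Finset.coe_product, Set.mem_prod, Finset.mem_coe, Finset.mem_filter,
        Finset.mem_univ, true_and] at hab
      obtain ⟨⟨ha, ha1⟩, hb, hb1⟩ := hab
      obtain ⟨i, rfl⟩ := mem_zpowers_iff.1 ha
      obtain ⟨j, rfl⟩ := mem_zpowers_iff.1 hb
      have hc : Commute (x ^ i) (y ^ j) := (hxy.zpow_left i).zpow_right j
      have e1 : (x ^ i * y ^ j) ^ q = (x ^ i) ^ q := by
        rw [hc.mul_pow, ← zpow_natCast (y ^ j), zpow_comm, zpow_natCast, hyq, one_zpow, mul_one]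
      have e2 : (x ^ i * y ^ j) ^ p = (y ^ j) ^ p := by
        rw [hc.mul_pow, ← zpow_natCast (x ^ i), zpow_comm, zpow_natCast, hxp, one_zpow, one_mul]
      have hip : (x ^ i) ^ p = 1 := by
        rw [← zpow_natCast, zpow_comm, zpow_natCast, hxp, one_zpow]
      have hjq : (y ^ j) ^ q = 1 := by
        rw [← zpow_natCast, zpow_comm, zpow_natCast, hyq, one_zpow]
      have hcop : p.Coprime q := (Nat.coprime_primes hp.1 hq.1).2 h.ne
      simp only [A, Finset.coe_filter, Finset.mem_univ, true_and, Set.mem_ofPred_eq]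
      rw [e1, e2]
      exact ⟨⟨(P : Subgroup G).pow_mem ((P : Subgroup G).zpow_mem hx i) q,
        fun h => ha1 (pow_eq_one_of_coprime_pow hcop hip h)⟩,
        (S : Subgroup G).pow_mem ((S : Subgroup G).zpow_mem hyS j) p,
        fun h => hb1 (pow_eq_one_of_coprime_pow hcop h hjq)⟩
    · rintro ⟨a, b⟩ hab ⟨c, d⟩ hcd heq
      simp only [Finset.coe_product, Set.mem_prod, Finset.mem_coe, Finset.mem_filter,
        Finset.mem_univ, true_and] at hab hcd heq
      have e : c⁻¹ * a = d * b⁻¹ := by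
        rw [inv_mul_eq_iff_eq_mul, ← mul_assoc, ← heq]; simp
      have h1 : c⁻¹ * a ∈ (P : Subgroup G) :=
        (zpowers_le.2 hx) ((zpowers x).mul_mem ((zpowers x).inv_mem hcd.1.1) hab.1.1)
      have h2 : c⁻¹ * a ∈ (S : Subgroup G) := by
        rw [e]
        exact (zpowers_le.2 hyS) ((zpowers y).mul_mem hcd.2.1 ((zpowers y).inv_mem hab.2.1))
      have h3 := hPS h1 h2
      rw [h3] at e
      rw [inv_mul_eq_one] at h3
      have h4 := mul_inv_eq_one.1 e.symm
      rw [h3, h4]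
  have hconjpow : ∀ (g z : G) (n : ℕ), (g * z * g⁻¹) ^ n = g * z ^ n * g⁻¹ := fun g z n => conj_pow
  let N : Subgroup G := normalizer (P : Set G) ⊓ normalizer (S : Set G)
  have hNcard : Nat.card N ∣ p * q := by
    have h1 : Nat.card N ∣ Nat.card P * q := by
      have := card_dvd_of_le (inf_le_left : N ≤ normalizer (P : Set G))
      rw [h.card_eq, hoy] at this
      exact this
    have h2 : Nat.card N ∣ Nat.card S * p := by
      have := card_dvd_of_le (inf_le_right : N ≤ normalizer (S : Set G))
      rw [hS.card_eq, how] at this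
      exact this
    obtain ⟨n, hn⟩ := IsPGroup.iff_card.1 P.2
    obtain ⟨m, hm⟩ := IsPGroup.iff_card.1 S.2
    rw [hn] at h1
    rw [hm] at h2
    have hcop : p.Coprime q := (Nat.coprime_primes hp.1 hq.1).2 h.ne
    obtain ⟨d, e, hd, he, hde⟩ := Nat.dvd_mul.1 h1
    rw [← hde]
    refine Nat.mul_dvd_mul ?_ he
    refine (Nat.Coprime.coprime_dvd_left hd (Nat.Coprime.pow n m hcop)).dvd_of_dvd_mul_left ?_
    exact (Dvd.intro _ hde).trans h2
  have hX := card_mul_card_le_card_mul_card_conjugates AP (normalizer (P : Set G)) (by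
    intro g a ha hg
    simp only [AP, Finset.mem_filter, Finset.mem_univ, true_and] at ha hg
    exact hG.mem_normalizer_of_conj_mem_sylow P ha.1 ha.2 hg.1)
  have hY := card_mul_card_le_card_mul_card_conjugates AS (normalizer (S : Set G)) (by
    intro g a ha hg
    simp only [AS, Finset.mem_filter, Finset.mem_univ, true_and] at ha hg
    exact hG.mem_normalizer_of_conj_mem_sylow S ha.1 ha.2 hg.1)
  have hZ := card_mul_card_le_card_mul_card_conjugates A N (by
    intro g a ha hg
    simp only [A, Finset.mem_filter, Finset.mem_univ, true_and, hconjpow] at ha hg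
    exact ⟨hG.mem_normalizer_of_conj_mem_sylow P ha.1.1 ha.1.2 hg.1.1,
      hG.mem_normalizer_of_conj_mem_sylow S ha.2.1 ha.2.2 hg.2.1⟩)
  let conj : Finset G → Finset G := fun B =>
    (Finset.univ ×ˢ B).image fun z : G × G => z.1 * z.2 * z.1⁻¹
  have hXP : ∀ z ∈ conj AP, z ≠ 1 ∧ ∃ k, z ^ p ^ k = 1 := by
    intro z hz
    simp only [conj, AP, Finset.mem_image, Finset.mem_product, Finset.mem_univ, true_and,
      Finset.mem_filter, Prod.exists] at hz
    obtain ⟨g, a, ⟨ha, ha1⟩, rfl⟩ := hz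
    obtain ⟨k, hk⟩ := P.2.exists_pow_eq_one ha
    exact ⟨by simpa using ha1, k, by rw [hconjpow, hk]; simp⟩
  have hYS : ∀ z ∈ conj AS, z ≠ 1 ∧ ∃ k, z ^ q ^ k = 1 := by
    intro z hz
    simp only [conj, AS, Finset.mem_image, Finset.mem_product, Finset.mem_univ, true_and,
      Finset.mem_filter, Prod.exists] at hz
    obtain ⟨g, a, ⟨ha, ha1⟩, rfl⟩ := hz
    obtain ⟨k, hk⟩ := S.2.exists_pow_eq_one ha
    exact ⟨by simpa using ha1, k, by rw [hconjpow, hk]; simp⟩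
  have hZA : ∀ z ∈ conj A, z ≠ 1 ∧ (∀ k, z ^ p ^ k ≠ 1) ∧ ∀ k, z ^ q ^ k ≠ 1 := by
    intro z hz
    simp only [conj, A, Finset.mem_image, Finset.mem_product, Finset.mem_univ, true_and,
      Finset.mem_filter, Prod.exists] at hz
    obtain ⟨g, a, ⟨⟨ha, ha1⟩, hb, hb1⟩, rfl⟩ := hz
    have e1 : ∀ k, (g * a * g⁻¹) ^ p ^ k ≠ 1 := by
      intro k hk
      rw [hconjpow, conj_eq_one_iff] at hk
      obtain ⟨l, hl⟩ := S.2.exists_pow_eq_one hb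
      refine hb1 (pow_eq_one_of_coprime_pow (m := p ^ k) (n := q ^ l)
        (Nat.Coprime.pow _ _ ((Nat.coprime_primes hp.1 hq.1).2 h.ne)) ?_ hl)
      rw [← pow_mul, mul_comm, pow_mul, hk, one_pow]
    refine ⟨fun h1 => e1 0 (by rw [h1, one_pow]), e1, fun k hk => ?_⟩
    rw [hconjpow, conj_eq_one_iff] at hk
    obtain ⟨l, hl⟩ := P.2.exists_pow_eq_one ha
    refine ha1 (pow_eq_one_of_coprime_pow (m := p ^ l) (n := q ^ k)
      (Nat.Coprime.pow _ _ ((Nat.coprime_primes hp.1 hq.1).2 h.ne)) hl ?_)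
    rw [← pow_mul, mul_comm, pow_mul, hk, one_pow]
  have hd1 : Disjoint (conj AP) (conj AS) := Finset.disjoint_left.2 fun z hz hz' => by
    obtain ⟨h1, k, hk⟩ := hXP z hz
    obtain ⟨-, l, hl⟩ := hYS z hz'
    exact h1 (pow_eq_one_of_coprime_pow
      (Nat.Coprime.pow _ _ ((Nat.coprime_primes hp.1 hq.1).2 h.ne)) hk hl)
  have hd2 : Disjoint (conj AP ∪ conj AS) (conj A) := Finset.disjoint_left.2 fun z hz hz' => by
    obtain ⟨-, h1, h2⟩ := hZA z hz'
    rcases Finset.mem_union.1 hz with hz | hz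
    · obtain ⟨-, k, hk⟩ := hXP z hz
      exact h1 k hk
    · obtain ⟨-, k, hk⟩ := hYS z hz
      exact h2 k hk
  have hsub : (conj AP ∪ conj AS) ∪ conj A ⊆ Finset.univ.erase 1 := by
    intro z hz
    refine Finset.mem_erase.2 ⟨?_, Finset.mem_univ _⟩
    rcases Finset.mem_union.1 hz with hz | hz
    · rcases Finset.mem_union.1 hz with hz | hz
      · exact (hXP z hz).1
      · exact (hYS z hz).1
    · exact (hZA z hz).1
  have hc := Finset.card_le_card hsub
  rw [Finset.card_union_of_disjoint hd2, Finset.card_union_of_disjoint hd1,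
    Finset.card_erase_of_mem (Finset.mem_univ _), Finset.card_univ] at hc
  have hg0 : 0 < Fintype.card G := Fintype.card_pos
  rw [hcardsub, h.card_eq, hoy] at hX
  rw [hcardsub, hS.card_eq, how] at hY
  refine three_classes_count hp.1.two_le hq.1.two_le hPcard hScard hX hY (X := (conj AP).card)
    (Y := (conj AS).card) (Z := (conj A).card) ?_ (by omega)
  calc Fintype.card G * ((p - 1) * (q - 1)) ≤ Fintype.card G * A.card :=
        Nat.mul_le_mul_left _ hAcard
    _ ≤ _ := hZ
    _ ≤ _ := Nat.mul_le_mul_right _ (Nat.le_of_dvd (Nat.mul_pos hp.1.pos hq.1.pos) hNcard)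

end
end IsSimpleBiminimal

/-- `P` is elementary abelian, and its normalizer `P ⋊ ⟨y⟩` is a Frobenius group with complement of
prime order `q` acting irreducibly on `P`. -/
structure IsFrobeniusSylow {G : Type*} [Group G] (P : Subgroup G) (p q : ℕ) (y : G) : Prop where
  schmidt : IsSchmidt (normalizer (P : Set G)) p q P y
  ne_bot : P ≠ ⊥
  orderOf_eq : orderOf y = q
  card_normalizer : Nat.card (normalizer (P : Set G)) = Nat.card P * q
  comm : ∀ u ∈ P, ∀ v ∈ P, Commute u v
  pow_eq_one : ∀ u ∈ P, u ^ p = 1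
  mem_of_commute : ∀ u ∈ P, u ≠ 1 → ∀ g, Commute g u → g ∈ P
  irreducible : ∀ K ≤ P, (∀ x ∈ K, y * x * y⁻¹ ∈ K) → K = ⊥ ∨ K = P
  dvd_card_sub_one : q ∣ Nat.card P - 1

namespace IsSimpleBiminimal
variable {G : Type*} [Group G] [Finite G] (hG : IsSimpleBiminimal G)
include hG

theorem eq_bot_or_eq_of_conj_mem {p : ℕ} [hp : Fact p.Prime] {P : Sylow p G} {q : ℕ} {y : G}
    (hPb : (P : Subgroup G) ≠ ⊥) (h : IsSchmidt (normalizer (P : Set G)) p q P y)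
    {K : Subgroup G} (hKP : K ≤ P) (hy : ∀ x ∈ K, y * x * y⁻¹ ∈ K) : K = ⊥ ∨ K = P := by
  refine or_iff_not_imp_right.2 fun hKne => ?_
  have hoy := hG.orderOf_eq_of_isSchmidt_normalizer h
  have hKy : zpowers y ≤ normalizer (K : Set G) := by
    rw [zpowers_le]
    exact mem_normalizer_of_conj_mem hy
  have hHN : K ⊔ zpowers y ≤ normalizer (P : Set G) :=
    sup_le (hKP.trans h.le) (zpowers_le.2 h.mem)
  have hHne : K ⊔ zpowers y ≠ normalizer (P : Set G) := by
    intro heq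
    apply hKne
    refine le_antisymm hKP fun x hx => ?_
    have hx' : x ∈ K ⊔ zpowers y := by rw [heq]; exact h.le hx
    have hcoe := coe_mul_of_right_le_normalizer_left K (zpowers y) hKy
    rw [← SetLike.mem_coe, hcoe] at hx'
    obtain ⟨k, hk, z, hz, rfl⟩ := Set.mem_mul.1 hx'
    obtain ⟨j, rfl⟩ := mem_zpowers_iff.1 hz
    have h1 : y ^ j ∈ (P : Subgroup G) := ((P : Subgroup G).mul_mem_cancel_left (hKP hk)).1 hx
    rw [h.zpow_mem_iff.1 h1]
    simpa using hk
  have hNt := hG.normalizer_ne_top hPb (hG.ne_top_of_isPGroup P.2)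
  have hM := (hG.proper _ hNt).resolve_left h.not_isNilpotent
  have hnil : Group.IsNilpotent (K ⊔ zpowers y : Subgroup G) := by
    have := hM.2 ((K ⊔ zpowers y).subgroupOf (normalizer (P : Set G)))
      fun ht => hHne (le_antisymm hHN (subgroupOf_eq_top.1 ht))
    exact Group.nilpotent_of_mulEquiv (subgroupOfEquivOfLe hHN)
  rw [eq_bot_iff]
  intro x hx
  refine mem_bot.2 (hG.eq_one_of_commute h (hKP hx) ?_)
  refine Subgroup.commute_of_coprime_orderOf hnil (mem_sup_left hx)
    (mem_sup_right (mem_zpowers y)) ?_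
  obtain ⟨k, hk⟩ := P.2.exists_pow_eq_one (hKP hx)
  rw [hoy]
  exact ((Nat.coprime_primes hp.1 h.prime_q).2 h.ne).pow_left k |>.coprime_dvd_left
    (orderOf_dvd_of_pow_eq_one hk)

theorem exists_isFrobeniusSylow {p : ℕ} [hp : Fact p.Prime] (P : Sylow p G)
    (hPb : (P : Subgroup G) ≠ ⊥) : ∃ q y, IsFrobeniusSylow (P : Subgroup G) p q y := by
  classical
  have := Fintype.ofFinite G
  obtain ⟨q, y, h⟩ := hG.exists_isSchmidt_normalizer P hPb
  have hq : Fact q.Prime := ⟨h.prime_q⟩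
  have hoy := hG.orderOf_eq_of_isSchmidt_normalizer h
  have hyq := hG.pow_eq_one_of_isSchmidt_normalizer h
  have hirr : ∀ K ≤ (P : Subgroup G), (∀ x ∈ K, y * x * y⁻¹ ∈ K) → K = ⊥ ∨ K = P :=
    fun K hK hy => hG.eq_bot_or_eq_of_conj_mem hPb h hK hy
  have hyconj : ∀ x ∈ (P : Subgroup G), y * x * y⁻¹ ∈ (P : Subgroup G) := h.conj_mem y h.mem
  have hcomm : ∀ u ∈ (P : Subgroup G), ∀ v ∈ (P : Subgroup G), Commute u v := by
    have hnt : Nontrivial (P : Subgroup G) := (nontrivial_iff_ne_bot _).2 hPb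
    have hc := P.2.center_nontrivial
    have hmem : ∀ x, x ∈ (center (P : Subgroup G)).map (P : Subgroup G).subtype ↔
        x ∈ (P : Subgroup G) ∧ ∀ v ∈ (P : Subgroup G), Commute v x := by
      intro x
      constructor
      · rintro ⟨x, hx, rfl⟩
        exact ⟨x.2, fun v hv => congrArg Subtype.val (mem_center_iff.1 hx ⟨v, hv⟩)⟩
      · rintro ⟨hx, hx'⟩
        exact ⟨⟨x, hx⟩, mem_center_iff.2 fun v => Subtype.ext (hx' v v.2), rfl⟩
    have hPy : ∀ v ∈ (P : Subgroup G), y⁻¹ * v * y ∈ (P : Subgroup G) := fun v hv => by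
      simpa using h.conj_mem y⁻¹ (inv_mem h.mem) v hv
    rcases hirr ((center (P : Subgroup G)).map (P : Subgroup G).subtype) (map_subtype_le _) (by
      intro x hx
      rw [hmem] at hx ⊢
      refine ⟨hyconj x hx.1, fun v hv => ?_⟩
      have h1 := (hx.2 _ (hPy v hv)).eq
      show v * (y * x * y⁻¹) = (y * x * y⁻¹) * v
      calc v * (y * x * y⁻¹) = y * ((y⁻¹ * v * y) * x) * y⁻¹ := by group
        _ = _ := by rw [h1]; group) with hb | ht
    · rw [map_eq_bot_iff_of_injective _ (subtype_injective _)] at hb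
      exact absurd hb ((nontrivial_iff_ne_bot _).1 hc)
    · intro u hu v hv
      rw [← ht, hmem] at hv
      exact hv.2 u hu
  have hcent : ∀ u ∈ (P : Subgroup G), u ≠ 1 → ∀ g, Commute g u → g ∈ (P : Subgroup G) := by
    intro u hu hu1 g hg
    have hgN : g ∈ normalizer (P : Set G) := by
      refine hG.mem_normalizer_of_conj_mem_sylow P hu hu1 ?_
      rw [hg.eq]
      simpa using hu
    obtain ⟨x, hx, k, rfl⟩ := h.exists_eq g hgN
    have h1 : Commute u (y ^ k) := by
      have h2 := ((hcomm u hu x hx).inv_right).mul_right hg.symm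
      simpa using h2
    by_cases hk : (q : ℤ) ∣ k
    · obtain ⟨c, rfl⟩ := hk
      rw [zpow_mul, zpow_natCast, hyq, one_zpow, mul_one]
      exact hx
    · refine absurd (hG.eq_one_of_commute h hu (h1.of_zpow_of_pow hyq ?_)) hu1
      rw [isCoprime_comm, (Nat.prime_iff_prime_int.1 h.prime_q).coprime_iff_not_dvd]
      exact hk
  refine ⟨q, y, h, hPb, hoy, by
    have := h.card_eq; rw [hoy] at this; exact this, hcomm, ?_, hcent, hirr, ?_⟩
  · let Ω : Subgroup G :=
      { carrier := {x | x ∈ (P : Subgroup G) ∧ x ^ p = 1}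
        mul_mem' := fun {a b} ha hb => ⟨mul_mem ha.1 hb.1, by
          rw [(hcomm a ha.1 b hb.1).mul_pow, ha.2, hb.2, one_mul]⟩
        one_mem' := ⟨one_mem _, one_pow _⟩
        inv_mem' := fun {a} ha => ⟨inv_mem ha.1, by rw [inv_pow, ha.2, inv_one]⟩ }
    rcases hirr Ω (fun x hx => hx.1) (fun x hx => ⟨hyconj x hx.1, by rw [conj_pow, hx.2]; simp⟩)
      with hb | ht
    · exfalso
      have hnt : Nontrivial (P : Subgroup G) := (nontrivial_iff_ne_bot _).2 hPb
      obtain ⟨n, hn⟩ := IsPGroup.iff_card.1 P.2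
      have hn0 : n ≠ 0 := by
        rintro rfl
        rw [pow_zero, card_eq_one] at hn
        exact hPb hn
      obtain ⟨x, hx⟩ := exists_prime_orderOf_dvd_card' (G := (P : Subgroup G)) p
        (hn ▸ dvd_pow_self p hn0)
      have hxΩ : (x : G) ∈ Ω := ⟨x.2, by
        have := pow_orderOf_eq_one x
        rw [hx] at this
        exact_mod_cast congrArg Subtype.val this⟩
      rw [hb, mem_bot] at hxΩ
      have : x = 1 := Subtype.ext hxΩ
      rw [this, orderOf_one] at hx
      exact hp.1.one_lt.ne hx
    · intro u hu
      have : u ∈ Ω := by rw [ht]; exact hu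
      exact this.2
  · let α := {x : G // x ∈ (P : Subgroup G) ∧ x ≠ 1}
    let f : Function.End α := fun x => ⟨y * x * y⁻¹, hyconj x x.2.1, by simpa using x.2.2⟩
    have hf : ∀ n (x : α), ((f ^ n) x : G) = y ^ n * x * (y ^ n)⁻¹ := by
      intro n
      induction n with
      | zero => intro x; simp only [pow_zero, one_mul, inv_one, mul_one]; rfl
      | succ n ih =>
        intro x
        rw [pow_succ]
        refine (ih (f x)).trans ?_
        simp only [f, pow_succ, mul_inv_rev, mul_assoc]
    have hfix := Equiv.Perm.card_fixedPoints_modEq (f := f) (p := q) (n := 1) (by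
      funext x
      refine Subtype.ext ?_
      rw [hf, pow_one, hyq]
      simp; rfl)
    have h0 : Fintype.card f.fixedPoints = 0 := by
      rw [Fintype.card_eq_zero_iff]
      refine ⟨fun ⟨x, hx⟩ => x.2.2 (hG.eq_one_of_commute h x.2.1 ?_)⟩
      have : y * x * y⁻¹ = (x : G) := congrArg Subtype.val hx
      rw [mul_inv_eq_iff_eq_mul] at this
      exact this.symm
    rw [h0, Nat.modEq_zero_iff_dvd] at hfix
    convert hfix using 1
    rw [Fintype.card_subtype]
    have : (Finset.univ.filter fun z => z ∈ (P : Subgroup G) ∧ z ≠ 1) =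
        (Finset.univ.filter fun y => y ∈ (P : Subgroup G)).erase 1 := by
      ext y; simp [and_comm]
    rw [this, Finset.card_erase_of_mem (by simp [one_mem]), ← Fintype.card_subtype,
      Nat.card_eq_fintype_card]

end IsSimpleBiminimal

theorem IsSchmidt.exists_pow_eq_mul {G : Type*} [Group G] {H P : Subgroup G} {p q : ℕ} {y : G}
    (h : IsSchmidt H p q P y) {x : G} (hx : x ∈ P) (k : ℤ) (n : ℕ) :
    ∃ z ∈ P, (x * y ^ k) ^ n = z * (y ^ k) ^ n := by
  have hyk : y ^ k ∈ H := H.zpow_mem h.mem k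
  induction n with
  | zero => exact ⟨1, P.one_mem, by simp⟩
  | succ n ih =>
    obtain ⟨z, hz, hzn⟩ := ih
    refine ⟨z * ((y ^ k) ^ n * x * ((y ^ k) ^ n)⁻¹),
      P.mul_mem hz (h.conj_mem _ (H.pow_mem hyk n) x hx), ?_⟩
    rw [pow_succ, hzn, pow_succ]
    group

namespace IsFrobeniusSylow
variable {G : Type*} [Group G] {P : Subgroup G} {p q : ℕ} {y : G}

theorem prime (h : IsFrobeniusSylow P p q y) : q.Prime := h.schmidt.prime_q

theorem pow_orderOf (h : IsFrobeniusSylow P p q y) : y ^ q = 1 := by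
  rw [← h.orderOf_eq, pow_orderOf_eq_one]

theorem notMem (h : IsFrobeniusSylow P p q y) : y ∉ P := by
  intro hy
  have h1 := h.schmidt.zpow_mem_iff (k := 1)
  rw [zpow_one] at h1
  have h2 := h.orderOf_eq
  rw [h1.1 hy, orderOf_one] at h2
  exact h.prime.one_lt.ne h2

theorem one_lt_card [Finite G] (h : IsFrobeniusSylow P p q y) : 1 < Nat.card P := by
  rw [one_lt_card_iff_ne_bot]
  exact h.ne_bot

theorem le_card_sub_one [Finite G] (h : IsFrobeniusSylow P p q y) : q ≤ Nat.card P - 1 :=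
  Nat.le_of_dvd (by have := h.one_lt_card; omega) h.dvd_card_sub_one

/-- A subgroup of the normalizer meeting `P` trivially has order at most `q`. -/
theorem card_le [Finite G] (h : IsFrobeniusSylow P p q y) {D : Subgroup G}
    (hD : D ≤ normalizer (P : Set G)) (hDP : ∀ x ∈ D, x ∈ P → x = 1) : Nat.card D ≤ q := by
  have hinj : Function.Injective fun z : P × D =>
      (⟨z.1 * z.2, mul_mem (h.schmidt.le z.1.2) (hD z.2.2)⟩ : normalizer (P : Set G)) := by
    rintro ⟨⟨a, ha⟩, b, hb⟩ ⟨⟨c, hc⟩, d, hd⟩ he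
    simp only [Subtype.mk.injEq] at he
    have e : c⁻¹ * a = d * b⁻¹ := by
      rw [inv_mul_eq_iff_eq_mul, ← mul_assoc, ← he]; simp
    have h3 := hDP (d * b⁻¹) (mul_mem hd (inv_mem hb)) (e ▸ mul_mem (inv_mem hc) ha)
    rw [h3] at e
    simp [inv_mul_eq_one.1 e, mul_inv_eq_one.1 h3]
  have := Nat.card_le_card_of_injective _ hinj
  rw [Nat.card_prod, h.card_normalizer] at this
  exact Nat.le_of_mul_le_mul_left this (by have := h.one_lt_card; omega)

/-- A subgroup of the normalizer not contained in `P` meets the coset `P y`. -/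
theorem exists_mul_mem [Finite G] (h : IsFrobeniusSylow P p q y) {D : Subgroup G}
    (hD : D ≤ normalizer (P : Set G)) (hDP : ¬ D ≤ P) : ∃ v ∈ P, v * y ∈ D := by
  obtain ⟨d, hd, hdP⟩ := Set.not_subset.1 hDP
  obtain ⟨x, hx, k, rfl⟩ := h.schmidt.exists_eq d (hD hd)
  have hk : ¬ (q : ℤ) ∣ k := by
    rintro ⟨c, rfl⟩
    rw [zpow_mul, zpow_natCast, h.pow_orderOf, one_zpow, mul_one] at hdP
    exact hdP hx
  have hc : IsCoprime k (q : ℤ) := by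
    rw [isCoprime_comm, (Nat.prime_iff_prime_int.1 h.prime).coprime_iff_not_dvd]
    exact hk
  obtain ⟨n, hn⟩ : ∃ n : ℕ, (y ^ k) ^ n = y := by
    have : y ∈ zpowers (y ^ k) := by
      obtain ⟨a, b, hab⟩ := hc
      refine ⟨a, ?_⟩
      show (y ^ k) ^ a = y
      rw [← zpow_mul, show k * a = 1 - q * b by linarith, zpow_sub, zpow_mul, zpow_natCast,
        h.pow_orderOf]
      simp
    exact mem_powers_iff_mem_zpowers.2 this
  obtain ⟨z, hz, hzn⟩ := h.schmidt.exists_pow_eq_mul hx k n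
  rw [hn] at hzn
  exact ⟨z, hz, hzn ▸ pow_mem hd n⟩

end IsFrobeniusSylow

namespace IsSimpleBiminimal
variable {G : Type*} [Group G] [Finite G] (hG : IsSimpleBiminimal G)
include hG

theorem eq_of_smul_eq {p : ℕ} [Fact p.Prime] {P T : Sylow p G} {x : G}
    (hx : x ∈ (P : Subgroup G)) (hx1 : x ≠ 1) (h : x • T = T) : T = P := by
  obtain ⟨k, hk⟩ := P.2.exists_pow_eq_one hx
  exact hG.sylow_eq (T.mem_of_mem_normalizer (Sylow.smul_eq_iff_mem_normalizer.1 h) hk) hx hx1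

theorem one_lt_card_sylow {p : ℕ} [Fact p.Prime] {P : Sylow p G} (hP : (P : Subgroup G) ≠ ⊥) :
    1 < Nat.card (Sylow p G) := by
  rw [P.card_eq_index_normalizer]
  have h := hG.normalizer_ne_top hP (hG.ne_top_of_isPGroup P.2)
  have h0 : (normalizer (P : Set G)).index ≠ 0 := index_ne_zero_of_finite
  have h1 : (normalizer (P : Set G)).index ≠ 1 := fun h1 => h (index_eq_one.1 h1)
  omega

theorem card_eq_mul {p q : ℕ} [Fact p.Prime] {P : Sylow p G} {y : G}
    (h : IsFrobeniusSylow (P : Subgroup G) p q y) :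
    Nat.card G = Nat.card (Sylow p G) * (Nat.card P * q) := by
  rw [P.card_eq_index_normalizer, mul_comm]
  have := h.card_normalizer
  rw [← (normalizer (P : Set G)).card_mul_index]
  exact congrArg (· * _) this

theorem card_stabilizer_inf_le {p q : ℕ} [Fact p.Prime] {P T : Sylow p G} {y : G}
    (h : IsFrobeniusSylow (P : Subgroup G) p q y) (hT : T ≠ P) :
    Nat.card (MulAction.stabilizer G P ⊓ MulAction.stabilizer G T : Subgroup G) ≤ q := by
  refine h.card_le (fun x hx => Sylow.smul_eq_iff_mem_normalizer.1 hx.1) fun x hx hxP => ?_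
  by_contra hx1
  exact hT (hG.eq_of_smul_eq hxP hx1 hx.2)

theorem card_sylow_eq {p : ℕ} [Fact p.Prime] (P T : Sylow p G) :
    Nat.card (T : Subgroup G) = Nat.card (P : Subgroup G) :=
  Nat.card_congr (T.equiv P).toEquiv

section Even
variable {P : Sylow 2 G} {q : ℕ} {y : G} (h : IsFrobeniusSylow (P : Subgroup G) 2 q y)
include h

theorem mul_self_of_mem_sylow_two {T : Sylow 2 G} {u : G} (hu : u ∈ (T : Subgroup G)) :
    u * u = 1 := by
  have hTb : (T : Subgroup G) ≠ ⊥ := by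
    rw [← one_lt_card_iff_ne_bot, hG.card_sylow_eq P T]
    exact h.one_lt_card
  obtain ⟨q', y', h'⟩ := hG.exists_isFrobeniusSylow T hTb
  rw [← sq]
  exact h'.pow_eq_one u hu

open Classical in
theorem card_involutions_swapping [Fintype G] :
    Nat.card P - 1 = q ∧ ∀ T : Sylow 2 G, T ≠ P →
      (Finset.univ.filter fun u : G => (u ≠ 1 ∧ u * u = 1) ∧ u • P = T).card = q ∧
      Nat.card (MulAction.stabilizer G P ⊓ MulAction.stabilizer G T : Subgroup G) = q := by
  let I : Finset G := Finset.univ.filter fun u => u ≠ 1 ∧ u * u = 1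
  let J : Sylow 2 G → Finset G := fun T =>
    Finset.univ.filter fun u : G => (u ≠ 1 ∧ u * u = 1) ∧ u • P = T
  have := Fintype.ofFinite (Sylow 2 G)
  have hcardsub : ∀ K : Subgroup G,
      (Finset.univ.filter fun z => z ∈ K ∧ z ≠ 1).card = Nat.card K - 1 := by
    intro K
    have : (Finset.univ.filter fun z => z ∈ K ∧ z ≠ 1) =
        (Finset.univ.filter fun y => y ∈ K).erase 1 := by
      ext y; simp [and_comm]
    rw [this, Finset.card_erase_of_mem (by simp [K.one_mem]), Nat.card_eq_fintype_card,
      ← Fintype.card_subtype]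
  have hIcard : I.card = Fintype.card (Sylow 2 G) * (Nat.card P - 1) := by
    have : I = Finset.univ.biUnion fun T : Sylow 2 G =>
        Finset.univ.filter fun z => z ∈ (T : Subgroup G) ∧ z ≠ 1 := by
      ext z
      simp only [I, Finset.mem_filter, Finset.mem_univ, true_and, Finset.mem_biUnion]
      constructor
      · rintro ⟨h1, h2⟩
        obtain ⟨S, hS⟩ := exists_sylow_mem (p := 2) (k := 1) (g := z) (by rw [pow_one, sq, h2])
        exact ⟨S, hS, h1⟩
      · rintro ⟨T, h1, h2⟩
        exact ⟨h2, hG.mul_self_of_mem_sylow_two h h1⟩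
    rw [this, Finset.card_biUnion]
    · rw [Finset.sum_congr rfl (g := fun _ => Nat.card P - 1) fun (T : Sylow 2 G) _ =>
        (hcardsub (T : Subgroup G)).trans (by rw [hG.card_sylow_eq P T]),
        Finset.sum_const, Finset.card_univ, smul_eq_mul]
    · intro T _ T' _ hne
      refine Finset.disjoint_left.2 fun z hz hz' => hne ?_
      simp only [Finset.mem_filter, Finset.mem_univ, true_and] at hz hz'
      exact hG.sylow_eq hz.1 hz'.1 hz.2
  have hJP : (J P).card = Nat.card P - 1 := by
    refine Eq.trans ?_ (hcardsub P)
    congr 1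
    ext u
    simp only [J, Finset.mem_filter, Finset.mem_univ, true_and]
    constructor
    · rintro ⟨⟨h1, h2⟩, h3⟩
      exact ⟨P.mem_of_mem_normalizer (Sylow.smul_eq_iff_mem_normalizer.1 h3) (k := 1)
        (by rw [pow_one, sq, h2]), h1⟩
    · rintro ⟨h1, h2⟩
      exact ⟨⟨h2, hG.mul_self_of_mem_sylow_two h h1⟩,
        Sylow.smul_eq_iff_mem_normalizer.2 (h.schmidt.le h1)⟩
  have hJD : ∀ T, (J T).card ≤
      Nat.card (MulAction.stabilizer G P ⊓ MulAction.stabilizer G T : Subgroup G) := by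
    intro T
    rcases (J T).eq_empty_or_nonempty with he | ⟨u, hu⟩
    · simp [he]
    · simp only [J, Finset.mem_filter, Finset.mem_univ, true_and] at hu
      rw [Nat.card_eq_fintype_card, Fintype.card_subtype]
      refine Finset.card_le_card_of_injOn (fun w => u * w) ?_ (mul_right_injective u).injOn
      intro w hw
      simp only [J, Finset.mem_coe, Finset.mem_filter, Finset.mem_univ, true_and] at hw ⊢
      have huT : u • T = P := by rw [← hu.2, smul_smul, hu.1.2, one_smul]
      have hwT : w • T = P := by rw [← hw.2, smul_smul, hw.1.2, one_smul]
      refine ⟨?_, ?_⟩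
      · show (u * w) • P = P
        rw [mul_smul, hw.2, huT]
      · show (u * w) • T = T
        rw [mul_smul, hwT, hu.2]
  have hJq : ∀ T, T ≠ P → (J T).card ≤ q := fun T hT =>
    (hJD T).trans (hG.card_stabilizer_inf_le h hT)
  have hsum : I.card = ∑ T, (J T).card := by
    rw [Finset.card_eq_sum_card_fiberwise (f := fun u => u • P) (t := Finset.univ)
      (fun _ _ => Finset.mem_coe.2 (Finset.mem_univ _))]
    refine Finset.sum_congr rfl fun T _ => ?_
    rw [Finset.filter_filter]
  rw [hIcard, ← Finset.sum_erase_add _ _ (Finset.mem_univ P), hJP] at hsum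
  have hk : 1 < Fintype.card (Sylow 2 G) := by
    rw [← Nat.card_eq_fintype_card]
    exact hG.one_lt_card_sylow h.ne_bot
  have hec : (Finset.univ.erase P).card = Fintype.card (Sylow 2 G) - 1 := by
    rw [Finset.card_erase_of_mem (Finset.mem_univ _), Finset.card_univ]
  have hsum' : ∑ T ∈ Finset.univ.erase P, (J T).card =
      (Fintype.card (Sylow 2 G) - 1) * (Nat.card P - 1) := by
    obtain ⟨k, hk'⟩ := Nat.exists_eq_add_of_lt hk
    rw [hk'] at hsum ⊢
    simp only [show 1 + k + 1 - 1 = k + 1 by omega] at hsum ⊢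
    rw [show 1 + k + 1 = (k + 1) + 1 by omega, add_mul (k + 1) 1, one_mul] at hsum
    exact (Nat.add_right_cancel hsum).symm
  have hle : ∀ T ∈ Finset.univ.erase P, (J T).card ≤ q := fun T hT =>
    hJq T (Finset.ne_of_mem_erase hT)
  have hq : Nat.card P - 1 = q := by
    refine le_antisymm ?_ h.le_card_sub_one
    have := Finset.sum_le_sum hle
    rw [hsum', Finset.sum_const, hec, smul_eq_mul] at this
    exact Nat.le_of_mul_le_mul_left this (by omega)
  refine ⟨hq, fun T hT => ?_⟩
  have hJT : (J T).card = q := by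
    refine (Finset.sum_eq_sum_iff_of_le hle).1 ?_ T (Finset.mem_erase.2 ⟨hT, Finset.mem_univ _⟩)
    rw [hsum', Finset.sum_const, hec, smul_eq_mul, hq]
  refine ⟨hJT, le_antisymm (hG.card_stabilizer_inf_le h hT) ?_⟩
  rw [← hJT]
  exact hJD T

end Even
end IsSimpleBiminimal

namespace IsSimpleBiminimal
variable {G : Type*} [Group G] [Finite G] (hG : IsSimpleBiminimal G)
include hG

section Even
variable {P : Sylow 2 G} {q : ℕ} {y : G} (h : IsFrobeniusSylow (P : Subgroup G) 2 q y)
include h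

theorem card_sylow_two_sub_one : Nat.card P - 1 = q := by
  classical
  have := Fintype.ofFinite G
  exact (hG.card_involutions_swapping h).1

/-- Two Sylow `2`-subgroups other than `P` with a common stabilizing element outside `1` that also
normalizes `P` coincide. -/
theorem eq_of_mem_stabilizers {T T' : Sylow 2 G} (hT : T ≠ P) (hT' : T' ≠ P) {z : G} (hz : z ≠ 1)
    (hP : z • P = P) (hzT : z • T = T) (hzT' : z • T' = T') : T = T' := by
  classical
  have := Fintype.ofFinite G
  have hq : Fact q.Prime := ⟨h.prime⟩
  -- an involution swapping `P` and `T` inverts the stabilizer of both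
  have key : ∀ T : Sylow 2 G, T ≠ P → z • T = T → ∃ u : G, u * u = 1 ∧ u ≠ 1 ∧ u • P = T ∧
      u * z * u = z⁻¹ ∧ (zpowers z : Subgroup G) =
        MulAction.stabilizer G P ⊓ MulAction.stabilizer G T := by
    intro T hT hzT
    obtain ⟨hJ, hD⟩ := (hG.card_involutions_swapping h).2 T hT
    set D : Subgroup G := MulAction.stabilizer G P ⊓ MulAction.stabilizer G T with hDdef
    set J := Finset.univ.filter fun u : G => (u ≠ 1 ∧ u * u = 1) ∧ u • P = T with hJdef
    have hzD : z ∈ D := ⟨hP, hzT⟩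
    obtain ⟨u, hu⟩ : J.Nonempty := by
      rw [← Finset.card_pos, hJ]; exact h.prime.pos
    have hu' := hu
    simp only [hJdef, Finset.mem_filter, Finset.mem_univ, true_and] at hu'
    obtain ⟨⟨hu1, huu⟩, huP⟩ := hu'
    have huT : u • T = P := by rw [← huP, smul_smul, huu, one_smul]
    refine ⟨u, huu, hu1, huP, ?_, ?_⟩
    · have himg : J.image (fun w => u * w) = Finset.univ.filter fun d => d ∈ D := by
        refine Finset.eq_of_subset_of_card_le ?_ ?_
        · intro d hd
          obtain ⟨w, hw, rfl⟩ := Finset.mem_image.1 hd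
          simp only [hJdef, Finset.mem_filter, Finset.mem_univ, true_and] at hw ⊢
          have hwT : w • T = P := by rw [← hw.2, smul_smul, hw.1.2, one_smul]
          refine ⟨?_, ?_⟩
          · show (u * w) • P = P
            rw [mul_smul, hw.2, huT]
          · show (u * w) • T = T
            rw [mul_smul, hwT, huP]
        · rw [Finset.card_image_of_injective _ (mul_right_injective u), hJ, ← hD,
            Nat.card_eq_fintype_card, Fintype.card_subtype]
      have hz' : z ∈ J.image (fun w => u * w) := by
        rw [himg]; simpa using hzD
      obtain ⟨w, hw, rfl⟩ := Finset.mem_image.1 hz'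
      simp only [hJdef, Finset.mem_filter, Finset.mem_univ, true_and] at hw
      have h1 : u⁻¹ = u := inv_eq_of_mul_eq_one_left huu
      have h2 : w⁻¹ = w := inv_eq_of_mul_eq_one_left hw.1.2
      rw [mul_inv_rev, h1, h2, ← mul_assoc, huu, one_mul]
    · refine eq_of_le_of_card_ge (zpowers_le.2 hzD) ?_
      rw [hD]
      have hd := card_dvd_of_le (zpowers_le.2 hzD)
      rw [hD] at hd
      rcases (Nat.dvd_prime h.prime).1 hd with h1 | h1
      · rw [card_eq_one, zpowers_eq_bot] at h1
        exact absurd h1 hz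
      · exact h1.ge
  obtain ⟨u, huu, hu1, huP, huz, hDz⟩ := key T hT hzT
  obtain ⟨u', huu', hu1', huP', huz', hDz'⟩ := key T' hT' hzT'
  have hcardz : Nat.card (zpowers z) = q := by
    rw [hDz]; exact ((hG.card_involutions_swapping h).2 T hT).2
  have hzq : z ^ q = 1 := by rw [← hcardz, Nat.card_zpowers, pow_orderOf_eq_one]
  obtain ⟨S, hzS⟩ := exists_sylow_mem (p := q) (k := 1) (g := z) (by simpa using hzq)
  have hSb : (S : Subgroup G) ≠ ⊥ := by
    intro hS
    rw [hS, mem_bot] at hzS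
    exact hz hzS
  obtain ⟨r, w, hS⟩ := hG.exists_isFrobeniusSylow S hSb
  have huinv : u⁻¹ = u := inv_eq_of_mul_eq_one_left huu
  have huN : u ∈ normalizer (S : Set G) := by
    refine hG.mem_normalizer_of_conj_mem_sylow S hzS hz ?_
    rw [huinv, huz]
    exact inv_mem hzS
  have huS : u ∉ (S : Subgroup G) := by
    intro huS
    obtain ⟨k, hk⟩ := S.2.exists_pow_eq_one huS
    exact hu1 (pow_eq_one_of_coprime_pow (m := 2) (n := q ^ k)
      (((Nat.coprime_primes Nat.prime_two h.prime).2 h.schmidt.ne).pow_right k)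
      (by rw [sq, huu]) hk)
  have hr : r = 2 := by
    refine ((hS.schmidt.eq_or_eq_of_dvd Nat.prime_two ?_).resolve_left ?_).symm
    · have h1 : orderOf u = 2 := orderOf_eq_prime (by rw [sq, huu]) hu1
      rw [← h1, ← Nat.card_zpowers]
      exact card_dvd_of_le (zpowers_le.2 huN)
    · exact h.schmidt.ne
  subst hr
  have hwz : w * z * w⁻¹ = z⁻¹ := by
    obtain ⟨s, hs, k, hk⟩ := hS.schmidt.exists_eq u huN
    have hw2 := hS.pow_orderOf
    have hwk : w ^ k = w := by
      rcases Int.even_or_odd' k with ⟨c, rfl | rfl⟩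
      · rw [zpow_mul, zpow_ofNat, hw2, one_zpow, mul_one] at hk
        exact absurd (hk ▸ hs) huS
      · rw [zpow_add, zpow_mul, zpow_ofNat, hw2, one_zpow, one_mul, zpow_one]
    have hw : w = s⁻¹ * u := by rw [hk, hwk]; group
    have hc : Commute s⁻¹ z⁻¹ := (hS.comm s hs z hzS).inv_inv
    rw [hw, mul_inv_rev, huinv, inv_inv]
    calc s⁻¹ * u * z * (u * s) = s⁻¹ * (u * z * u) * s := by group
      _ = z⁻¹ := by rw [huz, hc.eq]; group
  have hSz : zpowers z = (S : Subgroup G) := by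
    refine (hS.irreducible _ (zpowers_le.2 hzS) ?_).resolve_left (by simpa using hz)
    rintro _ ⟨k, rfl⟩
    show w * z ^ k * w⁻¹ ∈ zpowers z
    rw [← conj_zpow, hwz]
    exact zpow_mem (inv_mem (mem_zpowers z)) k
  have hmem : u * u' ∈ zpowers z := by
    rw [hSz]
    refine hS.mem_of_commute z hzS hz _ ?_
    show u * u' * z = z * (u * u')
    have e1 : u' * z = z⁻¹ * u' := by
      rw [← huz', mul_assoc, mul_assoc, huu', mul_one]
    have e2 : u * z⁻¹ = z * u := by
      rw [← huz, ← mul_assoc, ← mul_assoc, huu, one_mul]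
    rw [mul_assoc, e1, ← mul_assoc, e2, mul_assoc]
  rw [hDz] at hmem
  have h1 : (u * u') • T = T := hmem.2
  have h2 : (u * u') • P = P := hmem.1
  rw [mul_smul, huP'] at h2
  have h3 : u • (u • T') = T' := by rw [smul_smul, huu, one_smul]
  rw [h2, huP] at h3
  exact h3

theorem card_sylow_two : Nat.card (Sylow 2 G) = Nat.card P + 1 := by
  classical
  have := Fintype.ofFinite G
  have := Fintype.ofFinite (Sylow 2 G)
  have hk := hG.one_lt_card_sylow h.ne_bot
  have hα : Nat.card {T : Sylow 2 G // T ≠ P} = Nat.card (Sylow 2 G) - 1 := by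
    rw [Nat.card_eq_fintype_card, Nat.card_eq_fintype_card, Fintype.card_subtype_compl,
      Fintype.card_subtype_eq]
  have hle : Nat.card {T : Sylow 2 G // T ≠ P} ≤ Nat.card P := by
    have key : ∀ T : {T : Sylow 2 G // T ≠ P}, ∃ v ∈ (P : Subgroup G),
        v * y ∈ (MulAction.stabilizer G P ⊓ MulAction.stabilizer G T.1 : Subgroup G) := by
      rintro ⟨T, hT⟩
      refine h.exists_mul_mem (fun x hx => Sylow.smul_eq_iff_mem_normalizer.1 hx.1) fun hle => ?_
      have hc := ((hG.card_involutions_swapping h).2 T hT).2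
      have : (MulAction.stabilizer G P ⊓ MulAction.stabilizer G T : Subgroup G) = ⊥ := by
        rw [eq_bot_iff]
        intro x hx
        by_contra hx1
        exact hT (hG.eq_of_smul_eq (hle hx) hx1 hx.2)
      rw [this, card_bot] at hc
      exact h.prime.one_lt.ne hc
    choose f hfP hf using key
    refine Nat.card_le_card_of_injective (fun T => (⟨f T, hfP T⟩ : P)) fun T T' he => ?_
    have he' : f T = f T' := congrArg Subtype.val he
    have hne : f T * y ≠ 1 := by
      intro h1
      exact h.notMem (eq_inv_of_mul_eq_one_right h1 ▸ inv_mem (hfP T))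
    exact Subtype.ext (hG.eq_of_mem_stabilizers h T.2 T'.2 hne (hf T).1 (hf T).2
      (he' ▸ (hf T').2))
  have hge : Nat.card P ≤ Nat.card {T : Sylow 2 G // T ≠ P} := by
    have : Nontrivial (Sylow 2 G) := Finite.one_lt_card_iff_nontrivial.1 hk
    obtain ⟨T, hT⟩ := exists_ne P
    refine Nat.card_le_card_of_injective (fun v : P => (⟨(v : G) • T, fun he => hT ?_⟩ :
      {T : Sylow 2 G // T ≠ P})) ?_
    · have h1 : (v : G) • P = P := Sylow.smul_eq_iff_mem_normalizer.2 (h.schmidt.le v.2)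
      exact smul_left_cancel (v : G) (he.trans h1.symm)
    · intro v w he
      have he' : (v : G) • T = (w : G) • T := congrArg Subtype.val he
      by_contra hne
      refine hT (hG.eq_of_smul_eq (x := (w : G)⁻¹ * v) (mul_mem (inv_mem w.2) v.2) ?_ ?_)
      · intro h1
        exact hne (Subtype.ext (inv_mul_eq_one.1 h1).symm)
      · rw [mul_smul, he', inv_smul_smul]
  omega

end Even
end IsSimpleBiminimal

namespace IsSimpleBiminimal
variable {G : Type*} [Group G] [Finite G] (hG : IsSimpleBiminimal G)
include hG

section Even
variable {P : Sylow 2 G} {q : ℕ} {y : G} (h : IsFrobeniusSylow (P : Subgroup G) 2 q y)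
include h

theorem eq_one_of_smul_three {T₁ T₂ T₃ : Sylow 2 G} (h12 : T₁ ≠ T₂) (h13 : T₁ ≠ T₃) (h23 : T₂ ≠ T₃)
    {z : G} (h1 : z • T₁ = T₁) (h2 : z • T₂ = T₂) (h3 : z • T₃ = T₃) : z = 1 := by
  by_contra hz
  have hTb : (T₁ : Subgroup G) ≠ ⊥ := by
    rw [← one_lt_card_iff_ne_bot, hG.card_sylow_eq P T₁]
    exact h.one_lt_card
  obtain ⟨q', y', h'⟩ := hG.exists_isFrobeniusSylow T₁ hTb
  exact h23 (hG.eq_of_mem_stabilizers h' h12.symm h13.symm hz h1 h2 h3)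

theorem card_eq_of_sylow_two :
    Nat.card G = (Nat.card P + 1) * (Nat.card P * (Nat.card P - 1)) := by
  rw [hG.card_eq_mul h, hG.card_sylow_two h, hG.card_sylow_two_sub_one h]

theorem card_sylow_two_eq_four : Nat.card P = 4 := by
  classical
  have := Fintype.ofFinite G
  have := Fintype.ofFinite (Sylow 2 G)
  have hq := hG.card_sylow_two_sub_one h
  have hgc := hG.card_eq_of_sylow_two h
  have ha1 := h.one_lt_card
  obtain ⟨n, hn⟩ := IsPGroup.iff_card.1 P.2
  have hn' : Nat.card P = 2 ^ n := hn
  have hcp : Nat.card P = Nat.card (P : Subgroup G) := rfl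
  by_contra h4
  have hnq : ¬ 3 ∣ Nat.card P * (Nat.card P - 1) := by
    rw [Nat.prime_three.dvd_mul, not_or]
    constructor
    · rw [hn']
      intro hd
      have := Nat.prime_three.dvd_of_dvd_pow hd
      omega
    · rw [hq]
      intro hd
      have := (Nat.prime_dvd_prime_iff_eq Nat.prime_three h.prime).1 hd
      omega
  have h3 : 3 ∣ Nat.card G := by
    rw [hgc]
    have h3n : ¬ 3 ∣ Nat.card P := fun hd => hnq (hd.mul_right _)
    have h3n' : ¬ 3 ∣ Nat.card P - 1 := fun hd => hnq (hd.mul_left _)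
    have : 3 ∣ Nat.card P + 1 := by omega
    exact this.mul_right _
  have : Fact (Nat.Prime 3) := ⟨Nat.prime_three⟩
  obtain ⟨R⟩ : Nonempty (Sylow 3 G) := inferInstance
  have hRb : (R : Subgroup G) ≠ ⊥ := R.ne_bot_of_dvd_card h3
  obtain ⟨r, w, hR⟩ := hG.exists_isFrobeniusSylow R hRb
  -- elements of order three
  let A : Finset G := Finset.univ.filter fun z => z ∈ (R : Subgroup G) ∧ z ≠ 1
  have hA : A.card = Nat.card R - 1 := by
    have : A = (Finset.univ.filter fun y => y ∈ (R : Subgroup G)).erase 1 := by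
      ext y; simp [A, and_comm]
    rw [this, Finset.card_erase_of_mem (by simp [one_mem]), ← Fintype.card_subtype,
      ← Nat.card_eq_fintype_card]
  have hconj := card_mul_card_le_card_mul_card_conjugates A (normalizer (R : Set G)) (by
    intro g a ha hg
    simp only [A, Finset.mem_filter, Finset.mem_univ, true_and] at ha hg
    exact hG.mem_normalizer_of_conj_mem_sylow R ha.1 ha.2 hg.1)
  set B := (Finset.univ ×ˢ A).image fun z : G × G => z.1 * z.2 * z.1⁻¹ with hBdef
  have hB : ∀ z ∈ B, z ≠ 1 ∧ z ^ 3 = 1 := by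
    intro z hz
    simp only [hBdef, A, Finset.mem_image, Finset.mem_product, Finset.mem_univ, true_and,
      Finset.mem_filter, Prod.exists] at hz
    obtain ⟨g, a, ⟨ha, ha1⟩, rfl⟩ := hz
    exact ⟨by simpa using ha1, by rw [conj_pow, hR.pow_eq_one a ha]; simp⟩
  have hBfix : ∀ z ∈ B, ∀ T : Sylow 2 G, z • T ≠ T := by
    intro z hz T hzT
    obtain ⟨hz1, hz3⟩ := hB z hz
    have hTb : (T : Subgroup G) ≠ ⊥ := by
      rw [← one_lt_card_iff_ne_bot, hG.card_sylow_eq P T]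
      exact h.one_lt_card
    obtain ⟨q', y', h'⟩ := hG.exists_isFrobeniusSylow T hTb
    apply hnq
    have h1 : Nat.card (T : Subgroup G) = Nat.card P := hG.card_sylow_eq P T
    have h2 := h'.card_normalizer
    have h3 : Nat.card T - 1 = q' := hG.card_sylow_two_sub_one h'
    rw [← h3, h1] at h2
    rw [← h2, ← orderOf_eq_prime hz3 hz1, ← Nat.card_zpowers]
    exact card_dvd_of_le (zpowers_le.2 (Sylow.smul_eq_iff_mem_normalizer.1 hzT))
  have hcount : B.card * (Nat.card P + 1) ≤ (Nat.card P + 1) * (Nat.card P * (Nat.card P - 1)) := by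
    have hk : Fintype.card (Sylow 2 G) = Nat.card P + 1 := by
      rw [← Nat.card_eq_fintype_card, hG.card_sylow_two h]
    let U : Finset (Sylow 2 G × Sylow 2 G × Sylow 2 G) :=
      Finset.univ.filter fun t => t.2.1 ≠ t.1 ∧ t.2.2 ≠ t.1 ∧ t.2.2 ≠ t.2.1
    have hU : U.card ≤ (Nat.card P + 1) * (Nat.card P * (Nat.card P - 1)) := by
      have : U ⊆ (Finset.univ : Finset (Sylow 2 G)).biUnion fun T =>
          ((Finset.univ.erase T).biUnion fun T' =>
            (((Finset.univ.erase T).erase T')).image fun T'' => (T, T', T'')) := by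
        rintro ⟨T, T', T''⟩ ht
        simp only [U, Finset.mem_filter, Finset.mem_univ, true_and] at ht
        simp only [Finset.mem_biUnion, Finset.mem_univ, true_and, Finset.mem_image,
          Finset.mem_erase]
        exact ⟨T, T', ⟨ht.1, trivial⟩, T'', ⟨ht.2.2, ht.2.1, trivial⟩, rfl⟩
      refine (Finset.card_le_card this).trans ?_
      refine (Finset.card_biUnion_le_card_mul _ _ (Nat.card P * (Nat.card P - 1)) fun T _ => ?_).trans
        (by rw [Finset.card_univ, hk])
      refine (Finset.card_biUnion_le_card_mul _ _ (Nat.card P - 1) fun T' hT' => ?_).trans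
        (by rw [Finset.card_erase_of_mem (Finset.mem_univ _), Finset.card_univ, hk]; simp)
      refine Finset.card_image_le.trans ?_
      rw [Finset.card_erase_of_mem hT', Finset.card_erase_of_mem (Finset.mem_univ _),
        Finset.card_univ, hk]
      omega
    refine le_trans ?_ hU
    rw [← hk, ← Finset.card_univ, ← Finset.card_product]
    refine Finset.card_le_card_of_injOn (fun z => (z.2, z.1 • z.2, z.1 • z.1 • z.2)) ?_ ?_
    · rintro ⟨z, T⟩ hz
      simp only [Finset.mem_coe, Finset.mem_product, Finset.mem_univ, and_true] at hz
      simp only [U, Finset.mem_coe, Finset.mem_filter, Finset.mem_univ, true_and]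
      refine ⟨hBfix z hz T, fun h2 => hBfix z hz T ?_, hBfix z hz _⟩
      have : z • z • z • T = T := by
        rw [smul_smul, smul_smul, ← sq, ← pow_succ, (hB z hz).2, one_smul]
      rwa [h2] at this
    · rintro ⟨z, T⟩ hz ⟨z', T'⟩ hz' he
      simp only [Finset.mem_coe, Finset.mem_product, Finset.mem_univ, and_true] at hz hz'
      simp only [Prod.mk.injEq] at he
      obtain ⟨rfl, he1, he2⟩ := he
      have e3 : ∀ z ∈ B, z • z • z • T = T := fun z hz => by
        rw [smul_smul, smul_smul, ← sq, ← pow_succ, (hB z hz).2, one_smul]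
      have := hG.eq_one_of_smul_three h (hBfix z hz T).symm
        (T₃ := z • z • T) (fun h2 => hBfix z hz T (by
          have := e3 z hz
          rwa [← h2] at this)) (hBfix z hz (z • T)).symm (z := z⁻¹ * z')
        (by rw [mul_smul, ← he1, inv_smul_smul])
        (by rw [mul_smul, inv_smul_eq_iff, he2, he1])
        (by rw [mul_smul, inv_smul_eq_iff, e3 z hz, he2, e3 z' hz'])
      rw [inv_mul_eq_one] at this
      rw [this]
  have hBle : B.card ≤ Nat.card P * (Nat.card P - 1) := by
    rw [mul_comm] at hcount
    exact Nat.le_of_mul_le_mul_left hcount (by omega)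
  -- the order of `R` is `|P| + 1`
  have hb1 := hR.one_lt_card
  have hrle := hR.le_card_sub_one
  have hRN : Nat.card (normalizer (R : Set G)) = Nat.card R * r := hR.card_normalizer
  have hb1' : 1 < Nat.card R := hb1
  have hrle' : r ≤ Nat.card R - 1 := hrle
  rw [hA, hRN, ← Nat.card_eq_fintype_card, hgc] at hconj
  set a := Nat.card P with ha
  set b := Nat.card R with hb
  have hpos : 0 < a * (a - 1) := Nat.mul_pos (by omega) (by omega)
  have hmain : (a + 1) * (b - 1) ≤ b * r := by
    have : (a * (a - 1)) * ((a + 1) * (b - 1)) ≤ (a * (a - 1)) * (b * r) := by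
      calc (a * (a - 1)) * ((a + 1) * (b - 1)) = (a + 1) * (a * (a - 1)) * (b - 1) := by ring
        _ ≤ b * r * B.card := hconj
        _ ≤ b * r * (a * (a - 1)) := Nat.mul_le_mul_left _ hBle
        _ = _ := by ring
    exact Nat.le_of_mul_le_mul_left this hpos
  have hab : a + 1 ≤ b := by
    have : (a + 1) * (b - 1) ≤ b * (b - 1) := hmain.trans (Nat.mul_le_mul_left _ hrle')
    exact Nat.le_of_mul_le_mul_right this (by omega)
  have hbd : b ∣ a + 1 := by
    have h1 : b ∣ (a + 1) * (a * (a - 1)) := by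
      rw [← hgc]; exact card_subgroup_dvd_card (R : Subgroup G)
    refine Nat.Coprime.dvd_of_dvd_mul_right ?_ h1
    obtain ⟨m, hm⟩ := IsPGroup.iff_card.1 R.2
    have hm' : b = 3 ^ m := hm
    rw [hm']
    exact Nat.Coprime.pow_left _ ((Nat.Prime.coprime_iff_not_dvd Nat.prime_three).2 hnq)
  have hb : b = a + 1 := le_antisymm (Nat.le_of_dvd (by omega) hbd) hab
  have hr : r = a := by
    rw [hb] at hmain hrle'
    have := Nat.le_of_mul_le_mul_left hmain (by omega)
    omega
  have h2a : 2 ∣ a := by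
    rw [hn']
    refine dvd_pow_self 2 ?_
    rintro rfl
    rw [pow_zero] at hn'
    omega
  have := (Nat.prime_dvd_prime_iff_eq Nat.prime_two hR.prime).1 (hr ▸ h2a)
  have := h.prime.two_le
  omega

end Even

theorem card_eq_sixty (h2 : 2 ∣ Nat.card G) : Nat.card G = 60 ∧ Nat.card (Sylow 2 G) = 5 := by
  obtain ⟨P⟩ : Nonempty (Sylow 2 G) := inferInstance
  obtain ⟨q, y, h⟩ := hG.exists_isFrobeniusSylow P (P.ne_bot_of_dvd_card h2)
  rw [hG.card_eq_of_sylow_two h, hG.card_sylow_two h, hG.card_sylow_two_eq_four h]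
  exact ⟨rfl, rfl⟩

theorem nonempty_mulEquiv_alternatingGroup (h2 : 2 ∣ Nat.card G) :
    Nonempty (G ≃* alternatingGroup (Fin 5)) := by
  classical
  obtain ⟨hc, h5⟩ := hG.card_eq_sixty h2
  have e : Sylow 2 G ≃ Fin 5 := Finite.equivFinOfCardEq h5
  let φ : G →* Equiv.Perm (Fin 5) :=
    (e.permCongrHom : Equiv.Perm (Sylow 2 G) ≃* _).toMonoidHom.comp
      (MulAction.toPermHom G (Sylow 2 G))
  have hφ : Function.Injective φ := by
    rw [← MonoidHom.ker_eq_bot_iff]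
    refine (hG.eq_bot_or_eq_top _ inferInstance).resolve_right fun ht => ?_
    obtain ⟨P⟩ : Nonempty (Sylow 2 G) := inferInstance
    have : Nontrivial (Sylow 2 G) := Finite.one_lt_card_iff_nontrivial.1 (by rw [h5]; norm_num)
    obtain ⟨T, hT⟩ := exists_ne P
    obtain ⟨g, hg⟩ := MulAction.exists_smul_eq G P T
    have h1 : φ g = 1 := MonoidHom.mem_ker.1 (by rw [ht]; trivial)
    have h3 := congrArg e.symm (congrArg (fun σ : Equiv.Perm (Fin 5) => σ (e P)) h1)
    simp [φ, Equiv.permCongrHom] at h3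
    exact hT (hg.symm.trans h3)
  have hcard : Nat.card φ.range = 60 := by
    rw [← hc]
    exact (Nat.card_congr (MonoidHom.ofInjective hφ).toEquiv).symm
  have hidx : φ.range.index = 2 := by
    have h1 := φ.range.card_mul_index
    rw [hcard, Nat.card_perm, Nat.card_fin] at h1
    have : Nat.factorial 5 = 120 := rfl
    omega
  have := Equiv.Perm.eq_alternatingGroup_of_index_eq_two hidx
  exact ⟨(MonoidHom.ofInjective hφ).trans (MulEquiv.subgroupCongr this)⟩

end IsSimpleBiminimal

end

open MonoidAlgebra in
theorem MonoidAlgebra.trace_mulLeft {G : Type*} [Group G] [Fintype G] (b : MonoidAlgebra ℂ G) :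
    LinearMap.trace ℂ _ (LinearMap.mulLeft ℂ b) = Fintype.card G * b.coeff 1 := by
  classical
  rw [LinearMap.trace_eq_matrix_trace ℂ (MonoidAlgebra.basis G ℂ), Matrix.trace]
  have : ∀ x : G, (LinearMap.toMatrix (MonoidAlgebra.basis G ℂ) (MonoidAlgebra.basis G ℂ)
      (LinearMap.mulLeft ℂ b)).diag x = b.coeff 1 := by
    intro x
    rw [Matrix.diag_apply, LinearMap.toMatrix_apply, MonoidAlgebra.basis_apply]
    change (b * single x 1).coeff x = _
    simp
  simp only [this]
  simp

theorem Pi.trace_mulLeft_matrix {n : ℕ} {d : Fin n → ℕ}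
    (M : ∀ i, Matrix (Fin (d i)) (Fin (d i)) ℂ) :
    LinearMap.trace ℂ _ (LinearMap.mulLeft ℂ M) = ∑ i, (d i : ℂ) * (M i).trace := by
  classical
  rw [LinearMap.trace_eq_matrix_trace ℂ
    (Pi.basis fun i => Matrix.stdBasis ℂ (Fin (d i)) (Fin (d i))), Matrix.trace, Fintype.sum_sigma]
  refine Finset.sum_congr rfl fun i _ => ?_
  rw [Fintype.sum_prod_type]
  have : ∀ a b, (LinearMap.toMatrix
      (Pi.basis fun i => Matrix.stdBasis ℂ (Fin (d i)) (Fin (d i)))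
      (Pi.basis fun i => Matrix.stdBasis ℂ (Fin (d i)) (Fin (d i)))
      (LinearMap.mulLeft ℂ M)).diag ⟨i, (a, b)⟩ = M i a a := by
    intro a b
    rw [Matrix.diag_apply, LinearMap.toMatrix_apply, Pi.basis_repr, Pi.basis_apply]
    simp [Matrix.stdBasis, Matrix.mul_apply, Pi.single_apply, apply_ite, ite_apply]
  simp only [this]
  simp [Matrix.trace, Finset.mul_sum]

theorem Matrix.trace_mem_nat_of_isIdempotentElem {n : ℕ} {e : Matrix (Fin n) (Fin n) ℂ}
    (he : e * e = e) : ∃ k : ℕ, e.trace = k := by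
  have h : IsIdempotentElem (Matrix.toLin' e) := by
    rw [IsIdempotentElem, Module.End.mul_eq_comp, ← Matrix.toLin'_mul, he]
  refine ⟨_, Eq.trans ?_ (LinearMap.IsIdempotentElem.isProj_range _ h).trace⟩
  simp

/-- The multiplicity of a linear character in the character of a representation is integral. -/
theorem exists_nat_sum_trace_eq {H : Type*} [Group H] [Fintype H] {n : ℕ}
    (ρ : H →* Matrix (Fin n) (Fin n) ℂ) (ψ : H →* ℂ) :
    ∃ k : ℕ, ∑ x, (ρ x).trace * ψ x⁻¹ = Fintype.card H * k := by
  have h0 : (Fintype.card H : ℂ) ≠ 0 := by simp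
  set e : Matrix (Fin n) (Fin n) ℂ := (Fintype.card H : ℂ)⁻¹ • ∑ x, ψ x⁻¹ • ρ x with he
  have h1 : ∀ y, ψ y⁻¹ • ρ y * e = e := by
    intro y
    rw [he, mul_smul_comm, Finset.mul_sum]
    congr 1
    rw [← Equiv.sum_comp (Equiv.mulLeft y) (fun x => ψ x⁻¹ • ρ x)]
    refine Finset.sum_congr rfl fun x _ => ?_
    rw [Equiv.coe_mulLeft, map_mul, mul_inv_rev, map_mul, smul_mul_smul_comm, mul_comm (ψ y⁻¹)]
  have h2 : e * e = e := by
    conv_lhs => enter [1]; rw [he]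
    rw [smul_mul_assoc, Finset.sum_mul, Finset.sum_congr rfl fun y _ => h1 y]
    simp [← Nat.cast_smul_eq_nsmul ℂ, smul_smul, h0]
  obtain ⟨k, hk⟩ := Matrix.trace_mem_nat_of_isIdempotentElem h2
  refine ⟨k, ?_⟩
  rw [← hk, he, Matrix.trace_smul, Matrix.trace_sum, smul_eq_mul, mul_inv_cancel_left₀ h0]
  refine Finset.sum_congr rfl fun x _ => ?_
  rw [Matrix.trace_smul, smul_eq_mul, mul_comm]

open MonoidAlgebra in
/-- The irreducible representations of a finite group, with the orthogonality relations. -/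
theorem exists_irreducible_representations (G : Type*) [Group G] [Fintype G] [DecidableEq G] :
    ∃ (n : ℕ) (d : Fin n → ℕ) (ρ : ∀ i, G →* Matrix (Fin (d i)) (Fin (d i)) ℂ),
      (∀ i, 0 < d i) ∧
      (∀ x y, ∑ i, (ρ i x).trace * (ρ i y⁻¹).trace =
        (Finset.univ.filter fun s : G => s * x * s⁻¹ = y).card) ∧
      (∀ i, ∑ x, (ρ i x).trace * (ρ i x⁻¹).trace = Fintype.card G) ∧
      ∃ o, ∀ x, (ρ o x).trace = 1 := by
  have hg0 : (Fintype.card G : ℂ) ≠ 0 := by simp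
  obtain ⟨n, d, hd, ⟨φ⟩⟩ :=
    IsSemisimpleRing.exists_algEquiv_pi_matrix_of_isAlgClosed ℂ (MonoidAlgebra ℂ G)
  let ρ : ∀ i, G →* Matrix (Fin (d i)) (Fin (d i)) ℂ := fun i =>
    ((Pi.evalMonoidHom (fun i => Matrix (Fin (d i)) (Fin (d i)) ℂ) i).comp
      φ.toMulEquiv.toMonoidHom).comp (MonoidAlgebra.of ℂ G)
  have hρ : ∀ i x, ρ i x = φ (single x 1) i := fun i x => rfl
  have hd0 : ∀ i, 0 < d i := fun i => Nat.pos_of_ne_zero (NeZero.ne _)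
  have hd0' : ∀ i, (d i : ℂ) ≠ 0 := fun i => NeZero.ne _
  have hcoeff : ∀ b : MonoidAlgebra ℂ G,
      (Fintype.card G : ℂ) * b.coeff 1 = ∑ i, (d i : ℂ) * (φ b i).trace := by
    intro b
    rw [← MonoidAlgebra.trace_mulLeft, ← Pi.trace_mulLeft_matrix,
      ← LinearMap.trace_conj' (LinearMap.mulLeft ℂ b) φ.toLinearEquiv]
    congr 1
    refine LinearMap.ext fun x => ?_
    simp [LinearEquiv.conj_apply]
  have hscalar : ∀ z : MonoidAlgebra ℂ G, (∀ x, single x 1 * z = z * single x 1) →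
      ∀ i, ∃ ω : ℂ, φ z i = ω • 1 := by
    intro z hz i
    have hz' : ∀ a, a * z = z * a := by
      intro a
      induction a using MonoidAlgebra.induction_on with
      | of x => exact hz x
      | add a b ha hb => rw [add_mul, mul_add, ha, hb]
      | smul r a ha => rw [smul_mul_assoc, mul_smul_comm, ha]
    have : φ z i ∈ Set.range (Matrix.scalar (Fin (d i))) := by
      rw [Matrix.mem_range_scalar_iff_commute_single']
      intro a b
      have h := congrArg (fun M => φ M i) (hz' (φ.symm (Pi.single i (Matrix.single a b 1))))
      rw [Commute, SemiconjBy]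
      simpa using h
    obtain ⟨ω, hω⟩ := this
    exact ⟨ω, by rw [← hω, Matrix.scalar_apply, Matrix.smul_one_eq_diagonal]⟩
  have hclass : ∀ i s x, (ρ i (s * x * s⁻¹)).trace = (ρ i x).trace := by
    intro i s x
    rw [map_mul, map_mul, Matrix.trace_mul_comm, ← mul_assoc, ← map_mul]
    simp
  have horth : ∀ i, ∑ x, (ρ i x).trace * (ρ i x⁻¹).trace = Fintype.card G := by
    intro i
    set e := φ.symm (Pi.single i 1) with he
    have h1 : ∀ x, (Fintype.card G : ℂ) * e.coeff x = d i * (ρ i x⁻¹).trace := by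
      intro x
      have h2 := hcoeff (e * single x⁻¹ 1)
      rw [coeff_mul_single_apply] at h2
      simp only [inv_inv, one_mul, mul_one] at h2
      rw [h2, Finset.sum_eq_single i]
      · rw [map_mul, he, AlgEquiv.apply_symm_apply, Pi.mul_apply, Pi.single_eq_same, one_mul, hρ]
      · intro j _ hj
        rw [map_mul, he, AlgEquiv.apply_symm_apply, Pi.mul_apply, Pi.single_eq_of_ne hj]
        simp
      · simp
    have h2 : e = ∑ x, e.coeff x • single x 1 := by
      ext x
      simp
    have h3 : (d i : ℂ) = ∑ x, e.coeff x * (ρ i x).trace := by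
      have h4 : (φ e i).trace = d i := by
        rw [he, AlgEquiv.apply_symm_apply, Pi.single_eq_same]; simp
      rw [← h4]
      conv_lhs => rw [h2]
      rw [map_sum, Finset.sum_apply, Matrix.trace_sum]
      refine Finset.sum_congr rfl fun x _ => ?_
      rw [map_smul, Pi.smul_apply, Matrix.trace_smul, smul_eq_mul, hρ]
    have h5 : (d i : ℂ) * Fintype.card G = d i * ∑ x, (ρ i x).trace * (ρ i x⁻¹).trace := by
      conv_lhs => rw [h3]
      rw [Finset.sum_mul, Finset.mul_sum]
      refine Finset.sum_congr rfl fun x _ => ?_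
      linear_combination (ρ i x).trace * h1 x
    exact (mul_left_cancel₀ (hd0' i) h5).symm
  refine ⟨n, d, ρ, hd0, ?_, horth, ?_⟩
  · intro x y
    set z : MonoidAlgebra ℂ G := ∑ s, single (s * x * s⁻¹) 1 with hz
    have hzc : ∀ u, single u 1 * z = z * single u 1 := by
      intro u
      rw [hz, Finset.mul_sum, Finset.sum_mul,
        ← Equiv.sum_comp (Equiv.mulLeft u) (fun s => single (s * x * s⁻¹) (1 : ℂ) * single u 1)]
      refine Finset.sum_congr rfl fun s _ => ?_
      simp [mul_assoc]
    have h1 := hcoeff (z * single y⁻¹ 1)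
    have h2 : (z * single y⁻¹ 1).coeff 1 =
        ((Finset.univ.filter fun s : G => s * x * s⁻¹ = y).card : ℂ) := by
      rw [coeff_mul_single_apply, hz]
      simp [Finsupp.single_apply]
    rw [h2] at h1
    apply mul_left_cancel₀ hg0
    rw [h1, Finset.mul_sum]
    refine Finset.sum_congr rfl fun i _ => ?_
    obtain ⟨ω, hω⟩ := hscalar z hzc i
    have h3 : (φ z i).trace = Fintype.card G * (ρ i x).trace := by
      rw [hz, map_sum, Finset.sum_apply, Matrix.trace_sum]
      simp only [← hρ, hclass]
      simp
    rw [hω, Matrix.trace_smul, Matrix.trace_one, Fintype.card_fin, smul_eq_mul] at h3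
    rw [map_mul, Pi.mul_apply, hω, smul_mul_assoc, one_mul, Matrix.trace_smul, smul_eq_mul, ← hρ]
    linear_combination -(ρ i y⁻¹).trace * h3
  · set z : MonoidAlgebra ℂ G := ∑ s, single s 1 with hz
    have hz1 : ∀ x, single x 1 * z = z := by
      intro x
      rw [hz, Finset.mul_sum, ← Equiv.sum_comp (Equiv.mulLeft x) (fun s => single s (1 : ℂ))]
      simp
    have hz2 : ∀ x, z * single x 1 = z := by
      intro x
      rw [hz, Finset.sum_mul, ← Equiv.sum_comp (Equiv.mulRight x) (fun s => single s (1 : ℂ))]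
      simp
    have hz0 : z ≠ 0 := by
      intro h
      have := congrArg (fun a => a.coeff 1) h
      simp [hz, Finsupp.single_apply] at this
    have : ∃ i, φ z i ≠ 0 := by
      by_contra! h
      exact hz0 (φ.injective (by rw [map_zero]; exact funext h))
    obtain ⟨i, hi⟩ := this
    obtain ⟨ω, hω⟩ := hscalar z (fun x => by rw [hz1, hz2]) i
    have hω0 : ω ≠ 0 := by rintro rfl; simp [hω] at hi
    have h1 : ∀ x, ρ i x = 1 := by
      intro x
      have h := congrArg (fun M => φ M i) (hz1 x)
      simp only [map_mul, Pi.mul_apply, hω, mul_smul_comm, mul_one] at h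
      exact smul_right_injective _ hω0 h
    have h2 := horth i
    simp only [h1, Matrix.trace_one, Fintype.card_fin, Finset.sum_const, Finset.card_univ,
      nsmul_eq_mul] at h2
    have h3 : (d i : ℂ) * d i = 1 := mul_left_cancel₀ hg0 (by rw [h2, mul_one])
    have h4 : d i = 1 := by
      have : d i * d i = 1 := by exact_mod_cast h3
      exact Nat.eq_one_of_mul_eq_one_right this
    exact ⟨i, fun x => by rw [h1, Matrix.trace_one, Fintype.card_fin, h4, Nat.cast_one]⟩

theorem exists_eq_sub_of_sum_sq_eq_two {ι : Type*} [Fintype ι] [DecidableEq ι] {d v : ι → ℤ}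
    (hd : ∀ χ, 0 < d χ) (hdv : ∑ χ, d χ * v χ = 0) (hv : ∑ χ, v χ * v χ = 2) :
    ∃ α β, α ≠ β ∧ ∀ χ, v χ = (if χ = α then 1 else 0) - (if χ = β then 1 else 0) := by
  have h0 : ∃ χ, v χ ≠ 0 := by
    by_contra! h
    simp [h] at hv
  have hpos : ∃ α, 0 < v α := by
    by_contra! h
    have := (Finset.sum_eq_zero_iff_of_nonpos
      (fun χ _ => mul_nonpos_of_nonneg_of_nonpos (hd χ).le (h χ))).1 hdv
    obtain ⟨χ, hχ⟩ := h0
    have := this χ (Finset.mem_univ _)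
    simp [(hd χ).ne', hχ] at this
  have hneg : ∃ β, v β < 0 := by
    by_contra! h
    have := (Finset.sum_eq_zero_iff_of_nonneg
      (fun χ _ => mul_nonneg (hd χ).le (h χ))).1 hdv
    obtain ⟨χ, hχ⟩ := h0
    have := this χ (Finset.mem_univ _)
    simp [(hd χ).ne', hχ] at this
  obtain ⟨α, hα⟩ := hpos
  obtain ⟨β, hβ⟩ := hneg
  have hne : α ≠ β := by rintro rfl; omega
  have key : ∑ χ, v χ * v χ = v α * v α + (v β * v β +
      ∑ χ ∈ (Finset.univ.erase α).erase β, v χ * v χ) := by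
    rw [Finset.add_sum_erase _ (fun χ => v χ * v χ)
      (Finset.mem_erase.2 ⟨hne.symm, Finset.mem_univ _⟩),
      Finset.add_sum_erase _ (fun χ => v χ * v χ) (Finset.mem_univ _)]
  have hr : 0 ≤ ∑ χ ∈ (Finset.univ.erase α).erase β, v χ * v χ :=
    Finset.sum_nonneg fun χ _ => mul_self_nonneg _
  have h1 : v α = 1 := by nlinarith
  have h2 : v β = -1 := by nlinarith
  have h3 : ∑ χ ∈ (Finset.univ.erase α).erase β, v χ * v χ = 0 := by
    rw [h1, h2] at key; linarith
  rw [Finset.sum_eq_zero_iff_of_nonneg (fun χ _ => mul_self_nonneg _)] at h3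
  refine ⟨α, β, hne, fun χ => ?_⟩
  by_cases hχα : χ = α
  · subst hχα; simp [h1, hne]
  by_cases hχβ : χ = β
  · subst hχβ; simp [h2, hχα]
  · have := h3 χ (by simp [hχα, hχβ])
    simp [hχα, hχβ, mul_self_eq_zero.1 this]

/-- Integral vectors with the Gram matrix `q + δ` that are orthogonal to a positive vector
differ from a common vector by the same sign times distinct basis vectors. -/
theorem exists_coherent {ι T : Type*} [Fintype ι] [DecidableEq ι] [DecidableEq T]
    [Nontrivial T] {d : ι → ℤ} {q : ℤ} {w : T → ι → ℤ}
    (hd : ∀ χ, 0 < d χ) (hdw : ∀ i, ∑ χ, d χ * w i χ = 0)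
    (hw : ∀ i j, ∑ χ, w i χ * w j χ = q + if i = j then 1 else 0) :
    ∃ (ε : ℤ) (u : ι → ℤ) (β : T → ι), ε * ε = 1 ∧ Function.Injective β ∧
      ∀ i χ, w i χ = u χ + ε * if χ = β i then 1 else 0 := by
  obtain ⟨i₀, j₀, hij⟩ := exists_pair_ne T
  have hsub : ∀ j, j ≠ i₀ → ∃ α β, α ≠ β ∧
      ∀ χ, w i₀ χ - w j χ = (if χ = α then 1 else 0) - (if χ = β then 1 else 0) := by
    intro j hj
    apply exists_eq_sub_of_sum_sq_eq_two hd
    · simp [mul_sub, hdw]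
    · simp only [mul_sub, sub_mul, Finset.sum_sub_distrib, hw]
      simp [hj, hj.symm]
  obtain ⟨P, N, hPN⟩ : ∃ P N : T → ι, ∀ j, j ≠ i₀ → P j ≠ N j ∧
      ∀ χ, w i₀ χ - w j χ = (if χ = P j then 1 else 0) - (if χ = N j then 1 else 0) := by
    obtain ⟨α₀, -⟩ := hsub j₀ hij.symm
    have : ∀ j, ∃ αβ : ι × ι, j ≠ i₀ → αβ.1 ≠ αβ.2 ∧
      ∀ χ, w i₀ χ - w j χ = (if χ = αβ.1 then 1 else 0) - (if χ = αβ.2 then 1 else 0) := by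
      intro j
      by_cases hj : j = i₀
      · exact ⟨(α₀, α₀), fun h => (h hj).elim⟩
      · obtain ⟨α, β, h⟩ := hsub j hj
        exact ⟨(α, β), fun _ => h⟩
    choose f hf using this
    exact ⟨fun j => (f j).1, fun j => (f j).2, hf⟩
  have hxor : ∀ j k, j ≠ i₀ → k ≠ i₀ → j ≠ k → (P j = P k ↔ ¬ N j = N k) := by
    intro j k hj hk hjk
    have h1 : ∑ χ, (w i₀ χ - w j χ) * (w i₀ χ - w k χ) = 1 := by
      simp only [mul_sub, sub_mul, Finset.sum_sub_distrib, hw]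
      simp [hj, hjk, hk.symm]
    simp only [(hPN j hj).2, (hPN k hk).2, sub_mul, Finset.sum_sub_distrib, ite_mul, one_mul,
      zero_mul, Finset.sum_ite_eq', Finset.mem_univ, if_true] at h1
    have h2 := (hPN j hj).1
    have h3 := (hPN k hk).1
    constructor
    · intro h4 h5
      rw [← h4, ← h5] at h1
      simp [h2, h2.symm] at h1
    · intro h4
      by_contra h5
      rw [if_neg h5, if_neg h4] at h1
      split_ifs at h1 <;> omega
  by_cases hP : ∀ j, j ≠ i₀ → P j = P j₀
  · refine ⟨1, fun χ => w i₀ χ - if χ = P j₀ then 1 else 0,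
      fun j => if j = i₀ then P j₀ else N j, rfl, ?_, ?_⟩
    · intro j k hjk
      by_contra hne
      by_cases hj : j = i₀
      · have hk : k ≠ i₀ := fun h => hne (hj.trans h.symm)
        simp only [hj, hk, if_true, if_false] at hjk
        exact (hPN k hk).1 ((hP k hk).trans hjk)
      · by_cases hk : k = i₀
        · simp only [hj, hk, if_true, if_false] at hjk
          exact (hPN j hj).1 ((hP j hj).trans hjk.symm)
        · simp only [hj, hk, if_false] at hjk
          exact (hxor j k hj hk hne).1 ((hP j hj).trans (hP k hk).symm) hjk
    · intro j χ
      by_cases hj : j = i₀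
      · simp [hj]
      · have := (hPN j hj).2 χ
        rw [hP j hj] at this
        simp only [hj, if_false]
        linarith
  · push Not at hP
    obtain ⟨k₀, hk₀, hkP⟩ := hP
    have hk : k₀ ≠ j₀ := by rintro rfl; exact hkP rfl
    have hN0 : N k₀ = N j₀ := by
      by_contra h
      exact hkP ((hxor k₀ j₀ hk₀ hij.symm hk).2 h)
    have hN : ∀ j, j ≠ i₀ → N j = N j₀ := by
      intro j hj
      by_contra h
      have h1 : P j = P j₀ := by
        by_cases hjj : j = j₀
        · rw [hjj]
        · exact (hxor j j₀ hj hij.symm hjj).2 h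
      have h2 : P j = P k₀ := by
        by_cases hjj : j = k₀
        · rw [hjj]
        · exact (hxor j k₀ hj hk₀ hjj).2 (hN0 ▸ h)
      exact hkP (h2.symm.trans h1)
    refine ⟨-1, fun χ => w i₀ χ + if χ = N j₀ then 1 else 0,
      fun j => if j = i₀ then N j₀ else P j, rfl, ?_, ?_⟩
    · intro j k hjk
      by_contra hne
      by_cases hj : j = i₀
      · have hk : k ≠ i₀ := fun h => hne (hj.trans h.symm)
        simp only [hj, hk, if_true, if_false] at hjk
        exact (hPN k hk).1 (hjk.symm.trans (hN k hk).symm)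
      · by_cases hk : k = i₀
        · simp only [hj, hk, if_true, if_false] at hjk
          exact (hPN j hj).1 (hjk.trans (hN j hj).symm)
        · simp only [hj, hk, if_false] at hjk
          exact (hxor j k hj hk hne).1 hjk ((hN j hj).trans (hN k hk).symm)
    · intro j χ
      by_cases hj : j = i₀
      · simp only [hj, if_true]
        split_ifs <;> ring
      · have := (hPN j hj).2 χ
        rw [hN j hj] at this
        simp only [hj, if_false]
        linarith

open Finset in
theorem coherent_configuration_contradiction {ι R : Type*} [Fintype ι] [DecidableEq ι] [Fintype R]
    [Nonempty R] [DecidableEq R] {T : R → Type*} [∀ r, Fintype (T r)] [∀ r, DecidableEq (T r)]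
    {o : ι} {d : ι → ℤ} {g : ℚ} {a q : R → ℤ} (w : ∀ r, T r → ι → ℤ)
    (hd : ∀ χ, 0 < d χ) (hdo : d o = 1) (hg : 0 < g) (hsum : ∑ χ, (d χ : ℚ) ^ 2 = g)
    (ha : Function.Injective a) (hq : ∀ r, 2 ≤ q r)
    (ht : ∀ r, (Fintype.card (T r) : ℤ) * q r + 1 = a r)
    (h2 : ∀ r, (2 : ℤ) ∣ Fintype.card (T r)) (hpos : ∀ r, 2 ≤ Fintype.card (T r))
    (hwo : ∀ r i, w r i o = 1) (hdw : ∀ r i, ∑ χ, d χ * w r i χ = 0)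
    (hw : ∀ r i j, ∑ χ, w r i χ * w r j χ = q r + if i = j then 1 else 0)
    (hcross : ∀ r s, r ≠ s → ∀ i j, ∑ χ, w r i χ * w s j χ = 0)
    (hdeg : ∀ χ, (1 : ℚ) = d χ ^ 2 / g + ∑ r, (∑ i, (w r i χ : ℚ) ^ 2 -
      q r / a r * (∑ i, (w r i χ : ℚ)) ^ 2)) : False := by
  have hnt : ∀ r, Nontrivial (T r) := fun r => Fintype.one_lt_card_iff_nontrivial.1 (hpos r)
  have hco := fun r => exists_coherent hd (hdw r) (hw r)
  choose ε u β hε hβ hwu using hco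
  have hdisj : ∀ r s, r ≠ s → ∀ i j, β r i ≠ β s j := by
    intro r s hrs i j h
    obtain ⟨i', hi'⟩ := exists_ne i
    obtain ⟨j', hj'⟩ := exists_ne j
    have h0 : ∑ χ, (w r i χ - w r i' χ) * (w s j χ - w s j' χ) = 0 := by
      simp [mul_sub, sub_mul, Finset.sum_sub_distrib, hcross r s hrs]
    have h1 : ε r * ε s * ∑ χ, ((if χ = β r i then 1 else 0) - (if χ = β r i' then 1 else 0)) *
        ((if χ = β s j then 1 else 0) - (if χ = β s j' then 1 else 0)) = 0 := by
      refine Eq.trans ?_ h0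
      rw [Finset.mul_sum]
      refine Finset.sum_congr rfl fun χ _ => ?_
      rw [hwu, hwu, hwu, hwu]; ring
    have h3 : ε r * ε s ≠ 0 := by
      intro h
      have := congrArg (fun x => x * x) h
      simp only [mul_mul_mul_comm, hε] at this
      norm_num at this
    have h4 := (mul_eq_zero.1 h1).resolve_left h3
    simp only [sub_mul, Finset.sum_sub_distrib, ite_mul, one_mul,
      zero_mul, Finset.sum_ite_eq', Finset.mem_univ, if_true] at h4
    have h5 : β s j ≠ β s j' := fun h => hj' (hβ s h.symm)
    have h6 : β r i' ≠ β s j := fun h' => hi' (hβ r (h'.trans h.symm))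
    rw [h, if_pos rfl, if_neg h5, if_neg h6] at h4
    split_ifs at h4 <;> omega
  have ho : ∀ r i, β r i ≠ o := by
    intro r i h
    obtain ⟨i', hi'⟩ := exists_ne i
    have h1 := hwu r i o
    have h2 := hwu r i' o
    have h3 : o ≠ β r i' := fun h' => hi' (hβ r (h'.symm.trans h.symm))
    rw [hwo, if_pos h.symm] at h1
    rw [hwo, if_neg h3] at h2
    have := hε r
    have : ε r = 0 := by linarith
    simp [this] at *
  have huo : ∀ r, u r o = 1 := by
    intro r
    obtain ⟨i⟩ := (inferInstance : Nonempty (T r))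
    have h1 := hwu r i o
    rw [hwo, if_neg (ho r i).symm] at h1
    linarith
  have hnorm : ∀ r i, ∑ χ, u r χ * u r χ + 2 * ε r * u r (β r i) = q r := by
    intro r i
    have h := hw r i i
    simp only [hwu, mul_add, add_mul, Finset.sum_add_distrib] at h
    simp only [mul_ite, ite_mul, mul_one, mul_zero, zero_mul, Finset.sum_ite_eq', Finset.mem_univ,
      if_true, hε] at h
    linarith
  have hconst : ∀ r s, ∀ i j, u s (β r i) = u s (β r j) := by
    intro r s i j
    by_cases hrs : r = s
    · subst hrs
      have h1 := hnorm r i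
      have h2 := hnorm r j
      have h3 : ε r * (u r (β r i) - u r (β r j)) = 0 := by linarith
      rcases mul_eq_zero.1 h3 with h | h
      · have := hε r; rw [h] at this; norm_num at this
      · linarith
    · obtain ⟨k⟩ := (inferInstance : Nonempty (T s))
      have h1 := hcross r s hrs i k
      have h2 := hcross r s hrs j k
      simp only [hwu r, add_mul, Finset.sum_add_distrib, mul_ite, ite_mul, mul_one, mul_zero,
        zero_mul, Finset.sum_ite_eq', Finset.mem_univ, if_true] at h1 h2
      rw [hwu, if_neg (hdisj r s hrs _ _)] at h1 h2
      have h3 : ε r * (u s (β r i) - u s (β r j)) = 0 := by linarith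
      rcases mul_eq_zero.1 h3 with h | h
      · have := hε r; rw [h] at this; norm_num at this
      · linarith
  obtain ⟨c, hc⟩ : ∃ c : R → R → ℤ, ∀ r s i, u s (β r i) = c r s :=
    ⟨fun r s => u s (β r (Classical.arbitrary _)), fun r s i => hconst r s _ _⟩
  have ha0 : ∀ r, (0 : ℚ) < a r := by
    intro r
    have : 0 < a r := by rw [← ht]; nlinarith [hq r, hpos r]
    exact_mod_cast this
  have htq : ∀ r, (Fintype.card (T r) : ℚ) * q r + 1 = a r := fun r => by exact_mod_cast ht r
  have hVtot : ∀ r, ∑ χ, (∑ i, (w r i χ : ℚ) ^ 2 - q r / a r * (∑ i, (w r i χ : ℚ)) ^ 2) =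
      Fintype.card (T r) := by
    intro r
    have hwQ : ∀ i j, ∑ χ, (w r i χ : ℚ) * w r j χ = q r + if i = j then 1 else 0 :=
      fun i j => by exact_mod_cast hw r i j
    rw [Finset.sum_sub_distrib, Finset.sum_comm, ← Finset.mul_sum]
    simp only [pow_two, hwQ, Finset.sum_mul_sum]
    rw [Finset.sum_comm]
    have : ∀ i, ∑ χ, ∑ j, (w r i χ : ℚ) * w r j χ = Fintype.card (T r) * q r + 1 := by
      intro i
      rw [Finset.sum_comm]
      simp [hwQ, Finset.sum_add_distrib]
    simp only [this]
    simp only [if_true, sum_const, card_univ, nsmul_eq_mul]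
    rw [htq r]
    have := (ha0 r).ne'
    field_simp
    ring
  have hcard : (Fintype.card ι : ℚ) = 1 + ∑ r, (Fintype.card (T r) : ℚ) := by
    have h1 : ∑ _χ : ι, (1 : ℚ) = Fintype.card ι := by simp
    rw [← h1, Finset.sum_congr rfl (fun χ _ => hdeg χ), Finset.sum_add_distrib, Finset.sum_comm,
      Finset.sum_congr rfl (fun r _ => hVtot r), ← Finset.sum_div, hsum, div_self hg.ne']
  let Φ : Option (Σ r, T r) → ι := fun x => x.elim o fun y => β y.1 y.2
  have hΦi : Function.Injective Φ := by
    rintro (_ | ⟨r, i⟩) (_ | ⟨s, j⟩) h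
    · rfl
    · exact (ho _ _ h.symm).elim
    · exact (ho _ _ h).elim
    · by_cases hrs : r = s
      · subst hrs
        obtain rfl := hβ r h
        rfl
      · exact (hdisj r s hrs _ _ h).elim
  have hΦ : Function.Bijective Φ := by
    rw [Fintype.bijective_iff_injective_and_card]
    refine ⟨hΦi, ?_⟩
    have : (Fintype.card (Option (Σ r, T r)) : ℚ) = Fintype.card ι := by
      rw [hcard]; simp [Fintype.card_option, Fintype.card_sigma, add_comm]
    exact_mod_cast this
  have hdecZ : ∀ f : ι → ℤ, ∑ χ, f χ = f o + ∑ r, ∑ i, f (β r i) := by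
    intro f
    rw [← hΦ.sum_comp, Fintype.sum_option, Fintype.sum_sigma]
    rfl
  -- values of the quadratic forms
  have hVo : ∀ r, (∑ i, (w r i o : ℚ) ^ 2 - q r / a r * (∑ i, (w r i o : ℚ)) ^ 2) =
      Fintype.card (T r) / a r := by
    intro r
    have := (ha0 r).ne'
    simp only [hwo, Int.cast_one, one_pow, sum_const, card_univ, nsmul_eq_mul, mul_one]
    field_simp
    rw [← htq r]; ring
  have hVoff : ∀ r s, r ≠ s → ∀ k, (∑ i, (w r i (β s k) : ℚ) ^ 2 -
      q r / a r * (∑ i, (w r i (β s k) : ℚ)) ^ 2) = c s r ^ 2 * (Fintype.card (T r) / a r) := by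
    intro r s hrs k
    have h0 := (ha0 r).ne'
    have h1 : ∀ i, w r i (β s k) = c s r := by
      intro i
      rw [hwu, if_neg (hdisj r s hrs i k).symm, hc]; ring
    simp only [h1, sum_const, card_univ, nsmul_eq_mul]
    field_simp
    rw [← htq r]; ring
  have hVon : ∀ r, ∀ k, (∑ i, (w r i (β r k) : ℚ) ^ 2 -
      q r / a r * (∑ i, (w r i (β r k) : ℚ)) ^ 2) =
        (Fintype.card (T r) * c r r ^ 2 + 2 * ε r * c r r + a r - q r) / a r := by
    intro r k
    have h0 := (ha0 r).ne'
    have hε' : (ε r : ℚ) * ε r = 1 := by exact_mod_cast hε r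
    have h1 : ∀ i, (w r i (β r k) : ℚ) = c r r + ε r * if k = i then 1 else 0 := by
      intro i
      rw [hwu, hc]
      simp [(hβ r).eq_iff]
    have h2 : ∑ i, (w r i (β r k) : ℚ) ^ 2 =
        Fintype.card (T r) * c r r ^ 2 + 2 * ε r * c r r + 1 := by
      have : ∀ i, (w r i (β r k) : ℚ) ^ 2 = c r r ^ 2 +
          (2 * ε r * c r r + 1) * if k = i then 1 else 0 := by
        intro i
        rw [h1]
        split_ifs
        · linear_combination hε'
        · ring
      simp [this, Finset.sum_add_distrib, add_assoc]
    have h3 : ∑ i, (w r i (β r k) : ℚ) = Fintype.card (T r) * c r r + ε r := by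
      simp [h1, Finset.sum_add_distrib]
    rw [h2, h3]
    field_simp
    rw [← htq r]
    linear_combination (- (q r : ℚ)) * hε'
  have hO : ∑ r, (Fintype.card (T r) : ℚ) / a r = 1 - 1 / g := by
    have := hdeg o
    rw [Finset.sum_congr rfl (fun r _ => hVo r), hdo] at this
    push_cast at this
    linarith
  have huu : ∀ r, 1 + Fintype.card (T r) * c r r ^ 2 + 2 * ε r * c r r +
      ∑ s ∈ Finset.univ.erase r, Fintype.card (T s) * c s r ^ 2 = q r := by
    intro r
    rw [← hnorm r (Classical.arbitrary _), hdecZ, huo]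
    simp only [hc, sum_const, card_univ, nsmul_eq_mul]
    rw [← Finset.add_sum_erase _ _ (Finset.mem_univ r)]
    have : ∀ s, (Fintype.card (T s) : ℤ) * (c s r * c s r) = Fintype.card (T s) * c s r ^ 2 :=
      fun s => by ring
    simp only [this]
    ring
  have hnz : ∀ r s, r ≠ s → 1 ≤ c r s ^ 2 + c s r ^ 2 := by
    intro r s hrs
    by_contra! h
    have h3 : c r s = 0 := by
      have := sq_nonneg (c r s); have := sq_nonneg (c s r)
      exact pow_eq_zero_iff two_ne_zero |>.1 (by omega)
    have h4 : c s r = 0 := by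
      have := sq_nonneg (c r s); have := sq_nonneg (c s r)
      exact pow_eq_zero_iff two_ne_zero |>.1 (by omega)
    obtain ⟨i⟩ := (inferInstance : Nonempty (T r))
    obtain ⟨j⟩ := (inferInstance : Nonempty (T s))
    have h5 := hcross r s hrs i j
    rw [hdecZ, hwo, hwo] at h5
    have h6 : (2 : ℤ) ∣ ∑ x, ∑ k, w r i (β x k) * w s j (β x k) := by
      refine Finset.dvd_sum fun x _ => ?_
      by_cases hxr : x = r
      · subst hxr
        rw [Finset.sum_eq_zero]
        · exact dvd_zero _
        · intro k _
          rw [hwu s, hc, if_neg (hdisj _ _ hrs _ _), h3]; simp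
      by_cases hxs : x = s
      · subst hxs
        rw [Finset.sum_eq_zero]
        · exact dvd_zero _
        · intro k _
          rw [hwu r, hc, if_neg (hdisj _ _ hxr _ _), h4]; simp
      · have : ∀ k, w r i (β x k) * w s j (β x k) = c x r * c x s := by
          intro k
          rw [hwu, hwu, hc, hc, if_neg (hdisj _ _ hxr _ _), if_neg (hdisj _ _ hxs _ _)]
          ring
        simp only [this, sum_const, card_univ, nsmul_eq_mul]
        exact (h2 x).mul_right _
    omega
  obtain ⟨p, hp⟩ := Finite.exists_min a
  set K : ℤ := ∑ s ∈ Finset.univ.erase p, Fintype.card (T s) * c s p ^ 2 with hK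
  have hKq : K ≤ q p - 1 := by
    have h3 := huu p
    have h4 : 0 ≤ Fintype.card (T p) * c p p ^ 2 + 2 * ε p * c p p := by
      have h5 : (2 : ℤ) ≤ Fintype.card (T p) := by exact_mod_cast hpos p
      have h6 : c p p ^ 2 + ε p * c p p = (c p p + ε p) * c p p := by ring
      have h7 : 0 ≤ c p p ^ 2 + ε p * c p p := by
        have : ε p = 1 ∨ ε p = -1 := mul_self_eq_one_iff.1 (hε p)
        rcases this with h | h <;> rw [h6, h]
        · rcases lt_or_ge (c p p) 0 with h8 | h8 <;> nlinarith
        · rcases le_or_gt (c p p) 0 with h8 | h8 <;> nlinarith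
      nlinarith [sq_nonneg (c p p)]
    linarith
  have hKQ : (K : ℚ) = ∑ s ∈ Finset.univ.erase p, (Fintype.card (T s) : ℚ) * c s p ^ 2 := by
    rw [hK]; push_cast; rfl
  have hap := ha0 p
  have hP : (d (β p (Classical.arbitrary _)) : ℚ) ^ 2 / g +
      ∑ r ∈ Finset.univ.erase p, (c p r : ℚ) ^ 2 * (Fintype.card (T r) / a r) =
        (1 + K) / a p := by
    have h3 := hdeg (β p (Classical.arbitrary _))
    rw [← Finset.add_sum_erase _ _ (Finset.mem_univ p), hVon,
      Finset.sum_congr rfl (fun r hr => hVoff r p (Finset.ne_of_mem_erase hr) _)] at h3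
    have h4 : (1 + Fintype.card (T p) * c p p ^ 2 + 2 * ε p * c p p + K : ℚ) = q p := by
      exact_mod_cast huu p
    have h5 : (Fintype.card (T p) * c p p ^ 2 + 2 * ε p * c p p + a p - q p : ℚ) / a p =
        1 - (1 + K) / a p := by
      rw [← h4]; field_simp; ring
    rw [h5] at h3
    linarith
  have hdp : 1 / g ≤ (d (β p (Classical.arbitrary _)) : ℚ) ^ 2 / g := by
    have : (1 : ℚ) ≤ d (β p (Classical.arbitrary _)) := by exact_mod_cast hd _
    gcongr
    exact one_le_pow₀ this
  have hle : 1 - 1 / g - Fintype.card (T p) / a p ≤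
      ∑ r ∈ Finset.univ.erase p, ((c p r : ℚ) ^ 2 * (Fintype.card (T r) / a r)) +
      ∑ r ∈ Finset.univ.erase p, ((c r p : ℚ) ^ 2 * (Fintype.card (T r) / a r)) := by
    rw [← Finset.sum_add_distrib, ← hO, ← Finset.add_sum_erase _ _ (Finset.mem_univ p),
      add_sub_cancel_left]
    refine Finset.sum_le_sum fun r hr => ?_
    rw [← add_mul]
    have h3 : (1 : ℚ) ≤ c p r ^ 2 + c r p ^ 2 := by
      exact_mod_cast hnz p r (Finset.ne_of_mem_erase hr).symm
    exact le_mul_of_one_le_left (div_nonneg (Nat.cast_nonneg _) (ha0 r).le) h3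
  have hterm : ∀ r ∈ Finset.univ.erase p, ((c r p : ℚ) ^ 2 * (Fintype.card (T r) / a r)) ≤
      (Fintype.card (T r) : ℚ) * c r p ^ 2 / a p := by
    intro r _
    have : (a p : ℚ) ≤ a r := by exact_mod_cast hp r
    rw [← mul_div_assoc, mul_comm]
    gcongr
  have hKle : ∑ r ∈ Finset.univ.erase p, ((c r p : ℚ) ^ 2 * (Fintype.card (T r) / a r)) ≤
      K / a p := by
    rw [hKQ, Finset.sum_div]
    exact Finset.sum_le_sum hterm
  have hcp : (2 : ℚ) ≤ Fintype.card (T p) := by exact_mod_cast hpos p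
  have hqp : (2 : ℚ) ≤ q p := by exact_mod_cast hq p
  have hKq' : (K : ℚ) ≤ q p - 1 := by exact_mod_cast hKq
  have hmain : ∀ x : ℚ, 1 - 1 / g - Fintype.card (T p) / a p ≤ (1 + K) / a p - 1 / g + x / a p →
      (Fintype.card (T p) : ℚ) * (q p - 1) ≤ K + x := by
    intro x hx
    have h3 : 1 ≤ (1 + K + x + Fintype.card (T p)) / a p := by
      rw [add_div, add_div]; linarith
    rw [le_div_iff₀ hap, ← htq p] at h3
    linarith
  have h3 : 0 < K := by
    have := hmain K (by linarith)
    have h4 : (0 : ℚ) < K := by nlinarith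
    exact_mod_cast h4
  have hlt : ∑ r ∈ Finset.univ.erase p, ((c r p : ℚ) ^ 2 * (Fintype.card (T r) / a r)) <
      K / a p := by
    rw [hKQ, Finset.sum_div]
    refine Finset.sum_lt_sum hterm ?_
    have h4 : ∃ r ∈ Finset.univ.erase p, (0 : ℤ) < Fintype.card (T r) * c r p ^ 2 := by
      by_contra! h
      exact absurd (Finset.sum_nonpos h) (not_le.2 h3)
    obtain ⟨r, hr, h5⟩ := h4
    refine ⟨r, hr, ?_⟩
    have h6 : (a p : ℚ) < a r := by
      exact_mod_cast lt_of_le_of_ne (hp r) (fun h => (Finset.ne_of_mem_erase hr) (ha h).symm)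
    have h5' : (0 : ℚ) < Fintype.card (T r) * c r p ^ 2 := by exact_mod_cast h5
    rw [← mul_div_assoc, mul_comm]
    exact div_lt_div_of_pos_left h5' hap h6
  set S := ∑ r ∈ Finset.univ.erase p, ((c r p : ℚ) ^ 2 * (Fintype.card (T r) / a r)) with hS
  have h4 := hmain (S * a p) (by rw [mul_div_cancel_right₀ _ hap.ne']; linarith)
  rw [lt_div_iff₀ hap] at hlt
  nlinarith

/-- A permutation of order `q` fixing `x₀` and acting freely elsewhere has a system of
representatives for its cycles. -/
theorem Equiv.Perm.exists_representatives {X : Type*} [Finite X] (e : Equiv.Perm X) {q : ℕ}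
    (hq : 0 < q) (he : e ^ q = 1) {x₀ : X} (hx₀ : e x₀ = x₀)
    (hfree : ∀ x, x ≠ x₀ → ∀ k, 0 < k → k < q → (e ^ k) x ≠ x) :
    ∃ (t : ℕ) (rep : Fin t → X), Function.Bijective
      (fun z : Option (Fin t × Fin q) => z.elim x₀ fun z => (e ^ (z.2 : ℕ)) (rep z.1)) := by
  classical
  let s := Equiv.Perm.SameCycle.setoid e
  have hfix : ∀ k : ℕ, (e ^ k) x₀ = x₀ := fun k => Function.IsFixedPt.perm_pow hx₀ k
  have hsame : ∀ x y, e.SameCycle x y → ∃ k : Fin q, (e ^ (k : ℕ)) x = y := by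
    rintro x y ⟨i, hi⟩
    have hq' : (q : ℤ) ≠ 0 := by exact_mod_cast hq.ne'
    refine ⟨⟨(i % q).toNat, ?_⟩, ?_⟩
    · have := Int.emod_lt_of_pos i (by exact_mod_cast hq : (0 : ℤ) < q)
      have := Int.emod_nonneg i hq'
      omega
    · rw [← hi, ← zpow_natCast, Int.toNat_of_nonneg (Int.emod_nonneg i hq')]
      conv_rhs => rw [← Int.emod_add_mul_ediv i q, zpow_add, zpow_mul, zpow_natCast e q, he,
        one_zpow, mul_one]
  let Q := {c : Quotient s // c ≠ Quotient.mk s x₀}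
  obtain ⟨t, ⟨E⟩⟩ := Finite.exists_equiv_fin Q
  let rep : Fin t → X := fun i => (E.symm i).1.out
  have hrep : ∀ i, Quotient.mk s (rep i) = (E.symm i).1 := fun i => Quotient.out_eq _
  have hmk : ∀ x (k : ℕ), Quotient.mk s ((e ^ k) x) = Quotient.mk s x := fun x k =>
    Quotient.sound (Equiv.Perm.SameCycle.symm ⟨k, by simp⟩)
  have hne : ∀ i (k : ℕ), (e ^ k) (rep i) ≠ x₀ := by
    intro i k h
    apply (E.symm i).2
    rw [← hrep, ← hmk _ k, h]
  refine ⟨t, rep, ?_, ?_⟩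
  · rintro (_ | ⟨i, k⟩) (_ | ⟨j, l⟩) h
    · rfl
    · exact (hne _ _ h.symm).elim
    · exact (hne _ _ h).elim
    · simp only [Option.elim] at h
      have hij : i = j := by
        apply E.symm.injective
        apply Subtype.ext
        rw [← hrep, ← hrep, ← hmk _ k, h, hmk]
      subst hij
      have hkl : ∀ k l : Fin q, k < l → (e ^ (k : ℕ)) (rep i) ≠ (e ^ (l : ℕ)) (rep i) := by
        intro k l hkl h
        refine hfree ((e ^ (k : ℕ)) (rep i)) (hne _ _) (l - k) (by omega) (by omega) ?_
        rw [← Equiv.Perm.mul_apply, ← pow_add, Nat.sub_add_cancel (by omega), h]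
      rcases lt_trichotomy k l with h' | rfl | h'
      · exact (hkl _ _ h' h).elim
      · rfl
      · exact (hkl _ _ h' h.symm).elim
  · intro x
    by_cases hx : Quotient.mk s x = Quotient.mk s x₀
    · obtain ⟨k, hk⟩ := hsame _ _ (Quotient.exact hx.symm)
      exact ⟨none, by rw [hfix] at hk; exact hk⟩
    · have h := hrep (E ⟨_, hx⟩)
      rw [Equiv.symm_apply_apply] at h
      obtain ⟨k, hk⟩ := hsame _ _ (Quotient.exact h)
      exact ⟨some (_, k), hk⟩

theorem MonoidHom.sum_eq_zero_of_ne_one {A : Type*} [Group A] [Fintype A] {ψ : A →* ℂ}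
    (hψ : ψ ≠ 1) : ∑ x, ψ x = 0 := by
  obtain ⟨y, hy⟩ : ∃ y, ψ y ≠ 1 := by
    by_contra! h
    exact hψ (MonoidHom.ext h)
  have h : ψ y * ∑ x, ψ x = ∑ x, ψ x := by
    rw [Finset.mul_sum, ← Equiv.sum_comp (Equiv.mulLeft y) (fun x => ψ x)]
    simp
  have h' : (ψ y - 1) * ∑ x, ψ x = 0 := by rw [sub_mul, h, one_mul, sub_self]
  exact (mul_eq_zero.1 h').resolve_left (sub_ne_zero.2 hy)

/-- The linear characters of a finite abelian group separate points. -/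
theorem CommGroup.finite_monoidHom_and_sum (A : Type*) [CommGroup A] [Fintype A]
    [DecidableEq A] :
    ∃ _ : Fintype (A →* ℂ), Fintype.card (A →* ℂ) = Fintype.card A ∧ ∀ x : A, ∑ ψ : A →* ℂ, ψ x =
      if x = 1 then (Fintype.card A : ℂ) else 0 := by
  classical
  let _ : Fintype (Additive A) := Additive.fintype
  let E : AddChar (Additive A) ℂ ≃ (A →* ℂ) := AddChar.toMonoidHomEquiv
  have hA : Fintype.card (Additive A) = Fintype.card A := Fintype.card_congr Additive.toMul
  let _ : Fintype (A →* ℂ) := Fintype.ofEquiv _ E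
  refine ⟨Fintype.ofEquiv _ E, ?_, fun x => ?_⟩
  · rw [← hA, ← AddChar.card_eq (α := Additive A)]
    exact (Fintype.card_congr E).symm
  have h := AddChar.sum_apply_eq_ite (Additive.ofMul x)
  rw [← E.sum_comp (fun ψ => ψ x)]
  refine Eq.trans ?_ (h.trans ?_)
  · rfl
  · rw [hA]
    by_cases hx : x = 1
    · rw [if_pos hx, if_pos (by rw [hx]; rfl)]
    · rw [if_neg hx]
      exact if_neg hx

open Finset in
/-- Representatives of the non-principal linear characters of a finite abelian group under a
group of automorphisms acting freely. -/
theorem exists_character_representatives {A : Type*} [CommGroup A] [Fintype A]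
    (σ : MulAut A) {q : ℕ} (hq : 0 < q) (hσ : σ ^ q = 1)
    (hfree : ∀ k, 0 < k → k < q → ∀ x, (σ ^ k) x = x → x = 1) :
    ∃ (t : ℕ) (ψ : Fin t → A →* ℂ), t * q + 1 = Fintype.card A ∧
      (∀ i, ∑ x, ψ i x⁻¹ = 0) ∧
      (∀ i j, ∑ k : Fin q, ∑ x, (1 - ψ i x⁻¹) * (1 - ψ j ((σ ^ (k : ℕ)) x)) =
        Fintype.card A * (q + if i = j then 1 else 0)) ∧
      ∀ c : A → ℂ, (∀ x, c (σ x) = c x) →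
        (Fintype.card A * ∑ x, c x * c x⁻¹ =
          (∑ x, c x) ^ 2 + q * ∑ i, (∑ x, c x * ψ i x⁻¹) ^ 2) ∧
        Fintype.card A * c 1 = ∑ x, c x + q * ∑ i, ∑ x, c x * ψ i x⁻¹ := by
  classical
  obtain ⟨_, hcard, hsep⟩ := CommGroup.finite_monoidHom_and_sum A
  let e : Equiv.Perm (A →* ℂ) :=
    { toFun := fun ψ => ψ.comp σ.toMonoidHom
      invFun := fun ψ => ψ.comp (σ⁻¹ : MulAut A).toMonoidHom
      left_inv := fun ψ => by ext x; simp
      right_inv := fun ψ => by ext x; simp }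
  have hek : ∀ (k : ℕ) ψ x, (e ^ k) ψ x = ψ ((σ ^ k) x) := by
    intro k
    induction k with
    | zero => intro ψ x; simp
    | succ k ih =>
      intro ψ x
      rw [pow_succ, Equiv.Perm.mul_apply, ih, pow_succ', MulAut.mul_apply]
      rfl
  have heq : e ^ q = 1 := by
    ext ψ x
    rw [hek, hσ]; rfl
  have he1 : e 1 = 1 := rfl
  have hefree : ∀ ψ, ψ ≠ 1 → ∀ k, 0 < k → k < q → (e ^ k) ψ ≠ ψ := by
    intro ψ hψ k hk0 hkq h
    apply hψ
    let f : A →* A := (σ ^ k : MulAut A).toMonoidHom / MonoidHom.id A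
    have hf : Function.Injective f := by
      rw [injective_iff_map_eq_one]
      intro x hx
      exact hfree k hk0 hkq x (div_eq_one.1 hx)
    ext x
    obtain ⟨y, rfl⟩ := Finite.surjective_of_injective hf x
    have h1 := DFunLike.congr_fun h y
    rw [hek] at h1
    have h2 : ψ y * ψ y⁻¹ = 1 := by rw [← map_mul]; simp
    change ψ ((σ ^ k) y / y) = 1
    rw [div_eq_mul_inv, map_mul, h1, h2]
  obtain ⟨t, ψ, hbij⟩ := e.exists_representatives hq heq he1 hefree
  have hsum : ∀ F : (A →* ℂ) → ℂ, ∑ φ, F φ = F 1 + ∑ i, ∑ k : Fin q, F ((e ^ (k : ℕ)) (ψ i)) := by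
    intro F
    rw [← hbij.sum_comp, Fintype.sum_option, Fintype.sum_prod_type]
    rfl
  have hne : ∀ i k, (k : ℕ) < q → (e ^ k) (ψ i) ≠ 1 := by
    intro i k hk h
    have := @hbij.1 (some (i, ⟨k, hk⟩)) none h
    simp at this
  have hne0 : ∀ i, ψ i ≠ 1 := fun i => hne i 0 hq
  have hinv : ∀ φ : A →* ℂ, ∑ x, φ x⁻¹ = ∑ x, φ x := fun φ =>
    Equiv.sum_comp (Equiv.inv A) (fun x => φ x)
  have hmul : ∀ φ : A →* ℂ, ∀ x, φ x * φ x⁻¹ = 1 := fun φ x => by rw [← map_mul]; simp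
  refine ⟨t, ψ, ?_, ?_, ?_, ?_⟩
  · rw [← hcard, ← Fintype.card_of_bijective hbij]
    simp
  · intro i
    rw [hinv, MonoidHom.sum_eq_zero_of_ne_one (hne0 i)]
  · intro i j
    have h1 : ∀ k : Fin q, ∑ x, (1 - ψ i x⁻¹) * (1 - ψ j ((σ ^ (k : ℕ)) x)) =
        Fintype.card A * (1 + if i = j ∧ (k : ℕ) = 0 then 1 else 0) := by
      intro k
      have h2 : ∑ x, ψ j ((σ ^ (k : ℕ)) x) = 0 := by
        rw [← MonoidHom.sum_eq_zero_of_ne_one (hne j k k.2)]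
        exact Finset.sum_congr rfl fun x _ => (hek _ _ _).symm
      have h3 : ∑ x, ψ i x⁻¹ * ψ j ((σ ^ (k : ℕ)) x) =
          Fintype.card A * if i = j ∧ (k : ℕ) = 0 then 1 else 0 := by
        split_ifs with h
        · obtain ⟨rfl, h0⟩ := h
          rw [h0]
          have : ∀ x, ψ i x⁻¹ * ψ i ((σ ^ 0) x) = 1 := by
            intro x; rw [mul_comm]; exact hmul _ _
          simp only [this]
          simp
        · rw [mul_zero]
          let φ : A →* ℂ := (e ^ (k : ℕ)) (ψ j) * (ψ i).comp (invMonoidHom)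
          have hφ : φ ≠ 1 := by
            intro h'
            apply h
            have : (e ^ (k : ℕ)) (ψ j) = ψ i := by
              ext x
              have h4 := DFunLike.congr_fun h' x
              change (e ^ (k : ℕ)) (ψ j) x * ψ i x⁻¹ = 1 at h4
              have h5 := hmul (ψ i) x
              calc (e ^ (k : ℕ)) (ψ j) x = (e ^ (k : ℕ)) (ψ j) x * (ψ i x * ψ i x⁻¹) := by
                    rw [h5, mul_one]
                _ = ((e ^ (k : ℕ)) (ψ j) x * ψ i x⁻¹) * ψ i x := by ring
                _ = ψ i x := by rw [h4, one_mul]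
            have h6 := @hbij.1 (some (j, k)) (some (i, ⟨0, hq⟩)) this
            simp only [Option.some.injEq, Prod.mk.injEq] at h6
            exact ⟨h6.1.symm, by rw [h6.2]⟩
          rw [← MonoidHom.sum_eq_zero_of_ne_one hφ]
          refine Finset.sum_congr rfl fun x _ => ?_
          rw [mul_comm, ← hek]
          rfl
      simp only [sub_mul, mul_sub, one_mul, mul_one, Finset.sum_sub_distrib]
      rw [h2, h3, hinv, MonoidHom.sum_eq_zero_of_ne_one (hne0 i)]
      simp [mul_add]
    rw [Finset.sum_congr rfl fun k _ => h1 k, ← Finset.mul_sum, Finset.sum_add_distrib]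
    congr 2
    · simp
    · by_cases hij : i = j
      · simp only [hij, true_and, if_true]
        rw [Finset.sum_eq_single ⟨0, hq⟩]
        · simp
        · intro k _ hk
          rw [if_neg]
          exact fun h => hk (Fin.ext h)
        · simp
      · simp [hij]
  · intro c hc
    have hck : ∀ (k : ℕ) x, c ((σ ^ k) x) = c x := by
      intro k
      induction k with
      | zero => intro x; simp
      | succ k ih => intro x; rw [pow_succ, MulAut.mul_apply, ih, hc]
    have hcoef : ∀ (k : ℕ) φ, ∑ x, c x * (e ^ k) φ x⁻¹ = ∑ x, c x * φ x⁻¹ := by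
      intro k φ
      rw [← Equiv.sum_comp (σ ^ k : MulAut A).toEquiv (fun x => c x * φ x⁻¹)]
      refine Finset.sum_congr rfl fun x _ => ?_
      rw [hek, map_inv]
      change _ = c ((σ ^ k) x) * _
      rw [hck]
      rfl
    have hS1 : ∑ φ : A →* ℂ, ∑ x, c x * φ x⁻¹ = Fintype.card A * c 1 := by
      rw [Finset.sum_comm]
      simp only [← Finset.mul_sum, hsep, inv_eq_one]
      simp [mul_comm]
    have hS2 : ∑ φ : A →* ℂ, (∑ x, c x * φ x⁻¹) ^ 2 = Fintype.card A * ∑ x, c x * c x⁻¹ := by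
      simp only [pow_two, Finset.sum_mul_sum]
      rw [Finset.sum_comm, Finset.mul_sum]
      refine Finset.sum_congr rfl fun x _ => ?_
      rw [Finset.sum_comm]
      have : ∀ y, ∑ φ : A →* ℂ, c x * φ x⁻¹ * (c y * φ y⁻¹) =
          if y = x⁻¹ then c x * c y * Fintype.card A else 0 := by
        intro y
        have h1 : ∀ φ : A →* ℂ, c x * φ x⁻¹ * (c y * φ y⁻¹) = c x * c y * φ (x⁻¹ * y⁻¹) := by
          intro φ; rw [map_mul]; ring
        simp only [h1, ← Finset.mul_sum, hsep]
        rw [mul_ite, mul_zero]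
        congr 1
        rw [mul_inv_eq_one]
        exact propext eq_comm
      simp only [this]
      rw [Finset.sum_ite_eq' univ x⁻¹]
      simp only [Finset.mem_univ, if_true]
      ring
    rw [hsum] at hS1 hS2
    simp only [hcoef] at hS1 hS2
    simp only [MonoidHom.one_apply, mul_one, Finset.sum_const, Finset.card_univ, Fintype.card_fin,
      nsmul_eq_mul, ← Finset.mul_sum] at hS1 hS2
    exact ⟨hS2.symm, hS1.symm⟩

open Finset in
/-- The class functions `1 - ψ` on a Frobenius Sylow subgroup, where `ψ` runs over representatives
of the non-principal linear characters, viewed as functions on the whole group. -/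
theorem IsFrobeniusSylow.exists_functions {G : Type*} [Group G] [Fintype G]
    {P : Subgroup G} [Fintype P] {p q : ℕ} {y : G} (h : IsFrobeniusSylow P p q y)
    (hP : ∀ x ∈ P, x ≠ 1 → ∀ g, g * x * g⁻¹ ∈ P → g ∈ Subgroup.normalizer (P : Set G)) :
    ∃ (t : ℕ) (f : Fin t → G → ℂ), t * q + 1 = Nat.card P ∧
      (∀ i, ∀ x ∉ P, f i x = 0) ∧ (∀ i, f i 1 = 0) ∧ (∀ i, ∑ x, f i x = 1) ∧
      (∀ i j, ∑ s, ∑ x, f i x * f j (s * x⁻¹ * s⁻¹) = q + if i = j then 1 else 0) ∧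
      (∀ i, ∀ n, ∀ ρ : G →* Matrix (Fin n) (Fin n) ℂ, ∃ k : ℤ, ∑ x, f i x * (ρ x).trace = k) ∧
      ∀ c : G → ℂ, (∀ s x, c (s * x * s⁻¹) = c x) →
        (Nat.card P * q : ℂ)⁻¹ * (∑ x : P, c x * c (x : G)⁻¹ - c 1 ^ 2) =
          ∑ i, (∑ x, f i x * c x) ^ 2 - q / Nat.card P * (∑ i, ∑ x, f i x * c x) ^ 2 := by
  classical
  have hq := h.prime
  let _ : CommGroup P :=
    { (inferInstance : Group P) with mul_comm := fun u v => Subtype.ext (h.comm u u.2 v v.2) }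
  let σ : MulAut P :=
    { toFun := fun x => ⟨y * x * y⁻¹, h.schmidt.conj_mem y h.schmidt.mem x x.2⟩
      invFun := fun x => ⟨y⁻¹ * x * y, by
        have := h.schmidt.conj_mem y⁻¹ (inv_mem h.schmidt.mem) x x.2
        rwa [inv_inv] at this⟩
      left_inv := fun x => Subtype.ext (by simp [mul_assoc])
      right_inv := fun x => Subtype.ext (by simp [mul_assoc])
      map_mul' := fun u v => Subtype.ext (by simp [mul_assoc]) }
  have hσk : ∀ (k : ℕ) (x : P), (((σ ^ k) x : P) : G) = y ^ k * x * (y ^ k)⁻¹ := by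
    intro k
    induction k with
    | zero => intro x; simp
    | succ k ih =>
      intro x
      rw [pow_succ, MulAut.mul_apply, ih]
      show y ^ k * (y * x * y⁻¹) * (y ^ k)⁻¹ = _
      rw [pow_succ]
      group
  have hykP : ∀ k, 0 < k → k < q → y ^ k ∉ P := by
    intro k h0 h1 hk
    have h2 : y ^ (k : ℤ) ∈ P := by rwa [zpow_natCast]
    have h3 := h.schmidt.zpow_mem_iff.1 h2
    rw [zpow_natCast] at h3
    have h4 := orderOf_dvd_of_pow_eq_one h3
    rw [h.orderOf_eq] at h4
    exact absurd (Nat.le_of_dvd h0 h4) (by omega)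
  obtain ⟨t, ψ, ht, hψ0, hψ, hc⟩ := exists_character_representatives σ hq.pos
    (by ext x; rw [hσk, h.pow_orderOf]; simp)
    (fun k h0 h1 x hx => by
      by_contra hx1
      refine hykP k h0 h1 (h.mem_of_commute x x.2 (by simpa using hx1) _ ?_)
      have := congrArg Subtype.val hx
      rw [hσk, mul_inv_eq_iff_eq_mul] at this
      exact this)
  have hcard : Fintype.card P = Nat.card P := (Nat.card_eq_fintype_card).symm
  rw [hcard] at ht
  have ha0 : (Nat.card P : ℂ) ≠ 0 := by simp [Nat.card_eq_fintype_card]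
  have hq0 : (q : ℂ) ≠ 0 := by exact_mod_cast hq.ne_zero
  have htc : (t : ℂ) * q + 1 = Nat.card P := by exact_mod_cast ht
  let f : Fin t → G → ℂ := fun i x =>
    if hx : x ∈ P then (Nat.card P : ℂ)⁻¹ * (1 - ψ i (⟨x, hx⟩ : P)⁻¹) else 0
  have hf : ∀ i (x : P), f i x = (Nat.card P : ℂ)⁻¹ * (1 - ψ i x⁻¹) := fun i x => by
    simp only [f]; rw [dif_pos x.2]
  have hf0 : ∀ i, ∀ x ∉ P, f i x = 0 := fun i x hx => dif_neg hx
  have hf1 : ∀ i, f i 1 = 0 := fun i => by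
    have := hf i 1
    rw [inv_one, map_one, sub_self, mul_zero] at this
    exact this
  have hsumP : ∀ F : G → ℂ, (∀ x ∉ P, F x = 0) → ∑ x, F x = ∑ x : P, F x := by
    intro F hF
    refine (Fintype.sum_of_injective (fun x : P => (x : G)) Subtype.val_injective _ _
      (fun x hx => hF x fun hxP => hx ⟨⟨x, hxP⟩, rfl⟩) fun x => rfl).symm
  have hsumf : ∀ i (F : G → ℂ), ∑ x, f i x * F x =
      (Nat.card P : ℂ)⁻¹ * (∑ x : P, F x - ∑ x : P, F x * ψ i x⁻¹) := by
    intro i F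
    rw [hsumP _ fun x hx => by rw [hf0 i x hx, zero_mul], ← Finset.sum_sub_distrib,
      Finset.mul_sum]
    refine Finset.sum_congr rfl fun x _ => ?_
    rw [hf]
    ring
  refine ⟨t, f, ht, hf0, hf1, fun i => ?_, fun i j => ?_, fun i n ρ => ?_, fun c hcl => ?_⟩
  · have := hsumf i 1
    simp only [Pi.one_apply, mul_one, one_mul, hψ0, sub_zero, Finset.sum_const,
      Finset.card_univ, nsmul_eq_mul] at this
    rw [this, hcard, inv_mul_cancel₀ ha0]
  · have hinj : Function.Injective fun z : P × Fin q => (z.1 : G) * y ^ (z.2 : ℕ) := by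
      have key : ∀ (u v : P) (k l : Fin q), (k : ℕ) ≤ l →
          (u : G) * y ^ (k : ℕ) = v * y ^ (l : ℕ) → (k : ℕ) = l := by
        intro u v k l hkl he
        by_contra hne
        refine hykP (l - k) (by omega) (by omega) ?_
        have h1 : y ^ ((l : ℕ) - k) = (v : G)⁻¹ * u := by
          rw [pow_sub y hkl, eq_inv_mul_iff_mul_eq, ← mul_assoc, ← he]
          simp
        rw [h1]
        exact mul_mem (inv_mem v.2) u.2
      rintro ⟨u, k⟩ ⟨v, l⟩ he
      have hkl : k = l := by
        rcases le_total (k : ℕ) l with hle | hle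
        · exact Fin.ext (key u v k l hle he)
        · exact Fin.ext (key v u l k hle he.symm).symm
      subst hkl
      have : (u : G) = v := mul_right_cancel he
      rw [Subtype.ext this]
    rw [← Fintype.sum_of_injective _ hinj
      (fun z => ∑ x, f i x * f j (z.1 * y ^ (z.2 : ℕ) * x⁻¹ * (z.1 * y ^ (z.2 : ℕ))⁻¹)) _ ?_
      fun z => rfl]
    · rw [Fintype.sum_prod_type]
      have : ∀ (u : P) (k : Fin q),
          ∑ x, f i x * f j (u * y ^ (k : ℕ) * x⁻¹ * (u * y ^ (k : ℕ))⁻¹) =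
          ((Nat.card P : ℂ)⁻¹) ^ 2 * ∑ x, (1 - ψ i x⁻¹) * (1 - ψ j ((σ ^ (k : ℕ)) x)) := by
        intro u k
        rw [hsumP _ fun x hx => by rw [hf0 i x hx, zero_mul], Finset.mul_sum]
        refine Finset.sum_congr rfl fun x _ => ?_
        have h1 : (u * y ^ (k : ℕ) * (x : G)⁻¹ * (u * y ^ (k : ℕ))⁻¹ : G) =
            (((σ ^ (k : ℕ)) x)⁻¹ : P) := by
          have h2 := h.comm u u.2 ((((σ ^ (k : ℕ)) x)⁻¹ : P) : G) (((σ ^ (k : ℕ)) x)⁻¹).2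
          rw [← mul_inv_eq_iff_eq_mul.2 h2.eq, InvMemClass.coe_inv, hσk]
          group
        rw [h1, hf, hf, inv_inv]
        ring
      simp only [this, ← Finset.mul_sum, hψ, Finset.sum_const, Finset.card_univ, nsmul_eq_mul,
        hcard]
      field_simp
    · intro s hs
      refine Finset.sum_eq_zero fun x _ => ?_
      by_cases hx : x ∈ P
      · by_cases hx1 : x = 1
        · rw [hx1, hf1, zero_mul]
        · rw [hf0 j, mul_zero]
          intro hsx
          apply hs
          obtain ⟨u, hu, k, rfl⟩ := h.schmidt.exists_eq s
            (hP x⁻¹ (inv_mem hx) (by simpa using hx1) s hsx)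
          have hk := Int.emod_nonneg k (Int.natCast_ne_zero.2 hq.ne_zero)
          have hk' := Int.emod_lt_of_pos k (Int.natCast_pos.2 hq.pos)
          refine ⟨⟨⟨u, hu⟩, ⟨(k % q).toNat, by omega⟩⟩, ?_⟩
          show u * y ^ (k % q).toNat = _
          rw [← zpow_natCast, Int.toNat_of_nonneg hk, ← h.orderOf_eq, zpow_mod_orderOf]
      · rw [hf0 i x hx, zero_mul]
  · obtain ⟨k₀, hk₀⟩ := exists_nat_sum_trace_eq (ρ.comp P.subtype) 1
    obtain ⟨k₁, hk₁⟩ := exists_nat_sum_trace_eq (ρ.comp P.subtype) (ψ i)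
    simp only [MonoidHom.one_apply, mul_one, MonoidHom.comp_apply, Subgroup.subtype_apply,
      hcard] at hk₀ hk₁
    refine ⟨(k₀ : ℤ) - k₁, ?_⟩
    rw [hsumf i fun x => (ρ x).trace, hk₀, hk₁]
    push_cast
    field_simp
  · obtain ⟨h1, h2⟩ := hc (fun x => c x) fun x => hcl y x
    simp only [hcard] at h1 h2
    simp only [hsumf _ c]
    set N := ∑ x : P, c x
    set M : Fin t → ℂ := fun i => ∑ x : P, c x * ψ i x⁻¹ with hM
    rw [OneMemClass.coe_one] at h2
    have e1 : ∑ x : P, c x * c (x : G)⁻¹ = (Nat.card P : ℂ)⁻¹ * (N ^ 2 + q * ∑ i, M i ^ 2) := by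
      rw [eq_inv_mul_iff_mul_eq₀ ha0]
      exact h1
    have e2 : c 1 = (Nat.card P : ℂ)⁻¹ * (N + q * ∑ i, M i) := by
      rw [eq_inv_mul_iff_mul_eq₀ ha0]
      exact h2
    have e3 : ∑ i, ((Nat.card P : ℂ)⁻¹ * (N - M i)) ^ 2 =
        (Nat.card P : ℂ)⁻¹ ^ 2 * (t * N ^ 2 - 2 * N * ∑ i, M i + ∑ i, M i ^ 2) := by
      simp only [mul_pow, ← Finset.mul_sum, sub_sq, Finset.sum_add_distrib,
        Finset.sum_sub_distrib, Finset.sum_const, Finset.card_univ, Fintype.card_fin, nsmul_eq_mul]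
    have e4 : ∑ i, (Nat.card P : ℂ)⁻¹ * (N - M i) =
        (Nat.card P : ℂ)⁻¹ * (t * N - ∑ i, M i) := by
      simp only [← Finset.mul_sum, Finset.sum_sub_distrib, Finset.sum_const, Finset.card_univ,
        Fintype.card_fin, nsmul_eq_mul]
    rw [e1, e2, e3, e4, ← htc]
    rw [← htc] at ha0
    field_simp
    ring

open Finset in
theorem exists_bilinear_of_orthogonality {G ι : Type*} [Group G] [Fintype G] [DecidableEq G]
    [Fintype ι] {χ : ι → G → ℂ}
    (hχ : ∀ x y, ∑ i, χ i x * χ i y⁻¹ = (Finset.univ.filter fun s : G => s * x * s⁻¹ = y).card)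
    (f h : G → ℂ) :
    ∑ i, (∑ x, f x * χ i x) * (∑ x, h x * χ i x) = ∑ s, ∑ x, f x * h (s * x⁻¹ * s⁻¹) := by
  have h1 : ∀ x y, ∑ i, χ i x * χ i y = ∑ s : G, if s * x⁻¹ * s⁻¹ = y then 1 else 0 := by
    intro x y
    have := hχ x y⁻¹
    rw [inv_inv] at this
    rw [this, Finset.sum_boole]
    congr 2
    ext s
    have hs : s * x⁻¹ * s⁻¹ = (s * x * s⁻¹)⁻¹ := by group
    rw [Finset.mem_filter_univ, Finset.mem_filter_univ, hs, inv_eq_iff_eq_inv]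
  simp only [Finset.sum_mul_sum]
  rw [Finset.sum_comm, Finset.sum_comm (s := univ) (t := univ) (f := fun s x => f x * h _)]
  refine Finset.sum_congr rfl fun x _ => ?_
  rw [Finset.sum_comm]
  have h2 : ∀ y, ∑ i, f x * χ i x * (h y * χ i y) =
      ∑ s : G, if s * x⁻¹ * s⁻¹ = y then f x * h y else 0 := by
    intro y
    have : ∀ i, f x * χ i x * (h y * χ i y) = f x * h y * (χ i x * χ i y) := fun i => by ring
    simp only [this]
    rw [← Finset.mul_sum, h1, Finset.mul_sum]
    simp
  simp only [h2]
  rw [Finset.sum_comm]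
  simp

namespace IsSimpleBiminimal
variable {G : Type*} [Group G] [Fintype G] (hG : IsSimpleBiminimal G)
include hG

theorem existsUnique_sylow {z : G} (hz : z ≠ 1) :
    ∃! S : (r : (Nat.card G).primeFactors) × Sylow r G, z ∈ (S.2 : Subgroup G) := by
  have hex : ∃ S : (r : (Nat.card G).primeFactors) × Sylow r G, z ∈ (S.2 : Subgroup G) := by
    obtain ⟨r, hr, hrz⟩ := Nat.exists_prime_and_dvd (mt orderOf_eq_one_iff.1 hz)
    have : Fact r.Prime := ⟨hr⟩
    have hrG : r ∈ (Nat.card G).primeFactors :=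
      Nat.mem_primeFactors.2 ⟨hr, hrz.trans (orderOf_dvd_natCard z), Nat.card_pos.ne'⟩
    set u := z ^ (orderOf z / r) with hu
    have hur : orderOf u = r := by
      rw [hu, orderOf_pow_of_dvd (Nat.div_pos (Nat.le_of_dvd (orderOf_pos z) hrz) hr.pos).ne'
        (Nat.div_dvd_of_dvd hrz), Nat.div_div_self hrz (orderOf_pos z).ne']
    have hu1 : u ≠ 1 := by
      intro h
      rw [h, orderOf_one] at hur
      exact hr.one_lt.ne hur
    obtain ⟨S, hS⟩ := exists_sylow_mem (p := r) (k := 1) (g := u)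
      (by rw [pow_one, ← hur, pow_orderOf_eq_one])
    have hSb : (S : Subgroup G) ≠ ⊥ := fun h => hu1 (by rwa [h, Subgroup.mem_bot] at hS)
    obtain ⟨q, y, h⟩ := hG.exists_isFrobeniusSylow S hSb
    exact ⟨⟨⟨r, hrG⟩, S⟩, h.mem_of_commute u hS hu1 z (Commute.refl z |>.pow_right _)⟩
  obtain ⟨S, hS⟩ := hex
  refine ⟨S, hS, ?_⟩
  rintro ⟨s, T⟩ hT
  obtain ⟨r, S⟩ := S
  have : Fact (r : ℕ).Prime := ⟨Nat.prime_of_mem_primeFactors r.2⟩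
  have hrs : s = r := by
    by_contra hne
    apply hz
    obtain ⟨k, hk⟩ := S.2.exists_pow_eq_one hS
    obtain ⟨l, hl⟩ := T.2.exists_pow_eq_one hT
    refine pow_eq_one_of_coprime_pow (Nat.Coprime.pow k l ?_) hk hl
    exact (Nat.coprime_primes (Nat.prime_of_mem_primeFactors r.2)
      (Nat.prime_of_mem_primeFactors s.2)).2 fun h => hne (Subtype.ext h.symm)
  subst hrs
  obtain rfl : T = S := hG.sylow_eq hT hS hz
  rfl

open Finset in
theorem sum_classFunction {P : ∀ r : (Nat.card G).primeFactors, Sylow r G}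
    {q : (Nat.card G).primeFactors → ℕ} {y : (Nat.card G).primeFactors → G}
    [∀ r, Fintype (P r)]
    (hP : ∀ r, IsFrobeniusSylow (P r : Subgroup G) r (q r) (y r)) {F : G → ℂ}
    (hF : ∀ s x, F (s * x * s⁻¹) = F x) :
    ∑ x, F x = F 1 + Nat.card G *
      ∑ r, (Nat.card (P r) * q r : ℂ)⁻¹ * (∑ x : P r, F x - F 1) := by
  classical
  have hp : ∀ r : (Nat.card G).primeFactors, Fact (r : ℕ).Prime := fun r =>
    ⟨Nat.prime_of_mem_primeFactors r.2⟩
  let _ : ∀ r : (Nat.card G).primeFactors, Fintype (Sylow r G) := fun r => Fintype.ofFinite _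
  have h1 : ∑ x, F x = F 1 + ∑ x ∈ univ.erase 1, F x := (add_sum_erase _ _ (mem_univ 1)).symm
  have hS : ∀ (r : (Nat.card G).primeFactors) (S : Sylow r G),
      ∑ x ∈ univ.erase (1 : G), (if x ∈ (S : Subgroup G) then F x else 0) =
        ∑ x : P r, F x - F 1 := by
    intro r S
    obtain ⟨g, rfl⟩ := MulAction.exists_smul_eq G (P r) S
    rw [eq_sub_iff_add_eq]
    have h2 := sum_erase_add univ (fun x => if x ∈ ((g • P r : Sylow r G) : Subgroup G) then F x else 0)
      (mem_univ 1)
    simp only [one_mem, if_true] at h2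
    rw [h2]
    symm
    refine Fintype.sum_of_injective (fun x : P r => g * x * g⁻¹) ?_ _ _ ?_ ?_
    · intro a b hab
      simpa using hab
    · intro x hx
      refine if_neg fun hxS => hx ?_
      rw [Sylow.smul_def, Sylow.pointwise_smul_def] at hxS
      obtain ⟨z, hz, rfl⟩ := hxS
      exact ⟨⟨z, hz⟩, rfl⟩
    · intro x
      rw [if_pos, hF]
      rw [Sylow.smul_def, Sylow.pointwise_smul_def]
      exact ⟨x, x.2, rfl⟩
  have h3 : ∑ x ∈ univ.erase (1 : G), F x =
      ∑ S : (r : (Nat.card G).primeFactors) × Sylow r G,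
        ∑ x ∈ univ.erase (1 : G), (if x ∈ (S.2 : Subgroup G) then F x else 0) := by
    rw [Finset.sum_comm]
    refine Finset.sum_congr rfl fun x hx => ?_
    obtain ⟨S, hxS, huniq⟩ := hG.existsUnique_sylow (ne_of_mem_erase hx)
    rw [Finset.sum_eq_single S]
    · rw [if_pos hxS]
    · exact fun T _ hT => if_neg fun hxT => hT (huniq T hxT)
    · simp
  rw [h1, h3, Fintype.sum_sigma, Finset.mul_sum]
  congr 1
  refine Finset.sum_congr rfl fun r _ => ?_
  simp only [hS, Finset.sum_const, nsmul_eq_mul, Finset.card_univ]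
  rw [← mul_assoc]
  congr 1
  have hc := hG.card_eq_mul (hP r)
  have ha0 : (Nat.card (P r) : ℂ) ≠ 0 := by exact_mod_cast Nat.card_pos.ne'
  have hq0 : (q r : ℂ) ≠ 0 := by exact_mod_cast (hP r).prime.ne_zero
  rw [eq_mul_inv_iff_mul_eq₀ (mul_ne_zero ha0 hq0)]
  refine Eq.trans ?_ (congrArg Nat.cast hc).symm
  rw [← Nat.card_eq_fintype_card]
  push_cast
  rfl

open Finset in
theorem two_dvd_card : 2 ∣ Nat.card G := by
  classical
  by_contra hodd
  have hp : ∀ r : (Nat.card G).primeFactors, Fact (r : ℕ).Prime := fun r =>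
    ⟨Nat.prime_of_mem_primeFactors r.2⟩
  have hPr : ∀ r : (Nat.card G).primeFactors, ∃ P : Sylow r G, ∃ q y,
      IsFrobeniusSylow (P : Subgroup G) r q y := by
    intro r
    obtain ⟨P⟩ : Nonempty (Sylow r G) := inferInstance
    refine ⟨P, hG.exists_isFrobeniusSylow P fun hb => ?_⟩
    have := P.dvd_card_of_dvd_card (Nat.dvd_of_mem_primeFactors r.2)
    rw [hb, Subgroup.card_bot] at this
    exact (hp r).1.one_lt.ne' (Nat.dvd_one.1 this)
  choose P q y hP using hPr
  have hnorm : ∀ r, ∀ x ∈ (P r : Subgroup G), x ≠ 1 → ∀ g, g * x * g⁻¹ ∈ (P r : Subgroup G) →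
      g ∈ Subgroup.normalizer ((P r : Subgroup G) : Set G) :=
    fun r x hx hx1 g hg => hG.mem_normalizer_of_conj_mem_sylow (P r) hx hx1 hg
  choose t f ht hf0 hf1 hfs hff hfk hfc using fun r => (hP r).exists_functions (hnorm r)
  obtain ⟨n, d, ρ, hd, horth, hnn, o, ho⟩ := exists_irreducible_representations G
  choose w hw using fun r i χ => hfk r i (d χ) (ρ χ)
  have hχ1 : ∀ χ, (ρ χ 1).trace = d χ := fun χ => by simp
  have hcl : ∀ χ s x, (ρ χ (s * x * s⁻¹)).trace = (ρ χ x).trace := by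
    intro χ s x
    rw [map_mul, Matrix.trace_mul_comm, ← map_mul]
    simp
  have hbil := fun f h => exists_bilinear_of_orthogonality (χ := fun i x => (ρ i x).trace) horth f h
  have hoddq : ∀ r, ¬ 2 ∣ q r := by
    intro r h
    refine hodd (h.trans ?_)
    rw [← (hP r).orderOf_eq]
    exact orderOf_dvd_natCard _
  have hodda : ∀ r, ¬ 2 ∣ Nat.card (P r) := fun r h =>
    hodd (h.trans (Subgroup.card_subgroup_dvd_card _))
  have hteven : ∀ r, 2 ∣ t r := by
    intro r
    refine (Nat.prime_two.dvd_mul.1 ?_).resolve_right (hoddq r)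
    have h1 := ht r
    have h2 := hodda r
    omega
  have htpos : ∀ r, 2 ≤ t r := by
    intro r
    refine Nat.le_of_dvd (Nat.pos_of_ne_zero fun h => ?_) (hteven r)
    have h1 := ht r
    have h2 := (hP r).one_lt_card
    rw [h, zero_mul] at h1
    omega
  have hne : Nonempty (Nat.card G).primeFactors := by
    have : Nontrivial G := by
      by_contra h
      rw [not_nontrivial_iff_subsingleton] at h
      exact hG.not_isSolvable inferInstance
    obtain ⟨r, hr⟩ := Nat.nonempty_primeFactors.2 (Finite.one_lt_card (α := G))
    exact ⟨r, hr⟩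
  refine coherent_configuration_contradiction (ι := Fin n) (R := (Nat.card G).primeFactors)
    (T := fun r => Fin (t r)) (o := o) (d := fun χ => d χ) (g := Nat.card G)
    (a := fun r => Nat.card (P r)) (q := fun r => q r) w ?_ ?_ ?_ ?_ ?_ ?_ ?_ ?_ ?_ ?_ ?_ ?_ ?_ ?_
  · exact fun χ => by exact_mod_cast hd χ
  · have h1 := ho 1
    rw [hχ1] at h1
    exact_mod_cast h1
  · exact_mod_cast Nat.card_pos
  · have h1 := horth 1 1
    simp only [inv_one, hχ1, mul_one, mul_inv_cancel, filter_true, Finset.card_univ] at h1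
    rw [Nat.card_eq_fintype_card]
    have h2 : ∑ χ, (d χ : ℂ) ^ 2 = Fintype.card G := by
      rw [← h1]; exact Finset.sum_congr rfl fun χ _ => pow_two _
    exact_mod_cast h2
  · intro r s hrs
    have h1 : Nat.card (P r) = Nat.card (P s) := by simpa using hrs
    have h2 : (r : ℕ) ∣ Nat.card (P s) := by
      rw [← h1]
      exact (P r).dvd_card_of_dvd_card (Nat.dvd_of_mem_primeFactors r.2)
    obtain ⟨k, hk⟩ := IsPGroup.iff_card.1 (P s).2
    rw [hk] at h2
    exact Subtype.ext ((Nat.prime_dvd_prime_iff_eq (hp r).1 (hp s).1).1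
      ((hp r).1.dvd_of_dvd_pow h2))
  · exact fun r => by exact_mod_cast (hP r).prime.two_le
  · intro r
    have := ht r
    rw [Fintype.card_fin]
    exact_mod_cast this
  · intro r
    rw [Fintype.card_fin]
    exact_mod_cast hteven r
  · intro r
    rw [Fintype.card_fin]
    exact htpos r
  · intro r i
    have h1 := hw r i o
    simp only [ho, mul_one, hfs] at h1
    exact_mod_cast h1.symm
  · intro r i
    have h1 := hbil (fun x => if x = 1 then 1 else 0) (f r i)
    simp only [ite_mul, one_mul, zero_mul, Finset.sum_ite_eq', Finset.mem_univ, if_true, hχ1,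
      inv_one, mul_one, mul_inv_cancel, hf1, Finset.sum_const_zero, hw] at h1
    exact_mod_cast h1
  · intro r i j
    have h1 := hbil (f r i) (f r j)
    simp only [hw, hff] at h1
    have h2 : ((if i = j then 1 else 0 : ℤ) : ℂ) = if i = j then 1 else 0 := by split_ifs <;> simp
    rw [← h2] at h1
    exact_mod_cast h1
  · intro r s hrs i j
    have h1 := hbil (f r i) (f s j)
    simp only [hw] at h1
    have h2 : ∑ g : G, ∑ x, f r i x * f s j (g * x⁻¹ * g⁻¹) = 0 := by
      refine Finset.sum_eq_zero fun g _ => Finset.sum_eq_zero fun x _ => ?_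
      by_cases hx : x ∈ (P r : Subgroup G)
      · by_cases hgx : g * x⁻¹ * g⁻¹ ∈ (P s : Subgroup G)
        · have e1 := (hP r).pow_eq_one x hx
          have e2 := (hP s).pow_eq_one _ hgx
          rw [conj_pow, conj_eq_one_iff, inv_pow, inv_eq_one] at e2
          rw [pow_eq_one_of_coprime_pow ((Nat.coprime_primes (hp r).1 (hp s).1).2
            fun h => hrs (Subtype.ext h)) e1 e2, hf1, zero_mul]
        · rw [hf0 s j _ hgx, mul_zero]
      · rw [hf0 r i x hx, zero_mul]
    rw [h2] at h1
    exact_mod_cast h1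
  · intro χ
    have h1 := hG.sum_classFunction hP (F := fun x => (ρ χ x).trace * (ρ χ x⁻¹).trace)
      (fun s x => by
        have : (s * x * s⁻¹)⁻¹ = s * x⁻¹ * s⁻¹ := by group
        rw [this, hcl, hcl])
    have h2 := fun r => hfc r (fun x => (ρ χ x).trace) (hcl χ)
    simp only [hw] at h2
    rw [hnn χ] at h1
    simp only [inv_one, hχ1, ← pow_two] at h1 h2
    simp only [h2] at h1
    have hg0 : (Nat.card G : ℂ) ≠ 0 := by exact_mod_cast Nat.card_pos.ne'
    rw [← Nat.card_eq_fintype_card] at h1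
    have h3 : (1 : ℂ) = (d χ : ℂ) ^ 2 / Nat.card G + ∑ r, (∑ i, (w r i χ : ℂ) ^ 2 -
        q r / Nat.card (P r) * (∑ i, (w r i χ : ℂ)) ^ 2) := by
      refine mul_left_cancel₀ hg0 ?_
      rw [mul_add, mul_div_cancel₀ _ hg0, mul_one]
      exact h1
    apply Rat.cast_injective (α := ℂ)
    push_cast
    exact h3

end IsSimpleBiminimal

/-- A group with an elementary abelian central quotient of order four has a commutator subgroup of
order at most two. -/
theorem card_commutator_le_two_of_index_eq_four {T : Type*} [Group T] {N : Subgroup T}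
    (hN : N ≤ Subgroup.center T) (hi : N.index = 4) (hsq : ∀ x : T, x ^ 2 ∈ N) :
    Nat.card (commutator T) ≤ 2 := by
  classical
  have hcen : ∀ n ∈ N, ∀ x, Commute n x := fun n hn x =>
    (Subgroup.mem_center_iff.1 (hN hn) x).symm
  by_cases hall : ∀ a b : T, Commute a b
  · have : commutator T = ⊥ := by
      rw [commutator_def, Subgroup.commutator_eq_bot_iff_le_centralizer]
      exact fun a _ => Subgroup.mem_centralizer_iff.2 fun b _ => hall b a
    rw [this, Subgroup.card_bot]
    norm_num
  push Not at hall
  obtain ⟨a, b, hab⟩ := hall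
  have hnorm : N.Normal := ⟨fun n hn g => by rw [← (hcen n hn g).eq]; simpa using hn⟩
  have hcomm : ∀ x y : T, ⁅x, y⁆ ∈ N := by
    intro x y
    have h1 : ⁅x, y⁆ = (x * y) ^ 2 * (y⁻¹ * (x ^ 2)⁻¹ * y⁻¹⁻¹) * (y ^ 2)⁻¹ := by
      simp only [commutatorElement_def, pow_two]; group
    rw [h1]
    exact mul_mem (mul_mem (hsq _) (hnorm.conj_mem _ (inv_mem (hsq x)) _)) (inv_mem (hsq y))
  set c := ⁅a, b⁆ with hc
  have hcN := hcomm a b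
  have hc2 : c ^ 2 = 1 := by
    have h1 : a ^ 2 * b * (a ^ 2)⁻¹ * b⁻¹ = a * c * a⁻¹ * c := by
      simp only [hc, commutatorElement_def, pow_two]; group
    rw [(hcen _ (hsq a) b).eq, ← (hcen c hcN a).eq] at h1
    rw [pow_two]
    simpa [mul_assoc] using h1.symm
  have ha : a ∉ N := fun h => hab (hcen a h b)
  have hb : b ∉ N := fun h => hab (hcen b h a).symm
  have hab1 : a⁻¹ * b ∉ N := fun h => hab <| by
    have := (hcen _ h a).symm
    have h2 := (Commute.refl a).mul_right this
    rwa [mul_inv_cancel_left] at h2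
  have hab2 : a * b ∉ N := fun h => hab <| by
    have := (hcen _ h a).symm
    have h2 := ((Commute.refl a).inv_right).mul_right this
    rwa [inv_mul_cancel_left] at h2
  have hfin : Finite (T ⧸ N) := Nat.finite_of_card_ne_zero (by
    rw [← Subgroup.index_eq_card, hi]; norm_num)
  let _ : Fintype (T ⧸ N) := Fintype.ofFinite _
  have huniv : ({((1 : T) : T ⧸ N), (a : T ⧸ N), (b : T ⧸ N), ((a * b : T) : T ⧸ N)} :
      Finset (T ⧸ N)) = Finset.univ := by
    apply Finset.eq_univ_of_card
    rw [← Nat.card_eq_fintype_card, ← Subgroup.index_eq_card, hi]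
    rw [Finset.card_insert_of_notMem, Finset.card_insert_of_notMem,
      Finset.card_insert_of_notMem, Finset.card_singleton]
    · rw [Finset.mem_singleton, QuotientGroup.eq]
      intro h
      apply ha
      have h2 := hnorm.conj_mem _ h b
      simpa [mul_assoc] using h2
    · simp only [Finset.mem_insert, Finset.mem_singleton, QuotientGroup.eq, inv_mul_cancel_left]
      tauto
    · simp only [Finset.mem_insert, Finset.mem_singleton, QuotientGroup.eq, inv_one, one_mul]
      tauto
  have hex : ∀ x : T, ∃ z ∈ ({1, a, b, a * b} : Set T), ∃ n ∈ N, x = z * n := by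
    intro x
    have h1 := Finset.mem_univ (x : T ⧸ N)
    rw [← huniv] at h1
    simp only [Finset.mem_insert, Finset.mem_singleton] at h1
    rcases h1 with h | h | h | h
    all_goals exact ⟨_, by simp, _, QuotientGroup.eq.1 h.symm, (mul_inv_cancel_left _ _).symm⟩
  have hle : Subgroup.zpowers c ≤ N := Subgroup.zpowers_le.2 hcN
  have hZ : (Subgroup.zpowers c).Normal :=
    ⟨fun n hn g => by rw [← (hcen n (hle hn) g).eq]; simpa using hn⟩
  have hq : ∀ x y : T, (QuotientGroup.mk' (Subgroup.zpowers c) ⁅x, y⁆ = 1) ↔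
      Commute (QuotientGroup.mk' (Subgroup.zpowers c) x)
        (QuotientGroup.mk' (Subgroup.zpowers c) y) := by
    intro x y
    rw [map_commutatorElement, commutatorElement_eq_one_iff_commute]
  set π := QuotientGroup.mk' (Subgroup.zpowers c) with hπ
  have hπab : Commute (π a) (π b) := by
    rw [← hq, ← hc]
    exact (QuotientGroup.eq_one_iff c).2 (Subgroup.mem_zpowers c)
  have h1 : ∀ z ∈ ({1, a, b, a * b} : Set T), Commute (π z) (π a) ∧ Commute (π z) (π b) := by
    rintro z (rfl | rfl | rfl | rfl)
    · rw [map_one]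
      exact ⟨Commute.one_left _, Commute.one_left _⟩
    · exact ⟨Commute.refl _, hπab⟩
    · exact ⟨hπab.symm, Commute.refl _⟩
    · rw [map_mul]
      exact ⟨(Commute.refl _).mul_left hπab.symm, hπab.mul_left (Commute.refl _)⟩
  have h2 : ∀ z ∈ ({1, a, b, a * b} : Set T), ∀ w ∈ ({1, a, b, a * b} : Set T),
      Commute (π z) (π w) := by
    rintro z hz w (rfl | rfl | rfl | rfl)
    · rw [map_one]
      exact Commute.one_right _
    · exact (h1 z hz).1
    · exact (h1 z hz).2
    · rw [map_mul]
      exact (h1 z hz).1.mul_right (h1 z hz).2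
  have h3 : commutator T ≤ Subgroup.zpowers c := by
    rw [commutator_def, Subgroup.commutator_le]
    intro x _ y _
    rw [← QuotientGroup.eq_one_iff]
    refine (hq x y).2 ?_
    obtain ⟨z, hz, m, hm, rfl⟩ := hex x
    obtain ⟨w, hw, n, hn, rfl⟩ := hex y
    rw [map_mul, map_mul]
    have hm' : ∀ g, Commute (π m) (π g) := fun g => (hcen m hm g).map π
    have hn' : ∀ g, Commute (π n) (π g) := fun g => (hcen n hn g).map π
    exact ((h2 z hz w hw).mul_left (hm' w)).mul_right
      (((hn' z).symm).mul_left (hn' m).symm)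
  have hcz : Nat.card (Subgroup.zpowers c) ≤ 2 := by
    rw [Nat.card_zpowers]
    exact orderOf_le_of_pow_eq_one two_pos hc2
  have hfz : Finite (Subgroup.zpowers c) := by
    refine Set.Finite.to_subtype ?_
    rw [finite_zpowers, isOfFinOrder_iff_pow_eq_one]
    exact ⟨2, two_pos, hc2⟩
  exact (Subgroup.card_le_of_le h3).trans hcz

/-- The order of the domain of a surjective homomorphism is the product of the orders of its kernel
and its codomain. -/
theorem MonoidHom.card_eq_card_ker_mul_of_surjective {L A : Type*} [Group L] [Group A] (f : L →* A)
    (hf : Function.Surjective f) : Nat.card L = Nat.card f.ker * Nat.card A := by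
  rw [← f.ker.card_mul_index, Subgroup.index_ker, f.range_eq_top_of_surjective hf,
    Subgroup.card_top]

/-- A perfect central extension by a `2`-group of a group of order `60` with elementary abelian
Sylow `2`-subgroups has a kernel of order at most two. -/
theorem card_ker_le_two_of_card_eq_sixty {L A : Type*} [Group L] [Group A] [Finite L]
    (hL : commutator L = ⊤) (f : L →* A) (hf : Function.Surjective f)
    (hN : f.ker ≤ Subgroup.center L) (h2 : IsPGroup 2 f.ker) (hA : Nat.card A = 60)
    (hA2 : ∀ x : A, x ^ 4 = 1 → x ^ 2 = 1) : Nat.card f.ker ≤ 2 := by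
  have h2p : Fact (Nat.Prime 2) := ⟨Nat.prime_two⟩
  obtain ⟨k, hk⟩ := IsPGroup.iff_card.1 h2
  have hcard : Nat.card L = 60 * 2 ^ k := by
    rw [← hk, ← hA, mul_comm, MonoidHom.card_eq_card_ker_mul_of_surjective f hf]
  obtain ⟨T⟩ : Nonempty (Sylow 2 L) := inferInstance
  have hNT : f.ker ≤ T := by
    have h3 := h2.to_sup_of_normal_left T.2
    rw [← T.3 h3 le_sup_right]
    exact le_sup_left
  obtain ⟨m, hm⟩ := IsPGroup.iff_card.1 T.2
  have hTi := T.not_dvd_index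
  have hmk : m = k + 2 ∧ (T : Subgroup L).index = 15 := by
    have h3 := (T : Subgroup L).card_mul_index
    rw [hm, hcard, show 60 * 2 ^ k = 2 ^ (k + 2) * 15 by ring] at h3
    set i := (T : Subgroup L).index
    have hi2 : Nat.Coprime 2 i := (Nat.Prime.coprime_iff_not_dvd Nat.prime_two).2 hTi
    have h4 : 2 ^ m ∣ 2 ^ (k + 2) :=
      (Nat.Coprime.pow_left m (by norm_num : Nat.Coprime 2 15)).dvd_of_dvd_mul_right ⟨i, h3.symm⟩
    have h5 : 2 ^ (k + 2) ∣ 2 ^ m :=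
      (Nat.Coprime.pow_left (k + 2) hi2).dvd_of_dvd_mul_right ⟨15, h3⟩
    have h6 := Nat.dvd_antisymm h4 h5
    refine ⟨Nat.pow_right_injective le_rfl h6, ?_⟩
    rw [h6] at h3
    exact Nat.eq_of_mul_eq_mul_left (by positivity) h3
  have hidx : (f.ker.subgroupOf T).index = 4 := by
    have h3 := (f.ker.subgroupOf T).card_mul_index
    rw [Nat.card_congr (Subgroup.subgroupOfEquivOfLe hNT).toEquiv, hk] at h3
    have h4 : Nat.card (T : Subgroup L) = 2 ^ k * 4 := by rw [hm, hmk.1]; ring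
    exact Nat.eq_of_mul_eq_mul_left (by positivity) (h3.trans h4)
  have hcen : f.ker.subgroupOf T ≤ Subgroup.center T := by
    intro x hx
    rw [Subgroup.mem_center_iff]
    intro y
    exact Subtype.ext (Subgroup.mem_center_iff.1 (hN hx) y)
  have hcT := card_commutator_le_two_of_index_eq_four hcen hidx fun x => by
    rw [Subgroup.mem_subgroupOf, MonoidHom.mem_ker]
    show f ((x : L) ^ 2) = 1
    rw [map_pow]
    apply hA2
    obtain ⟨l, hl⟩ := T.2 x
    have h3 : f x ^ 2 ^ l = 1 := by
      rw [← map_pow]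
      have := congrArg (fun z : T => f z) hl
      simpa using this
    have h4 : f x ^ 60 = 1 := by rw [← hA]; exact pow_card_eq_one'
    rw [← orderOf_dvd_iff_pow_eq_one] at h3 h4 ⊢
    obtain ⟨j, -, hj⟩ := (Nat.dvd_prime_pow Nat.prime_two).1 h3
    rw [hj] at h4 ⊢
    exact (Nat.Coprime.pow_left j (by norm_num : Nat.Coprime 2 15)).dvd_of_dvd_mul_right h4
  refine le_trans ?_ hcT
  have hle : ∀ n (hn : n ∈ f.ker), (⟨n, hNT hn⟩ : T) ∈ commutator T := by
    intro n hn
    have h3 : MonoidHom.transfer (Abelianization.of (G := T)) n = 1 := by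
      have h4 := Abelianization.commutator_subset_ker (MonoidHom.transfer (Abelianization.of (G := T)))
      rw [hL] at h4
      exact h4 trivial
    rw [MonoidHom.transfer_eq_pow _ n fun j g _ => by
      have h4 : Commute g (n ^ j) := Commute.pow_right (Subgroup.mem_center_iff.1 (hN hn) g) j
      rw [mul_assoc, ← h4.eq, inv_mul_cancel_left]] at h3
    have h5 := (Abelianization.ker_of T).le (MonoidHom.mem_ker.2 h3)
    have h6 : (⟨n, hNT hn⟩ : T) ^ 15 ∈ commutator T := by
      have h7 : (⟨n, hNT hn⟩ : T) ^ 15 =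
          ⟨n ^ (T : Subgroup L).index, (T : Subgroup L).pow_mem (hNT hn) _⟩ := Subtype.ext (by rw [hmk.2]; rfl)
      rw [h7]
      exact h5
    obtain ⟨l, hl⟩ := T.2 ⟨n, hNT hn⟩
    have h7 : (15 : ℕ).Coprime (orderOf (⟨n, hNT hn⟩ : T)) := by
      have h8 := orderOf_dvd_of_pow_eq_one hl
      exact Nat.Coprime.coprime_dvd_right h8 (Nat.Coprime.pow_right l (by norm_num))
    exact Subgroup.zpowers_le.2 h6 (mem_zpowers_pow_iff.2 h7)
  exact Nat.card_le_card_of_injective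
    (fun n : f.ker => (⟨⟨n, hNT n.2⟩, hle n n.2⟩ : commutator T)) fun a b hab => by
      have h3 := congrArg (fun z : commutator (T : Subgroup L) => ((z : (T : Subgroup L)) : L)) hab
      exact Subtype.ext h3

/-- A surjection of finite groups from a subgroup covering the quotient of a perfect group by a
central subgroup is onto. -/
theorem eq_top_of_forall_exists_map_eq {G A : Type*} [Group G] [Group A]
    (hG : commutator G = ⊤) (f : G →* A) (hf : f.ker ≤ Subgroup.center G) (M : Subgroup G)
    (hM : ∀ g, ∃ m ∈ M, f m = f g) : M = ⊤ := by
  rw [eq_top_iff, ← hG, commutator_def, Subgroup.commutator_le]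
  intro x _ y _
  obtain ⟨m, hm, hmx⟩ := hM x
  obtain ⟨n, hn, hny⟩ := hM y
  have hx : m⁻¹ * x ∈ Subgroup.center G := hf (by
    rw [MonoidHom.mem_ker, map_mul, map_inv, hmx, inv_mul_cancel])
  have hy : n⁻¹ * y ∈ Subgroup.center G := hf (by
    rw [MonoidHom.mem_ker, map_mul, map_inv, hny, inv_mul_cancel])
  obtain ⟨a, rfl⟩ : ∃ a, x = m * a := ⟨m⁻¹ * x, by group⟩
  obtain ⟨b, rfl⟩ : ∃ b, y = n * b := ⟨n⁻¹ * y, by group⟩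
  rw [inv_mul_cancel_left] at hx hy
  have ha := Subgroup.mem_center_iff.1 hx
  have hb := Subgroup.mem_center_iff.1 hy
  have h1 : ⁅m * a, n * b⁆ = ⁅m, n⁆ := by
    have e1 : m * a * (n * b) = m * n * (a * b) := by
      rw [mul_assoc, ← mul_assoc a, ← ha n]; simp only [mul_assoc]
    have e2 : n * b * (m * a) = n * m * (a * b) := by
      rw [mul_assoc, ← mul_assoc b, ← hb m, ← ha b]; simp only [mul_assoc]
    rw [commutatorElement_def, commutatorElement_def, mul_assoc _ (m * a)⁻¹, ← mul_inv_rev,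
      mul_assoc _ m⁻¹, ← mul_inv_rev, e1, e2, mul_inv_rev]
    group
  rw [h1, commutatorElement_def]
  exact mul_mem (mul_mem (mul_mem hm hn) (inv_mem hm)) (inv_mem hn)

/-- Elements of a kernel of order two square to one. -/
theorem MonoidHom.pow_two_eq_one_of_card_ker_eq_two {G A : Type*} [Group G] [Group A] (f : G →* A)
    (hf : Nat.card f.ker = 2) {x : G} (hx : f x = 1) : x ^ 2 = 1 := by
  have h1 : (⟨x, hx⟩ : f.ker) ^ 2 = 1 := by rw [← hf]; exact pow_card_eq_one'
  exact congrArg Subtype.val h1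

/-- Perfect central extensions by groups of order two of a group of order `60` with elementary
abelian Sylow `2`-subgroups are isomorphic. -/
theorem nonempty_mulEquiv_of_card_ker_eq_two {G S A : Type*} [Group G] [Group S] [Group A]
    [Finite G] [Finite S] (hG : commutator G = ⊤) (hS : commutator S = ⊤)
    (α : G →* A) (hα : Function.Surjective α) (β : S →* A) (hβ : Function.Surjective β)
    (hαc : α.ker ≤ Subgroup.center G) (hβc : β.ker ≤ Subgroup.center S)
    (hα2 : Nat.card α.ker = 2) (hβ2 : Nat.card β.ker = 2) (hA : Nat.card A = 60)
    (hA2 : ∀ x : A, x ^ 4 = 1 → x ^ 2 = 1) : Nonempty (G ≃* S) := by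
  have hAp : commutator A = ⊤ := by
    have : Group.IsPerfect G := ⟨hG⟩
    exact (Group.IsPerfect.ofSurjective hα).commutator_eq_top
  let γ : G × S →* A := α.comp (MonoidHom.fst G S)
  let 𝓛 : Set (Subgroup (G × S)) := {L | (∀ x ∈ L, α x.1 = β x.2) ∧ L.map γ = ⊤}
  have hne : 𝓛.Nonempty := by
    refine ⟨(α.comp (MonoidHom.fst G S)).eqLocus (β.comp (MonoidHom.snd G S)), fun x hx => hx, ?_⟩
    rw [eq_top_iff]
    intro a _
    obtain ⟨g, rfl⟩ := hα a
    obtain ⟨s, hs⟩ := hβ (α g)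
    exact ⟨(g, s), hs.symm, rfl⟩
  obtain ⟨L, ⟨hL1, hL2⟩, hmin⟩ := (wellFounded_lt (α := Subgroup (G × S))).has_min 𝓛 hne
  have hLp : commutator L = ⊤ := by
    have h1 : ⁅L, L⁆ ≤ L := Subgroup.commutator_le.2 fun x hx y hy =>
      mul_mem (mul_mem (mul_mem hx hy) (inv_mem hx)) (inv_mem hy)
    have h2 : ⁅L, L⁆ ∈ 𝓛 := by
      refine ⟨fun x hx => hL1 x (h1 hx), ?_⟩
      rw [Subgroup.map_commutator, hL2, ← commutator_def, hAp]
    have h3 : ⁅L, L⁆ = L := by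
      by_contra h
      exact hmin _ h2 (lt_of_le_of_ne h1 h)
    have := Subgroup.isPerfect_iff.2 h3
    exact this.commutator_eq_top
  let f : L →* A := γ.comp L.subtype
  have hf : Function.Surjective f := by
    intro a
    have : a ∈ L.map γ := hL2 ▸ Subgroup.mem_top a
    obtain ⟨x, hx, rfl⟩ := this
    exact ⟨⟨x, hx⟩, rfl⟩
  have hker : ∀ x : L, f x = 1 → α x.1.1 = 1 ∧ β x.1.2 = 1 := fun x hx =>
    ⟨hx, (hL1 x x.2) ▸ hx⟩
  have hfc : f.ker ≤ Subgroup.center L := by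
    intro x hx
    obtain ⟨h1, h2⟩ := hker x hx
    rw [Subgroup.mem_center_iff]
    intro y
    refine Subtype.ext (Prod.ext ?_ ?_)
    · exact Subgroup.mem_center_iff.1 (hαc h1) y.1.1
    · exact Subgroup.mem_center_iff.1 (hβc h2) y.1.2
  have hf2 : IsPGroup 2 f.ker := by
    intro x
    obtain ⟨h1, h2⟩ := hker x x.2
    refine ⟨1, Subtype.ext (Subtype.ext (Prod.ext ?_ ?_))⟩
    · rw [pow_one]; exact α.pow_two_eq_one_of_card_ker_eq_two hα2 h1
    · rw [pow_one]; exact β.pow_two_eq_one_of_card_ker_eq_two hβ2 h2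
  have hcard := card_ker_le_two_of_card_eq_sixty hLp f hf hfc hf2 hA hA2
  have hLc : Nat.card L ≤ 120 := by
    rw [f.card_eq_card_ker_mul_of_surjective hf, hA]; omega
  have hGc : Nat.card G = 120 := by
    rw [α.card_eq_card_ker_mul_of_surjective hα, hA, hα2]
  have hSc : Nat.card S = 120 := by
    rw [β.card_eq_card_ker_mul_of_surjective hβ, hA, hβ2]
  let p : L →* G := (MonoidHom.fst G S).comp L.subtype
  let q : L →* S := (MonoidHom.snd G S).comp L.subtype
  have hp : Function.Surjective p := by
    rw [← MonoidHom.range_eq_top]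
    refine eq_top_of_forall_exists_map_eq hG α hαc _ fun g => ?_
    obtain ⟨x, hx⟩ := hf (α g)
    exact ⟨_, ⟨x, rfl⟩, hx⟩
  have hq : Function.Surjective q := by
    rw [← MonoidHom.range_eq_top]
    refine eq_top_of_forall_exists_map_eq hS β hβc _ fun g => ?_
    obtain ⟨x, hx⟩ := hf (β g)
    exact ⟨_, ⟨x, rfl⟩, (hL1 x x.2).symm.trans hx⟩
  have hp' : Function.Bijective p := (Nat.bijective_iff_surjective_and_card p).2
    ⟨hp, le_antisymm (hGc ▸ hLc) (Nat.card_le_card_of_surjective p hp)⟩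
  have hq' : Function.Bijective q := (Nat.bijective_iff_surjective_and_card q).2
    ⟨hq, le_antisymm (hSc ▸ hLc) (Nat.card_le_card_of_surjective q hq)⟩
  exact ⟨(MulEquiv.ofBijective p hp').symm.trans (MulEquiv.ofBijective q hq')⟩

/-- The invariant in `ZMod 5` of a matrix `!![x, y; z, -x]` of determinant one over `ZMod 5`. It
separates the five classes of such matrices that generate a common quaternion subgroup. -/
def quaternionClass (x y z : ZMod 5) : ZMod 5 :=
  if z = 0 then 3 * x * y else x * z * z * z

/-- The action of the matrix `!![a, b; c, d]` on the classes of `quaternionClass`. -/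
def conjQuaternionClass (a b c d i : ZMod 5) : ZMod 5 :=
  quaternionClass (2 * a * d + 2 * b * c - a * c * i) (a * a * i + a * b) (4 * c * d - c * c * i)

theorem quaternionClass_conj : ∀ a b c d : ZMod 5, a * d - b * c = 1 → ∀ x y z : ZMod 5,
    x * x + y * z = -1 →
    quaternionClass (a * d * x + b * c * x + b * d * z - a * c * y)
      (a * a * y - b * b * z - 2 * a * b * x) (d * d * z - c * c * y + 2 * c * d * x) =
    conjQuaternionClass a b c d (quaternionClass x y z) := by
  decide +kernel

theorem conjQuaternionClass_eq_self : ∀ a b c d : ZMod 5, a * d - b * c = 1 →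
    (∀ i, conjQuaternionClass a b c d i = i) → b = 0 ∧ c = 0 ∧ a = d ∧ (a = 1 ∨ a = -1) := by
  decide +kernel

theorem conjQuaternionClass_one : ∀ i, conjQuaternionClass 1 0 0 1 i = i := by
  decide +kernel

theorem conjQuaternionClass_neg_one : ∀ i, conjQuaternionClass (-1) 0 0 (-1) i = i := by
  decide +kernel

theorem card_det_eq_one : Fintype.card {p : (ZMod 5 × ZMod 5) × (ZMod 5 × ZMod 5) //
    p.1.1 * p.2.2 - p.1.2 * p.2.1 = 1} = 120 := by
  decide +kernel

theorem conjQuaternionClass_mul {a b c d a' b' c' d' : ZMod 5} (h : a * d - b * c = 1)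
    (h' : a' * d' - b' * c' = 1) (i : ZMod 5) :
    conjQuaternionClass (a * a' + b * c') (a * b' + b * d') (c * a' + d * c') (c * b' + d * d') i =
      conjQuaternionClass a b c d (conjQuaternionClass a' b' c' d' i) := by
  conv_rhs => rw [conjQuaternionClass.eq_1 a' b' c' d']
  rw [← quaternionClass_conj a b c d h, conjQuaternionClass]
  · have h5 : (5 : ZMod 5) = 0 := rfl
    congr 1
    · linear_combination (a * a' * c * b') * h5
    · linear_combination (a * a' * b * d' + a * b * c' * b' + b * b * c' * d') * h5
    · linear_combination (c * c * a' * b') * h5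
  · have h5 : (5 : ZMod 5) = 0 := rfl
    linear_combination 4 * (a' * d' - b' * c' + 1) * h' +
      (1 + 4 * a' * d' * b' * c' - a' * b' * c' * c' * i) * h5

theorem Matrix.SpecialLinearGroup.mul_sub_mul_eq_one {R : Type*} [CommRing R]
    (A : Matrix.SpecialLinearGroup (Fin 2) R) : A 0 0 * A 1 1 - A 0 1 * A 1 0 = 1 := by
  rw [← Matrix.det_fin_two]
  exact A.2

/-- The action of `SL(2, 5)` on the five classes of `quaternionClass`. -/
def slTwoFiveToPerm : Matrix.SpecialLinearGroup (Fin 2) (ZMod 5) →* Equiv.Perm (ZMod 5) :=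
  MonoidHom.toHomPerm
    { toFun := fun A => conjQuaternionClass (A 0 0) (A 0 1) (A 1 0) (A 1 1)
      map_one' := funext conjQuaternionClass_one
      map_mul' := fun A B => funext fun i => by
        have h := conjQuaternionClass_mul A.mul_sub_mul_eq_one B.mul_sub_mul_eq_one i
        simp only [Matrix.SpecialLinearGroup.coe_mul, Matrix.mul_apply, Fin.sum_univ_two]
        exact h }

theorem slTwoFiveToPerm_apply (A : Matrix.SpecialLinearGroup (Fin 2) (ZMod 5)) (i : ZMod 5) :
    slTwoFiveToPerm A i = conjQuaternionClass (A 0 0) (A 0 1) (A 1 0) (A 1 1) i := rfl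

theorem mem_ker_slTwoFiveToPerm (A : Matrix.SpecialLinearGroup (Fin 2) (ZMod 5)) :
    A ∈ slTwoFiveToPerm.ker ↔ A = 1 ∨ A = -1 := by
  constructor
  · intro h
    obtain ⟨h1, h2, h3, h4⟩ := conjQuaternionClass_eq_self _ _ _ _ A.mul_sub_mul_eq_one fun i => by
      rw [← slTwoFiveToPerm_apply, MonoidHom.mem_ker.1 h, Equiv.Perm.one_apply]
    refine h4.imp (fun h4 => ?_) fun h4 => ?_
    all_goals
      ext i j
      fin_cases i <;> fin_cases j <;> simp [h1, h2, ← h3, h4]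
  · rintro (rfl | rfl)
    · exact one_mem _
    · refine MonoidHom.mem_ker.2 (Equiv.ext fun i => ?_)
      rw [slTwoFiveToPerm_apply]
      simpa using conjQuaternionClass_neg_one i

theorem card_slTwoFive : Nat.card (Matrix.SpecialLinearGroup (Fin 2) (ZMod 5)) = 120 := by
  rw [← card_det_eq_one, ← Nat.card_eq_fintype_card]
  refine Nat.card_congr
    { toFun := fun A => ⟨((A 0 0, A 0 1), (A 1 0, A 1 1)), A.mul_sub_mul_eq_one⟩
      invFun := fun p => ⟨!![p.1.1.1, p.1.1.2; p.1.2.1, p.1.2.2], by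
        rw [Matrix.det_fin_two_of]; exact p.2⟩
      left_inv := fun A => by
        ext i j
        fin_cases i <;> fin_cases j <;> rfl
      right_inv := fun p => rfl }

theorem commutator_slTwoFive_eq_top :
    commutator (Matrix.SpecialLinearGroup (Fin 2) (ZMod 5)) = ⊤ := by
  have h1 : (2 : ZMod 5) ≠ 0 := by decide
  have h2 : (2 : ZMod 5) ^ 2 ≠ 1 := by decide
  have : Fact (Nat.Prime 5) := ⟨Nat.prime_five⟩
  exact Matrix.SL2.commutator_eq_top h1 h2

/-- The group `SL(2, 5)` is a central extension of the alternating group of degree five by a group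
of order two. -/
theorem exists_slTwoFive_surjective :
    ∃ β : Matrix.SpecialLinearGroup (Fin 2) (ZMod 5) →* alternatingGroup (Fin 5),
      Function.Surjective β ∧ β.ker ≤ Subgroup.center _ ∧ Nat.card β.ker = 2 := by
  let f : Matrix.SpecialLinearGroup (Fin 2) (ZMod 5) →* Equiv.Perm (Fin 5) := slTwoFiveToPerm
  have hf : ∀ A, f A ∈ alternatingGroup (Fin 5) := by
    intro A
    rw [Equiv.Perm.mem_alternatingGroup]
    have h := Abelianization.commutator_subset_ker (Equiv.Perm.sign.comp f)
    rw [commutator_slTwoFive_eq_top] at h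
    exact h (Subgroup.mem_top A)
  have hmem : ∀ A, A ∈ (f.codRestrict _ hf).ker ↔ A = 1 ∨ A = -1 := fun A => by
    rw [MonoidHom.ker_codRestrict]
    exact mem_ker_slTwoFiveToPerm A
  have hker : Nat.card (f.codRestrict _ hf).ker = 2 := by
    rw [Nat.card_eq_two_iff]
    refine ⟨1, ⟨-1, (hmem _).2 (Or.inr rfl)⟩, ?_, ?_⟩
    · intro h
      have h1 := congrArg (fun A => (A.1 : Matrix.SpecialLinearGroup (Fin 2) (ZMod 5)) 0 0) h
      revert h1
      simp
      decide
    · rw [Set.eq_univ_iff_forall]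
      rintro ⟨A, hA⟩
      rcases (hmem A).1 hA with rfl | rfl
      · exact Or.inl rfl
      · exact Or.inr rfl
  refine ⟨f.codRestrict _ hf, ?_, ?_, hker⟩
  · have h1 := (f.codRestrict _ hf).ker.card_mul_index
    rw [card_slTwoFive, hker, Subgroup.index_ker] at h1
    have h2 : Nat.card (alternatingGroup (Fin 5)) = 60 := by
      rw [nat_card_alternatingGroup, Nat.card_fin]; rfl
    rw [← MonoidHom.range_eq_top]
    exact Subgroup.eq_top_of_card_eq _ (by omega)
  · intro A hA
    rw [Subgroup.mem_center_iff]
    intro B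
    rcases (hmem A).1 hA with rfl | rfl
    · rw [mul_one, one_mul]
    · rw [mul_neg, neg_mul, mul_one, one_mul]

theorem isNilpotent_or_minimalNonNilpotent_of_surjective {X Y : Type*} [Group X] [Group Y]
    (f : X →* Y) (hf : Function.Surjective f)
    (h : Group.IsNilpotent X ∨ MinimalNonNilpotent X) :
    Group.IsNilpotent Y ∨ MinimalNonNilpotent Y := by
  rcases h with h | h
  · exact Or.inl (Group.nilpotent_of_surjective f hf)
  · refine or_iff_not_imp_left.2 fun hY => ⟨hY, fun H hH => ?_⟩
    have := h.2 (H.comap f) fun htop => hH (by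
      rw [← Subgroup.map_comap_eq_self_of_surjective hf H, htop,
        Subgroup.map_top_of_surjective f hf])
    exact Group.nilpotent_of_surjective (f.subgroupComap H)
      (f.subgroupComap_surjective_of_surjective H hf)

theorem MinimalNonNilpotent.isSolvable {G : Type*} [Group G] [Finite G]
    (h : MinimalNonNilpotent G) : Group.IsSolvable G :=
  isSolvable_of_proper_isNilpotent h.2

theorem isSolvable_of_normal_of_quotient {G : Type*} [Group G] {N : Subgroup G} [N.Normal]
    (h1 : Group.IsSolvable N) (h2 : Group.IsSolvable (G ⧸ N)) : Group.IsSolvable G :=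
  Group.isSolvable_of_ker_le_range N.subtype (QuotientGroup.mk' N) (by simp)

section
variable {G A : Type*} [Group G] [Group A] [Finite G] [Finite A]

theorem IsSimpleBiminimal.exists_isFrobeniusSylow_two (hA : IsSimpleBiminimal A)
    (h60 : Nat.card A = 60) {p : ℕ} (hp : p = 3 ∨ p = 5) :
    ∃ (P : Sylow p A) (y : A), IsFrobeniusSylow (P : Subgroup A) p 2 y := by
  have hpp : p.Prime := by rcases hp with rfl | rfl <;> norm_num
  have : Fact p.Prime := ⟨hpp⟩
  obtain ⟨P⟩ : Nonempty (Sylow p A) := inferInstance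
  have hc : Nat.card P = p := by
    obtain ⟨n, hn⟩ := IsPGroup.iff_card.1 P.2
    have h1 : p ∣ p ^ n := hn ▸ P.dvd_card_of_dvd_card (by rw [h60]; rcases hp with rfl | rfl <;> norm_num)
    have h2 : p ^ n ∣ 60 := hn ▸ h60 ▸ (P : Subgroup A).card_subgroup_dvd_card
    have h3 : ¬ p ^ 2 ∣ 60 := by rcases hp with rfl | rfl <;> norm_num
    have h4 : n < 2 := by
      by_contra h
      exact h3 ((pow_dvd_pow p (by omega)).trans h2)
    have h5 : n ≠ 0 := by
      rintro rfl
      exact hpp.one_lt.ne' (Nat.dvd_one.1 h1)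
    rw [hn, show n = 1 by omega, pow_one]
  have hPb : (P : Subgroup A) ≠ ⊥ := by
    rw [← Subgroup.one_lt_card_iff_ne_bot, hc]
    exact hpp.one_lt
  obtain ⟨q, y, h⟩ := hA.exists_isFrobeniusSylow P hPb
  have h1 := h.dvd_card_sub_one
  rw [hc] at h1
  have h2 : q = 2 := by
    rcases hp with rfl | rfl
    · exact (Nat.prime_dvd_prime_iff_eq h.prime Nat.prime_two).1 h1
    · exact (Nat.prime_dvd_prime_iff_eq h.prime Nat.prime_two).1
        (h.prime.dvd_of_dvd_pow (n := 2) h1)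
  exact ⟨P, y, h2 ▸ h⟩

variable (f : G →* A) (hf : Function.Surjective f)
  (hG : ∀ H : Subgroup G, H ≠ ⊤ → Group.IsNilpotent H ∨ MinimalNonNilpotent H)
include hf hG

/-- The preimage of the normalizer of a Sylow subgroup is a minimal non-nilpotent group. -/
theorem exists_isSchmidt_comap_normalizer (hA : IsSimpleBiminimal A) {p q : ℕ} {P : Subgroup A}
    {y : A} (hP : P ≠ ⊤) (h : IsFrobeniusSylow P p q y) :
    ∃ p' q' P' y', IsSchmidt ((Subgroup.normalizer (P : Set A)).comap f) p' q' P' y' := by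
  have h1 := h.schmidt.not_isNilpotent
  have htop : (Subgroup.normalizer (P : Set A)).comap f ≠ ⊤ := by
    intro ht
    refine hA.normalizer_ne_top h.ne_bot hP ?_
    rw [← Subgroup.map_comap_eq_self_of_surjective hf (Subgroup.normalizer (P : Set A)), ht,
      Subgroup.map_top_of_surjective f hf]
  refine ((hG _ htop).resolve_left fun hn => h1 ?_).exists_isSchmidt
  exact Group.nilpotent_of_surjective (f.subgroupComap _)
    (f.subgroupComap_surjective_of_surjective _ hf)

theorem eq_or_eq_two_of_dvd_card_ker (hA : IsSimpleBiminimal A) {p r : ℕ} [Fact p.Prime]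
    (hp2 : p ≠ 2) {P : Sylow p A} {y : A} (h : IsFrobeniusSylow (P : Subgroup A) p 2 y)
    (hr : r.Prime) (hd : r ∣ Nat.card f.ker) : r = p ∨ r = 2 := by
  obtain ⟨p', q', P', y', hS⟩ := exists_isSchmidt_comap_normalizer f hf hG hA
    (hA.ne_top_of_isPGroup P.2) h
  have hpp : p.Prime := Fact.out
  have h1 : r ∣ Nat.card ((Subgroup.normalizer ((P : Subgroup A) : Set A)).comap f) :=
    hd.trans (Subgroup.card_dvd_of_le (f.ker_le_comap _))
  have h2 : Nat.card (Subgroup.normalizer ((P : Subgroup A) : Set A)) ∣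
      Nat.card ((Subgroup.normalizer ((P : Subgroup A) : Set A)).comap f) :=
    Subgroup.card_dvd_of_surjective (f.subgroupComap _)
      (f.subgroupComap_surjective_of_surjective _ hf)
  rw [h.card_normalizer] at h2
  have h3 := hS.eq_or_eq_of_dvd hr h1
  have h4 := hS.eq_or_eq_of_dvd Nat.prime_two ((dvd_mul_left 2 _).trans h2)
  have h5 : p ∣ Nat.card P := by
    obtain ⟨n, hn⟩ := IsPGroup.iff_card.1 P.2
    rw [hn]
    refine dvd_pow_self p ?_
    rintro rfl
    exact h.one_lt_card.ne' hn
  have h6 := hS.eq_or_eq_of_dvd hpp ((h5.trans (dvd_mul_right _ 2)).trans h2)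
  omega

theorem isPGroup_two_ker (hA : IsSimpleBiminimal A) (h60 : Nat.card A = 60) :
    IsPGroup 2 f.ker := by
  have : Fact (Nat.Prime 3) := ⟨Nat.prime_three⟩
  have : Fact (Nat.Prime 5) := ⟨Nat.prime_five⟩
  obtain ⟨P, y, h3⟩ := hA.exists_isFrobeniusSylow_two h60 (Or.inl rfl)
  obtain ⟨Q, z, h5⟩ := hA.exists_isFrobeniusSylow_two h60 (Or.inr rfl)
  refine IsPGroup.of_card (n := (Nat.card f.ker).primeFactorsList.length) ?_
  refine Nat.eq_prime_pow_of_unique_prime_dvd Nat.card_pos.ne' fun {r} hr hd => ?_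
  have h6 := eq_or_eq_two_of_dvd_card_ker f hf hG hA (by norm_num) h3 hr hd
  have h7 := eq_or_eq_two_of_dvd_card_ker f hf hG hA (by norm_num) h5 hr hd
  omega

omit hG in
/-- The normal subgroup `P'` of the preimage of a Sylow normalizer `P ⋊ ⟨y⟩` is not a `2`-group. -/
theorem ne_two_of_isSchmidt_comap {P : Subgroup A} {p : ℕ} {y : A} (hp2 : p ≠ 2)
    (h : IsFrobeniusSylow P p 2 y) {p' q' : ℕ} {P' : Subgroup G} {y' : G}
    (hS : IsSchmidt ((Subgroup.normalizer (P : Set A)).comap f) p' q' P' y') : p' ≠ 2 := by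
  rintro rfl
  obtain ⟨g, hg⟩ := hf y
  obtain ⟨c, ⟨k, hk⟩, m, hm, hgm⟩ := exists_zpow_decomposition g Nat.prime_two
  have hy2 : y ^ 2 = 1 := h.pow_orderOf
  have h1 : y ^ (1 - c) = 1 := by
    refine pow_eq_one_of_coprime_pow hm ?_ ?_
    · rw [← zpow_natCast, ← zpow_mul, mul_comm, zpow_mul, zpow_natCast, hy2, one_zpow]
    · rw [← hg, ← map_zpow, ← map_pow, hgm, map_one]
  have h2 : f (g ^ c) = y := by
    rw [map_zpow, hg]
    calc y ^ c = y ^ (1 - c) * y ^ c := by rw [h1, one_mul]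
      _ = y := by rw [← zpow_add, sub_add_cancel, zpow_one]
  have h3 : g ^ c ∈ P' := hS.mem_of_pow_eq_one (by
    rw [Subgroup.mem_comap, h2]; exact h.schmidt.mem) hk
  refine h.schmidt.not_commute fun u hu => ?_
  obtain ⟨v, rfl⟩ := hf u
  have h4 : v * g ^ c * v⁻¹ * (g ^ c)⁻¹ ∈ P' :=
    mul_mem (hS.conj_mem v (h.schmidt.le hu) _ h3) (inv_mem h3)
  obtain ⟨l, hl⟩ := hS.isPGroup.exists_pow_eq_one h4
  have h5 : f v * (y * (f v)⁻¹ * y⁻¹) ∈ P :=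
    mul_mem hu (h.schmidt.conj_mem y h.schmidt.mem _ (inv_mem hu))
  have h6 := h.schmidt.disjoint_of_coprime h5 Nat.prime_two hp2 (k := l) (by
    have := congrArg f hl
    simp only [map_pow, map_mul, map_inv, h2, map_one, mul_assoc] at this ⊢
    exact this)
  rw [← mul_assoc, ← mul_assoc, mul_inv_eq_one, mul_inv_eq_iff_eq_mul] at h6
  exact h6

theorem ker_le_center (hA : IsSimpleBiminimal A) (h60 : Nat.card A = 60) :
    f.ker ≤ Subgroup.center G := by
  have : Fact (Nat.Prime 3) := ⟨Nat.prime_three⟩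
  have h2 := isPGroup_two_ker f hf hG hA h60
  obtain ⟨P, y, h⟩ := hA.exists_isFrobeniusSylow_two h60 (Or.inl rfl)
  obtain ⟨p', q', P', y', hS⟩ := exists_isSchmidt_comap_normalizer f hf hG hA
    (hA.ne_top_of_isPGroup P.2) h
  have hp' := ne_two_of_isSchmidt_comap f hf (by norm_num) h hS
  set K := (Subgroup.normalizer ((P : Subgroup A) : Set A)).comap f with hK
  have hNK : f.ker ≤ K := f.ker_le_comap _
  have hq' : q' = 2 := by
    have h3 : Nat.card (Subgroup.normalizer ((P : Subgroup A) : Set A)) ∣ Nat.card K :=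
      Subgroup.card_dvd_of_surjective (f.subgroupComap _)
        (f.subgroupComap_surjective_of_surjective _ hf)
    rw [h.card_normalizer] at h3
    have h4 := hS.eq_or_eq_of_dvd Nat.prime_two ((dvd_mul_left 2 _).trans h3)
    omega
  subst hq'
  obtain ⟨l, hl⟩ := hS.order
  have hyl : y' ^ 2 ^ l = 1 := by rw [← hl, pow_orderOf_eq_one]
  have hsup := h2.to_sup_of_normal_left (isPGroup_zpowers hyl)
  have hcomm : ∀ n ∈ f.ker, ∀ z ∈ P', Commute n z := by
    intro n hn z hz
    have h3 : n * z * n⁻¹ * z⁻¹ ∈ P' := mul_mem (hS.conj_mem n (hNK hn) z hz) (inv_mem hz)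
    have h4 : n * (z * n⁻¹ * z⁻¹) ∈ f.ker :=
      mul_mem hn (f.normal_ker.conj_mem _ (inv_mem hn) z)
    rw [← mul_assoc, ← mul_assoc] at h4
    have h5 := IsPGroup.eq_one_of_mem hS.prime_p Nat.prime_two hp' hS.isPGroup h2 h3 h4
    rw [mul_inv_eq_one, mul_inv_eq_iff_eq_mul] at h5
    exact h5
  have hzp : ∀ n ∈ f.ker, ∃ k : ℤ, n = y' ^ k := by
    intro n hn
    obtain ⟨x, hx, k, rfl⟩ := hS.exists_eq n (hNK hn)
    have h3 : x ∈ f.ker ⊔ Subgroup.zpowers y' := by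
      have h4 : x * y' ^ k * (y' ^ k)⁻¹ ∈ f.ker ⊔ Subgroup.zpowers y' :=
        mul_mem (Subgroup.mem_sup_left hn)
          (inv_mem (Subgroup.mem_sup_right (Subgroup.zpow_mem_zpowers y' k)))
      rwa [mul_inv_cancel_right] at h4
    have h5 := IsPGroup.eq_one_of_mem hS.prime_p Nat.prime_two hp' hS.isPGroup hsup hx h3
    exact ⟨k, by rw [h5, one_mul]⟩
  have hKC : K ≤ Subgroup.centralizer (f.ker : Set G) := by
    intro g hg
    rw [Subgroup.mem_centralizer_iff]
    intro n hn
    obtain ⟨z, hz, j, rfl⟩ := hS.exists_eq g hg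
    obtain ⟨k, hk⟩ := hzp n hn
    refine (hcomm n hn z hz).mul_right ?_
    rw [hk]
    exact ((Commute.refl y').zpow_right j).zpow_left k
  have hCn : (Subgroup.centralizer (f.ker : Set G)).Normal := inferInstance
  have hCt : (Subgroup.centralizer (f.ker : Set G)).map f = ⊤ := by
    refine (hA.eq_bot_or_eq_top _ (hCn.map f hf)).resolve_left fun hb => h.ne_bot ?_
    rw [eq_bot_iff, ← hb, ← Subgroup.map_comap_eq_self_of_surjective hf P]
    exact Subgroup.map_mono ((Subgroup.comap_mono Subgroup.le_normalizer).trans hKC)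
  intro n hn
  rw [Subgroup.mem_center_iff]
  intro g
  obtain ⟨c, hc, hcg⟩ : f g ∈ (Subgroup.centralizer (f.ker : Set G)).map f := hCt ▸ trivial
  have h3 : c⁻¹ * g ∈ Subgroup.centralizer (f.ker : Set G) := by
    refine hKC (hNK ?_)
    rw [MonoidHom.mem_ker, map_mul, map_inv, hcg, inv_mul_cancel]
  have h4 := mul_mem hc h3
  rw [mul_inv_cancel_left] at h4
  exact (Subgroup.mem_centralizer_iff.1 h4 n hn).symm

end

theorem IsSimpleBiminimal.pow_two_eq_one {A : Type*} [Group A] [Finite A]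
    (hA : IsSimpleBiminimal A) {x : A} (hx : x ^ 4 = 1) : x ^ 2 = 1 := by
  have : Fact (Nat.Prime 2) := ⟨Nat.prime_two⟩
  obtain ⟨S, hS⟩ := exists_sylow_mem (p := 2) (k := 2) hx
  by_cases hb : (S : Subgroup A) = ⊥
  · rw [hb, Subgroup.mem_bot] at hS
    rw [hS, one_pow]
  · obtain ⟨q, y, h⟩ := hA.exists_isFrobeniusSylow S hb
    exact h.pow_eq_one x hS

/-- A finite non-solvable group whose proper subgroups are nilpotent or minimal non-nilpotent has a
quotient that is moreover simple. -/
theorem exists_isSimpleBiminimal_quotient {G : Type*} [Group G] [Finite G]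
    (hsol : ¬ Group.IsSolvable G)
    (hG : ∀ H : Subgroup G, H ≠ ⊤ → Group.IsNilpotent H ∨ MinimalNonNilpotent H) :
    ∃ (N : Subgroup G) (_ : N.Normal), IsSimpleBiminimal (G ⧸ N) := by
  have hnt : (⊥ : Subgroup G) ≠ ⊤ := by
    intro h
    refine hsol ?_
    have := Subgroup.subsingleton_iff.1 (subsingleton_of_bot_eq_top h)
    infer_instance
  obtain ⟨N, ⟨hN, hNt⟩, hmax⟩ := (wellFounded_gt (α := Subgroup G)).has_min
    {N : Subgroup G | N.Normal ∧ N ≠ ⊤} ⟨⊥, inferInstance, hnt⟩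
  refine ⟨N, hN, ?_, ?_, ?_⟩
  · intro M hM
    refine or_iff_not_imp_right.2 fun hMt => ?_
    have hsurj := QuotientGroup.mk'_surjective N
    have h1 : M.comap (QuotientGroup.mk' N) ≠ ⊤ := fun h => hMt (by
      rw [← Subgroup.map_comap_eq_self_of_surjective hsurj M, h,
        Subgroup.map_top_of_surjective _ hsurj])
    have h2 : N ≤ M.comap (QuotientGroup.mk' N) := by
      have := (QuotientGroup.mk' N).ker_le_comap M
      rwa [QuotientGroup.ker_mk'] at this
    have h3 : N = M.comap (QuotientGroup.mk' N) := by
      by_contra h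
      exact hmax _ ⟨hM.comap _, h1⟩ (lt_of_le_of_ne h2 h)
    rw [← Subgroup.map_comap_eq_self_of_surjective hsurj M, ← h3, QuotientGroup.map_mk'_self]
  · intro h
    refine hsol (isSolvable_of_normal_of_quotient (N := N) ?_ h)
    rcases hG N hNt with h | h
    · infer_instance
    · exact h.isSolvable
  · intro H hH
    have hsurj := QuotientGroup.mk'_surjective N
    have h1 : H.comap (QuotientGroup.mk' N) ≠ ⊤ := fun h => hH (by
      rw [← Subgroup.map_comap_eq_self_of_surjective hsurj H, h,
        Subgroup.map_top_of_surjective _ hsurj])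
    exact isNilpotent_or_minimalNonNilpotent_of_surjective
      ((QuotientGroup.mk' N).subgroupComap H)
      ((QuotientGroup.mk' N).subgroupComap_surjective_of_surjective H hsurj) (hG _ h1)

theorem commutator_eq_top_of_not_isSolvable {G : Type*} [Group G] [Finite G]
    (hsol : ¬ Group.IsSolvable G)
    (hG : ∀ H : Subgroup G, H ≠ ⊤ → Group.IsNilpotent H ∨ MinimalNonNilpotent H) :
    commutator G = ⊤ := by
  by_contra h
  refine hsol (isSolvable_of_normal_of_quotient (N := commutator G) ?_ ?_)
  · rcases hG _ h with h | h
    · infer_instance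
    · exact h.isSolvable
  · exact inferInstanceAs (Group.IsSolvable (Abelianization G))

/-- A finite insoluble biminimal non-nilpotent group is isomorphic to $A_5$ or to
$\mathrm{SL}(2,5)$. -/
theorem stmt_5 {G : Type*} [Group G] [Finite G]
    (hinsol : ¬ IsSolvable G) (hbi : BiminimalNonNilpotent G) :
    Nonempty (G ≃* ↥(alternatingGroup (Fin 5))) ∨
      Nonempty (G ≃* Matrix.SpecialLinearGroup (Fin 2) (ZMod 5)) := by
  have hG := hbi.2.2
  obtain ⟨N, hN, hA⟩ := exists_isSimpleBiminimal_quotient hinsol hG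
  have h2 : 2 ∣ Nat.card (G ⧸ N) := by
    have := Fintype.ofFinite (G ⧸ N)
    exact hA.two_dvd_card
  have h60 := (hA.card_eq_sixty h2).1
  obtain ⟨e⟩ := hA.nonempty_mulEquiv_alternatingGroup h2
  have hperf := commutator_eq_top_of_not_isSolvable hinsol hG
  have hsurj := QuotientGroup.mk'_surjective N
  have hcen := ker_le_center (QuotientGroup.mk' N) hsurj hG hA h60
  have hcard := card_ker_le_two_of_card_eq_sixty hperf (QuotientGroup.mk' N) hsurj hcen
    (isPGroup_two_ker (QuotientGroup.mk' N) hsurj hG hA h60) h60 fun x => hA.pow_two_eq_one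
  have hpos : 0 < Nat.card (QuotientGroup.mk' N).ker := Nat.card_pos
  obtain h1 | h1 : Nat.card (QuotientGroup.mk' N).ker = 1 ∨
      Nat.card (QuotientGroup.mk' N).ker = 2 := by omega
  · left
    have hinj := (MonoidHom.ker_eq_bot_iff _).1 (Subgroup.card_eq_one.1 h1)
    exact ⟨(MulEquiv.ofBijective (QuotientGroup.mk' N) ⟨hinj, hsurj⟩).trans e⟩
  · right
    obtain ⟨β, hβ, hβc, hβ2⟩ := exists_slTwoFive_surjective
    have hker : (e.toMonoidHom.comp (QuotientGroup.mk' N)).ker = (QuotientGroup.mk' N).ker :=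
      MonoidHom.ker_mulEquiv_comp _ e
    refine nonempty_mulEquiv_of_card_ker_eq_two hperf commutator_slTwoFive_eq_top
      (e.toMonoidHom.comp (QuotientGroup.mk' N)) (e.surjective.comp hsurj) β hβ (hker ▸ hcen) hβc
      (hker ▸ h1) hβ2 ?_ fun x hx => ?_
    · rw [← Nat.card_congr e.toEquiv, h60]
    · have h3 := hA.pow_two_eq_one (x := e.symm x) (by rw [← map_pow, hx, map_one])
      rwa [← map_pow, map_eq_one_iff e.symm e.symm.injective] at h3
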